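/- For every exponent p in (1,2) ∪ (2,∞) there exists an integer d_p ≥ 2 such that for every integer d ≥ d_p the following holds: for every measurable set A ⊆ ℝ^d with positive upper Banach density δ̄_d(A) > 0 there exists λ₀ > 0 such that for every real number λ ≥ λ₀ there exist x, s ∈ ℝ^d with x ∈ A, x+s ∈ A, x+2s ∈ A and ‖s‖_{ℓ^p} = λ. -/

import Mathlib

open MeasureTheory Filter
open scoped ENNReal

/-- The `ℓ^p` norm of a vector in `ℝ^d`. -/
noncomputable def lpNorm {d : ℕ} (p : ℝ) (s : Fin d → ℝ) : ℝ :=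
  (∑ i, |s i| ^ p) ^ (1 / p)

/-- Upper Banach density of a subset of `ℝ^d`. -/
noncomputable def upperBanachDensity (d : ℕ) (A : Set (Fin d → ℝ)) : ℝ≥0∞ :=
  Filter.limsup (fun N : ℝ =>
    ⨆ x : Fin d → ℝ,
      volume (A ∩ Set.Icc x (x + fun _ => N)) / ENNReal.ofReal (N ^ d)) Filter.atTop

section Kernels

set_option linter.unusedSectionVars false

variable {G : Type} [AddCommGroup G] [Fintype G]

/-- The average `∑ t, q t * F (x + t)` of `F` against the kernel `q`. -/
def kerAct (q F : G → ℝ) (x : G) : ℝ := ∑ t, q t * F (x + t)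

/-- A kernel which is a probability density for the counting measure. -/
structure IsProbKer (q : G → ℝ) : Prop where
  nonneg : ∀ t, 0 ≤ q t
  sum_one : ∑ t, q t = 1

/-- The kernel `q` moves by at most `η` in `ℓ¹` under translation by `t`, in dual form. -/
def NearInv (q : G → ℝ) (t : G) (η : ℝ) : Prop :=
  ∀ φ : G → ℝ, (∀ x, |φ x| ≤ 1) → |∑ s, q s * φ (s + t) - ∑ s, q s * φ s| ≤ η

/-- The autocorrelation of a kernel. -/
def kerCorr (u : G → ℝ) (g : G) : ℝ := ∑ t, u t * u (t + g)

/-- The squared `ℓ²` norm of the average of `F` against `u`. -/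
def energy (u F : G → ℝ) : ℝ := ∑ x, kerAct u F x ^ 2

/-- The product of `f` with its translate by `r`. -/
def pairProd (f : G → ℝ) (r x : G) : ℝ := f x * f (x + r)

/-- The number of parallelograms with sides `r` and `k`, weighted by `f`. -/
def quadSum (f : G → ℝ) (r k : G) : ℝ := ∑ x, pairProd f r x * pairProd f r (x + k)

/-- The energies of the products of `f` with its translates, averaged over differences of
`φ`-distributed elements. -/
def boxEnergy (f φ u : G → ℝ) : ℝ := ∑ t, ∑ t', φ t * φ t' * energy u (pairProd f (t' - t))

theorem sum_shift (F : G → ℝ) (t : G) : ∑ x, F (x + t) = ∑ x, F x :=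
  Fintype.sum_equiv (Equiv.addRight t) _ _ (fun _ => rfl)

theorem kerAct_comm (q q' F : G → ℝ) (x : G) :
    kerAct q (kerAct q' F) x = kerAct q' (kerAct q F) x := by
  simp only [kerAct, Finset.mul_sum]
  rw [Finset.sum_comm]
  refine Finset.sum_congr rfl fun s _ => Finset.sum_congr rfl fun t _ => ?_
  rw [add_right_comm]; ring

theorem abs_sum_ker_le {q φ : G → ℝ} (hq : ∀ t, 0 ≤ q t) {C : ℝ}
    (hφ : ∀ t, q t ≠ 0 → |φ t| ≤ C) : |∑ t, q t * φ t| ≤ (∑ t, q t) * C := by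
  rw [Finset.sum_mul]
  refine (Finset.abs_sum_le_sum_abs _ _).trans (Finset.sum_le_sum fun t _ => ?_)
  rw [abs_mul, abs_of_nonneg (hq t)]
  rcases eq_or_ne (q t) 0 with h | h
  · simp [h]
  · exact mul_le_mul_of_nonneg_left (hφ t h) (hq t)

theorem IsProbKer.abs_sum_le {q φ : G → ℝ} (hq : IsProbKer q) {C : ℝ}
    (hφ : ∀ t, q t ≠ 0 → |φ t| ≤ C) : |∑ t, q t * φ t| ≤ C := by
  simpa [hq.sum_one] using abs_sum_ker_le hq.nonneg hφ

theorem IsProbKer.abs_kerAct_le {q F : G → ℝ} (hq : IsProbKer q) (hF : ∀ x, |F x| ≤ 1) (x : G) :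
    |kerAct q F x| ≤ 1 :=
  hq.abs_sum_le fun _ _ => hF _

theorem IsProbKer.neg {q : G → ℝ} (hq : IsProbKer q) : IsProbKer (fun t => q (-t)) :=
  ⟨fun t => hq.nonneg _, by
    rw [← hq.sum_one]; exact Fintype.sum_equiv (Equiv.neg G) _ _ (fun _ => rfl)⟩

theorem IsProbKer.sq_sum_le {q φ : G → ℝ} (hq : IsProbKer q) :
    (∑ t, q t * φ t) ^ 2 ≤ ∑ t, q t * φ t ^ 2 := by
  obtain ⟨m, hm⟩ : ∃ m, m = ∑ s, q s * φ s := ⟨_, rfl⟩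
  have h := Finset.sum_nonneg (s := Finset.univ)
    (fun t _ => mul_nonneg (hq.nonneg t) (sq_nonneg (φ t - m)))
  have e : ∑ t, q t * (φ t - m) ^ 2
      = ∑ t, q t * φ t ^ 2 - 2 * m * (∑ t, q t * φ t) + m ^ 2 * ∑ t, q t := by
    rw [Finset.mul_sum, Finset.mul_sum, ← Finset.sum_sub_distrib, ← Finset.sum_add_distrib]
    exact Finset.sum_congr rfl fun t _ => by ring
  rw [e, hq.sum_one, ← hm] at h
  rw [← hm]
  linarith

theorem IsProbKer.energy_le {q : G → ℝ} (hq : IsProbKer q) (F : G → ℝ) :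
    energy q F ≤ ∑ x, F x ^ 2 := by
  calc energy q F ≤ ∑ x, ∑ t, q t * F (x + t) ^ 2 := Finset.sum_le_sum fun x _ => hq.sq_sum_le
    _ = ∑ t, q t * ∑ x, F (x + t) ^ 2 := by
        rw [Finset.sum_comm]; simp only [Finset.mul_sum]
    _ = ∑ x, F x ^ 2 := by
        simp only [sum_shift (fun x => F x ^ 2)]
        rw [← Finset.sum_mul, hq.sum_one, one_mul]

theorem sum_kerAct_mul (u X Y : G → ℝ) :
    ∑ x, kerAct u X x * Y x = ∑ x, X x * kerAct (fun t => u (-t)) Y x := by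
  simp only [kerAct, Finset.mul_sum, Finset.sum_mul]
  rw [Finset.sum_comm]
  conv_rhs => rw [Finset.sum_comm]
  refine Fintype.sum_equiv (Equiv.neg G) _ _ fun t => ?_
  refine Fintype.sum_equiv (Equiv.addRight t) _ _ fun x => ?_
  simp only [Equiv.neg_apply, Equiv.coe_addRight, neg_neg, add_neg_cancel_right]
  ring

theorem kerAct_kerCorr (u F : G → ℝ) (x : G) :
    kerAct (kerCorr u) F x = kerAct (fun t => u (-t)) (kerAct u F) x := by
  simp only [kerAct, kerCorr, Finset.mul_sum, Finset.sum_mul]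
  rw [Finset.sum_comm]
  refine Fintype.sum_equiv (Equiv.neg G) _ _ fun t => ?_
  refine Fintype.sum_equiv (Equiv.addLeft t) _ _ fun g => ?_
  simp only [Equiv.neg_apply, Equiv.coe_addLeft, neg_neg]
  rw [show x + -t + (t + g) = x + g by abel]; ring

theorem sum_kerCorr_mul (u φ : G → ℝ) :
    ∑ g, kerCorr u g * φ g = ∑ t, u t * ∑ s, u s * φ (s - t) := by
  simp only [kerCorr, Finset.mul_sum, Finset.sum_mul]
  rw [Finset.sum_comm]
  refine Finset.sum_congr rfl fun t _ => ?_
  refine Fintype.sum_equiv (Equiv.addLeft t) _ _ fun g => ?_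
  simp only [Equiv.coe_addLeft, add_sub_cancel_left]; ring

theorem IsProbKer.kerCorr {u : G → ℝ} (hu : IsProbKer u) : IsProbKer (kerCorr u) :=
  ⟨fun g => Finset.sum_nonneg fun t _ => mul_nonneg (hu.nonneg _) (hu.nonneg _), by
    have := sum_kerCorr_mul u (fun _ => 1)
    simpa [hu.sum_one] using this⟩

theorem NearInv.kerAct_sub {q F : G → ℝ} {t : G} {η : ℝ} (h : NearInv q t η)
    (hF : ∀ x, |F x| ≤ 1) (x : G) : |kerAct q F (x + t) - kerAct q F x| ≤ η := by
  have := h (fun s => F (x + s)) (fun s => hF _)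
  simpa only [kerAct, add_assoc, add_comm t] using this

theorem NearInv.neg {q : G → ℝ} {t : G} {η : ℝ} (h : NearInv q t η) : NearInv q (-t) η := by
  intro φ hφ
  have := h (fun s => φ (s + -t)) (fun s => hφ _)
  simp only [add_neg_cancel_right] at this
  rwa [abs_sub_comm]

theorem NearInv.add {q : G → ℝ} {t t' : G} {η η' : ℝ} (h : NearInv q t η) (h' : NearInv q t' η') :
    NearInv q (t + t') (η + η') := by
  intro φ hφ
  have h1 := h φ hφ
  have h2 := h' (fun s => φ (s + t)) (fun s => hφ _)
  have e : ∀ s, s + (t + t') = s + t' + t := fun s => by abel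
  simp only [e]
  calc _ = |(∑ s, q s * φ (s + t' + t) - ∑ s, q s * φ (s + t)) +
      (∑ s, q s * φ (s + t) - ∑ s, q s * φ s)| := by ring_nf
    _ ≤ _ := (abs_add_le _ _).trans (by linarith)

theorem NearInv.mono {q : G → ℝ} {t : G} {η η' : ℝ} (h : NearInv q t η) (hη : η ≤ η') :
    NearInv q t η' := fun φ hφ => (h φ hφ).trans hη

theorem NearInv.zero (q : G → ℝ) {η : ℝ} (hη : 0 ≤ η) : NearInv q 0 η := by
  intro φ _; simpa using hη

theorem kerAct_kerAct_sub {q q' F : G → ℝ} {η : ℝ} (hq' : IsProbKer q')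
    (h : ∀ t, q' t ≠ 0 → NearInv q t η) (hF : ∀ x, |F x| ≤ 1) (x : G) :
    |kerAct q (kerAct q' F) x - kerAct q F x| ≤ η := by
  rw [kerAct_comm]
  have : kerAct q' (kerAct q F) x - kerAct q F x
      = ∑ t, q' t * (kerAct q F (x + t) - kerAct q F x) := by
    simp only [mul_sub, Finset.sum_sub_distrib, ← Finset.sum_mul, hq'.sum_one, one_mul]
    rfl
  rw [this]
  exact hq'.abs_sum_le fun t ht => (h t ht).kerAct_sub hF x

theorem abs_sq_sub_sq_le {x y η C : ℝ} (hx : |x| ≤ C) (hy : |y| ≤ C) (h : |x - y| ≤ η) :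
    |x ^ 2 - y ^ 2| ≤ 2 * C * η := by
  have h1 : |x + y| ≤ 2 * C := (abs_add_le _ _).trans (by linarith)
  rw [sq_sub_sq, abs_mul]
  exact mul_le_mul h1 h (abs_nonneg _) ((abs_nonneg _).trans h1)

theorem sum_sq_le_sum_sq_add {X Y : G → ℝ} {η C : ℝ} (hX : ∀ x, |X x| ≤ C)
    (hY : ∀ x, |Y x| ≤ C) (h : ∀ x, |X x - Y x| ≤ η) :
    ∑ x, X x ^ 2 ≤ ∑ x, Y x ^ 2 + 2 * C * η * Fintype.card G := by
  have : ∑ x, (X x ^ 2 - Y x ^ 2) ≤ ∑ _x : G, 2 * C * η :=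
    Finset.sum_le_sum fun x _ => (le_abs_self _).trans (abs_sq_sub_sq_le (hX x) (hY x) (h x))
  rw [Finset.sum_sub_distrib, Finset.sum_const, Finset.card_univ, nsmul_eq_mul] at this
  linarith

/-- Averaging at a coarser scale decreases the energy. -/
theorem energy_le_energy_add {a b F : G → ℝ} {η : ℝ} (ha : IsProbKer a) (hb : IsProbKer b)
    (hab : ∀ t, a t ≠ 0 → NearInv b t η) (hF : ∀ x, |F x| ≤ 1) :
    energy b F ≤ energy a F + 2 * η * Fintype.card G := by
  have h1 := sum_sq_le_sum_sq_add (X := kerAct b F) (Y := kerAct b (kerAct a F)) (η := η) (C := 1)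
    (hb.abs_kerAct_le hF) (hb.abs_kerAct_le (ha.abs_kerAct_le hF))
    (fun x => by rw [abs_sub_comm]; exact kerAct_kerAct_sub ha hab hF x)
  have h2 := hb.energy_le (kerAct a F)
  simp only [energy] at *
  linarith

theorem sum_mul_kerAct_kerCorr (u F : G → ℝ) :
    ∑ x, F x * kerAct (kerCorr u) F x = energy u F := by
  simp only [kerAct_kerCorr, energy, sq]
  rw [sum_kerAct_mul]

/-- The difference between averages at a fine and a coarse scale is controlled by the drop in
energy. -/
theorem sum_sq_sub_le_energy_sub {a b F : G → ℝ} {η : ℝ} (ha : IsProbKer a) (hb : IsProbKer b)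
    (hab : ∀ t, a t ≠ 0 → NearInv b t η) (hF : ∀ x, |F x| ≤ 1) :
    ∑ x, (kerAct a F x - kerAct (kerCorr b) F x) ^ 2
      ≤ energy a F - energy b F + 6 * η * Fintype.card G := by
  set X := kerAct a F with hX
  have hX1 : ∀ x, |X x| ≤ 1 := ha.abs_kerAct_le hF
  have hP : ∀ x, |kerAct (kerCorr b) X x - kerAct (kerCorr b) F x| ≤ η := by
    intro x
    have : kerAct (kerCorr b) X x - kerAct (kerCorr b) F x
        = ∑ t, b (-t) * (kerAct b X (x + t) - kerAct b F (x + t)) := by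
      simp only [kerAct_kerCorr, mul_sub, Finset.sum_sub_distrib]; rfl
    rw [this]
    exact hb.neg.abs_sum_le fun t _ => kerAct_kerAct_sub ha hab hF _
  have h1 := sum_sq_le_sum_sq_add (X := fun x => X x - kerAct (kerCorr b) F x)
    (Y := fun x => X x - kerAct (kerCorr b) X x) (η := η) (C := 2)
    (fun x => (abs_sub _ _).trans (by linarith [hX1 x, hb.kerCorr.abs_kerAct_le hF x]))
    (fun x => (abs_sub _ _).trans (by linarith [hX1 x, hb.kerCorr.abs_kerAct_le hX1 x]))
    (fun x => by
      rw [show X x - kerAct (kerCorr b) F x - (X x - kerAct (kerCorr b) X x)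
        = kerAct (kerCorr b) X x - kerAct (kerCorr b) F x by ring]
      exact hP x)
  have h2 : ∑ x, (X x - kerAct (kerCorr b) X x) ^ 2 ≤ energy a F - energy b X := by
    have e : ∑ x, (X x - kerAct (kerCorr b) X x) ^ 2
        = ∑ x, X x ^ 2 - 2 * ∑ x, X x * kerAct (kerCorr b) X x
          + ∑ x, kerAct (kerCorr b) X x ^ 2 := by
      rw [Finset.mul_sum, ← Finset.sum_sub_distrib, ← Finset.sum_add_distrib]
      exact Finset.sum_congr rfl fun x _ => by ring
    have h3 : ∑ x, kerAct (kerCorr b) X x ^ 2 ≤ energy b X := by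
      simp only [kerAct_kerCorr]
      exact hb.neg.energy_le _
    rw [e, sum_mul_kerAct_kerCorr]
    have : ∑ x, X x ^ 2 = energy a F := rfl
    linarith
  have h4 := sum_sq_le_sum_sq_add (X := kerAct b F) (Y := kerAct b X) (η := η) (C := 1)
    (hb.abs_kerAct_le hF) (hb.abs_kerAct_le hX1)
    (fun x => by rw [abs_sub_comm]; exact kerAct_kerAct_sub ha hab hF x)
  simp only [energy] at *
  linarith

theorem quadSum_comm (f : G → ℝ) (r k : G) : quadSum f r k = quadSum f k r := by
  refine Finset.sum_congr rfl fun x _ => ?_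
  simp only [pairProd]
  rw [add_right_comm x k r]; ring

theorem energy_pairProd (f φ : G → ℝ) (r : G) :
    energy φ (pairProd f r) = ∑ t, ∑ t', φ t * φ t' * quadSum f r (t' - t) := by
  simp only [energy, kerAct, sq, Finset.sum_mul_sum]
  rw [Finset.sum_comm]
  refine Finset.sum_congr rfl fun t _ => ?_
  rw [Finset.sum_comm]
  refine Finset.sum_congr rfl fun t' _ => ?_
  rw [quadSum, Finset.mul_sum]
  refine Fintype.sum_equiv (Equiv.addRight t) _ _ fun x => ?_
  simp only [Equiv.coe_addRight]
  rw [show x + t + (t' - t) = x + t' by abel]; ring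

theorem boxEnergy_comm (f φ u : G → ℝ) : boxEnergy f φ u = boxEnergy f u φ := by
  have e : ∀ φ u : G → ℝ, boxEnergy f φ u
      = ∑ q : (G × G) × (G × G), φ q.1.1 * φ q.1.2 * (u q.2.1 * u q.2.2)
        * quadSum f (q.1.2 - q.1.1) (q.2.2 - q.2.1) := by
    intro φ u
    simp only [boxEnergy, energy_pairProd, Finset.mul_sum, Fintype.sum_prod_type]
    refine Finset.sum_congr rfl fun t _ => Finset.sum_congr rfl fun t' _ =>
      Finset.sum_congr rfl fun k _ => Finset.sum_congr rfl fun k' _ => by ring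
  rw [e, e]
  refine Fintype.sum_equiv (Equiv.prodComm _ _) _ _ fun q => ?_
  simp only [Equiv.prodComm_apply, Prod.fst_swap, Prod.snd_swap]
  rw [quadSum_comm]; ring

end Kernels

section Trilinear

set_option linter.unusedSectionVars false

variable {G : Type} [AddCommGroup G] [Fintype G]

/-- The number of three-term progressions with gap `s`, weighted by `f`. -/
def apCount (f : G → ℝ) (s : G) : ℝ := ∑ x, f x * f (x + s) * f (x + s + s)

/-- The average of `f ⊗ f` near `(x, y)` in the antidiagonal direction. -/
def antiDiagAvg (f θ : G → ℝ) (x y : G) : ℝ := ∑ t, θ t * (f (x - t) * f (y + t))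

theorem sum_sq_antiDiagAvg (f θ w : G → ℝ) :
    ∑ s, w s * ∑ x, antiDiagAvg f θ x (x + (s + s)) ^ 2
      = ∑ t, ∑ t', θ t * θ t' * ∑ s, w s * quadSum f (t' - t) (s + s + (t + t')) := by
  have h : ∀ s, ∑ x, antiDiagAvg f θ x (x + (s + s)) ^ 2
      = ∑ t, ∑ t', θ t * θ t' * quadSum f (t' - t) (s + s + (t + t')) := by
    intro s
    simp only [antiDiagAvg, sq, Finset.sum_mul_sum]
    rw [Finset.sum_comm]
    refine Finset.sum_congr rfl fun t _ => ?_
    rw [Finset.sum_comm]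
    refine Finset.sum_congr rfl fun t' _ => ?_
    rw [quadSum, Finset.mul_sum]
    refine Fintype.sum_equiv (Equiv.subRight t') _ _ fun x => ?_
    simp only [Equiv.subRight_apply, pairProd]
    rw [show x - t' + (t' - t) = x - t by abel,
      show x - t' + (s + s + (t + t')) = x + (s + s) + t by abel,
      show x + (s + s) + t + (t' - t) = x + (s + s) + t' by abel]
    ring
  simp only [h, Finset.mul_sum]
  rw [Finset.sum_comm]
  refine Finset.sum_congr rfl fun t _ => ?_
  rw [Finset.sum_comm]
  refine Finset.sum_congr rfl fun t' _ => Finset.sum_congr rfl fun s _ => by ring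

theorem sum_ker_apCount (f w q : G → ℝ) :
    ∑ s, w s * ∑ t, q t * apCount f (s + t)
      = ∑ s, w s * ∑ x, f (x + s) * antiDiagAvg f q x (x + (s + s)) := by
  refine Finset.sum_congr rfl fun s _ => ?_
  congr 1
  simp only [apCount, antiDiagAvg, Finset.mul_sum]
  conv_rhs => rw [Finset.sum_comm]
  refine Finset.sum_congr rfl fun t _ => ?_
  refine Fintype.sum_equiv (Equiv.addRight t) _ _ fun x => ?_
  simp only [Equiv.coe_addRight, add_sub_cancel_right]
  rw [show x + (s + t) + (s + t) = x + t + (s + s) + t by abel,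
    show x + (s + t) = x + t + s by abel]
  ring

theorem kerAct_kerCorr_shift {c F : G → ℝ} {y : G} {η : ℝ} (hc : IsProbKer c)
    (h : NearInv c y η) (hF : ∀ x, |F x| ≤ 1) (x : G) :
    |kerAct (kerCorr c) F (x + y) - kerAct (kerCorr c) F x| ≤ η := by
  have : kerAct (kerCorr c) F (x + y) - kerAct (kerCorr c) F x
      = ∑ t, c (-t) * (kerAct c F (x + t + y) - kerAct c F (x + t)) := by
    simp only [kerAct_kerCorr, mul_sub, Finset.sum_sub_distrib]
    simp only [add_right_comm x _ y]; rfl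
  rw [this]
  exact hc.neg.abs_sum_le fun t _ => h.kerAct_sub hF _

theorem abs_pairProd_le {f : G → ℝ} (hf : ∀ x, |f x| ≤ 1) (r x : G) : |pairProd f r x| ≤ 1 := by
  rw [pairProd, abs_mul]
  exact mul_le_one₀ (hf _) (abs_nonneg _) (hf _)

theorem abs_sum_le_card_mul {F : G → ℝ} {C : ℝ} (h : ∀ x, |F x| ≤ C) :
    |∑ x, F x| ≤ C * Fintype.card G := by
  refine (Finset.abs_sum_le_sum_abs _ _).trans ((Finset.sum_le_sum fun x _ => h x).trans ?_)
  simp [mul_comm]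

/-- A weighted count of parallelograms is determined by its coarse-scale average, up to the drop in
energy between the fine scale `a` and the coarse scale `c`. -/
theorem abs_sum_quadSum_sub_le {a c w f : G → ℝ} {η ς : ℝ} {z r : G}
    (ha : IsProbKer a) (hc : IsProbKer c)
    (hw : ∀ s, 0 ≤ w s) (hf : ∀ x, |f x| ≤ 1) (hς : 0 < ς)
    (haw : ∀ t, a t ≠ 0 → ∀ φ : G → ℝ, (∀ x, |φ x| ≤ 1) →
      |∑ s, w s * φ (s + s + t) - ∑ s, w s * φ (s + s)| ≤ η * ∑ s, w s)
    (hac : ∀ t, a t ≠ 0 → NearInv c t η)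
    (hwc : ∀ s, w s ≠ 0 → NearInv c (s + s) η) (hz : NearInv c z (4 * η)) :
    |∑ s, w s * quadSum f r (s + s + z) - (∑ s, w s) * energy c (pairProd f r)|
      ≤ (∑ s, w s) * (6 * η * Fintype.card G + (ς * Fintype.card G +
        (energy a (pairProd f r) - energy c (pairProd f r) + 6 * η * Fintype.card G) / ς) / 2) := by
  obtain ⟨W, hW⟩ : ∃ W, W = ∑ s, w s := ⟨_, rfl⟩
  obtain ⟨F, hFdef⟩ : ∃ F, F = pairProd f r := ⟨_, rfl⟩
  have hF : ∀ x, |F x| ≤ 1 := fun x => hFdef ▸ abs_pairProd_le hf r x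
  have hq : ∀ k, quadSum f r k = ∑ x, F x * F (x + k) := fun k => by rw [hFdef]; rfl
  set X := kerAct a F with hX
  set P := kerAct (kerCorr c) F with hP
  set V : ℝ := (Fintype.card G : ℝ) with hV
  simp only [hq]
  rw [← hFdef, ← hW]
  rw [← hW] at haw
  have s1 : |∑ s, w s * ∑ x, F x * F (x + (s + s + z)) - ∑ s, w s * ∑ x, F x * X (x + (s + s + z))|
      ≤ η * W * V := by
    have e : ∑ s, w s * ∑ x, F x * F (x + (s + s + z)) - ∑ s, w s * ∑ x, F x * X (x + (s + s + z))
        = ∑ x, F x * ∑ t, a t * (∑ s, w s * F (x + z + (s + s))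
          - ∑ s, w s * F (x + z + (s + s + t))) := by
      have e1 : ∀ x, ∑ t, a t * (∑ s, w s * F (x + z + (s + s))
          - ∑ s, w s * F (x + z + (s + s + t)))
          = ∑ s, w s * F (x + z + (s + s)) - ∑ s, w s * X (x + (s + s + z)) := by
        intro x
        simp only [mul_sub, Finset.sum_sub_distrib]
        rw [← Finset.sum_mul, ha.sum_one, one_mul]
        congr 1
        simp only [hX, kerAct, Finset.mul_sum]
        rw [Finset.sum_comm]
        refine Finset.sum_congr rfl fun s _ => Finset.sum_congr rfl fun t _ => ?_
        rw [show x + z + (s + s + t) = x + (s + s + z) + t by abel]; ring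
      simp only [e1]
      simp only [mul_sub, Finset.sum_sub_distrib, Finset.mul_sum]
      congr 1
      · rw [Finset.sum_comm]
        refine Finset.sum_congr rfl fun s _ => Finset.sum_congr rfl fun t _ => ?_
        rw [show s + z + (t + t) = s + (t + t + z) by abel]; ring
      · rw [Finset.sum_comm]
        refine Finset.sum_congr rfl fun s _ => Finset.sum_congr rfl fun t _ => ?_
        ring
    rw [e]
    refine abs_sum_le_card_mul fun x => ?_
    rw [abs_mul]
    have h1 : |∑ t, a t * (∑ s, w s * F (x + z + (s + s))
          - ∑ s, w s * F (x + z + (s + s + t)))| ≤ η * W := by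
      refine ha.abs_sum_le fun t ht => ?_
      rw [abs_sub_comm]
      exact haw t ht (fun y => F (x + z + y)) (fun y => hF _)
    calc _ ≤ 1 * |∑ t, a t * (∑ s, w s * F (x + z + (s + s))
          - ∑ s, w s * F (x + z + (s + s + t)))| :=
          mul_le_mul_of_nonneg_right (hF x) (abs_nonneg _)
      _ ≤ _ := by rwa [one_mul]
  have hE : ∑ x, (X x - P x) ^ 2 ≤ energy a F - energy c F + 6 * η * V :=
    sum_sq_sub_le_energy_sub ha hc hac hF
  have s2 : |∑ s, w s * ∑ x, F x * X (x + (s + s + z)) - ∑ s, w s * ∑ x, F x * P (x + (s + s + z))|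
      ≤ W * ((ς * V + (energy a F - energy c F + 6 * η * V) / ς) / 2) := by
    have e : ∑ s, w s * ∑ x, F x * X (x + (s + s + z)) - ∑ s, w s * ∑ x, F x * P (x + (s + s + z))
        = ∑ s, w s * ∑ x, F x * (X (x + (s + s + z)) - P (x + (s + s + z))) := by
      simp only [mul_sub, Finset.sum_sub_distrib]
    rw [e, hW]
    refine abs_sum_ker_le hw fun s _ => ?_
    have h1 : ∀ x, |F x * (X (x + (s + s + z)) - P (x + (s + s + z)))|
        ≤ (ς + (X (x + (s + s + z)) - P (x + (s + s + z))) ^ 2 / ς) / 2 := by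
      intro x
      obtain ⟨y, hy⟩ : ∃ y, y = X (x + (s + s + z)) - P (x + (s + s + z)) := ⟨_, rfl⟩
      rw [← hy, abs_mul]
      have h2 : |F x| * |y| ≤ |y| := mul_le_of_le_one_left (abs_nonneg _) (hF x)
      refine h2.trans ?_
      rw [le_div_iff₀ two_pos, ← sub_nonneg]
      have : ς + y ^ 2 / ς - |y| * 2 = (ς - |y|) ^ 2 / ς := by
        field_simp; rw [sub_sq, sq_abs]; ring
      rw [this]; positivity
    refine (Finset.abs_sum_le_sum_abs _ _).trans ((Finset.sum_le_sum fun x _ => h1 x).trans ?_)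
    rw [← Finset.sum_div, Finset.sum_add_distrib, ← Finset.sum_div,
      sum_shift (fun x => (X x - P x) ^ 2)]
    simp only [Finset.sum_const, Finset.card_univ, nsmul_eq_mul]
    rw [mul_comm (Fintype.card G : ℝ) ς]
    gcongr
  have s3 : |∑ s, w s * ∑ x, F x * P (x + (s + s + z)) - W * energy c F| ≤ W * (5 * η * V) := by
    have e : ∑ s, w s * ∑ x, F x * P (x + (s + s + z)) - W * energy c F
        = ∑ s, w s * ∑ x, F x * (P (x + (s + s + z)) - P x) := by
      rw [← sum_mul_kerAct_kerCorr, hW, Finset.sum_mul, ← Finset.sum_sub_distrib]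
      refine Finset.sum_congr rfl fun s _ => ?_
      rw [← mul_sub, ← Finset.sum_sub_distrib]
      simp only [mul_sub, hP]
    rw [e, hW]
    refine abs_sum_ker_le hw fun s hs => abs_sum_le_card_mul fun x => ?_
    rw [abs_mul]
    have h1 := kerAct_kerCorr_shift hc ((hwc s hs).add hz) hF x
    calc _ ≤ 1 * |P (x + (s + s + z)) - P x| := mul_le_mul_of_nonneg_right (hF x) (abs_nonneg _)
      _ ≤ 5 * η := by rw [one_mul]; linarith
  have t1 := abs_sub_le (∑ s, w s * ∑ x, F x * F (x + (s + s + z)))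
    (∑ s, w s * ∑ x, F x * X (x + (s + s + z))) (∑ s, w s * ∑ x, F x * P (x + (s + s + z)))
  have t2 := abs_sub_le (∑ s, w s * ∑ x, F x * F (x + (s + s + z)))
    (∑ s, w s * ∑ x, F x * P (x + (s + s + z))) (W * energy c F)
  linarith

theorem boxEnergy_le_boxEnergy_add {f p u v : G → ℝ} {C : ℝ} (hp : ∀ t, 0 ≤ p t)
    (h : ∀ r, energy u (pairProd f r) ≤ energy v (pairProd f r) + C) :
    boxEnergy f p u ≤ boxEnergy f p v + (∑ t, p t) ^ 2 * C := by
  have : boxEnergy f p v + (∑ t, p t) ^ 2 * C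
      = ∑ t, ∑ t', p t * p t' * (energy v (pairProd f (t' - t)) + C) := by
    rw [sq, Finset.sum_mul_sum]
    simp only [boxEnergy, mul_add, Finset.sum_add_distrib, Finset.sum_mul]
  rw [this]
  exact Finset.sum_le_sum fun t _ => Finset.sum_le_sum fun t' _ =>
    mul_le_mul_of_nonneg_left (h _) (mul_nonneg (hp _) (hp _))

theorem NearInv.of_kerCorr {b c : G → ℝ} {η : ℝ} (hbc : ∀ t, b t ≠ 0 → NearInv c t η) {t : G}
    (ht : kerCorr b t ≠ 0) : NearInv c t (2 * η) := by
  obtain ⟨s, _, hs⟩ := Finset.exists_ne_zero_of_sum_ne_zero ht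
  have h := (hbc _ (right_ne_zero_of_mul hs)).add (hbc _ (left_ne_zero_of_mul hs)).neg
  rw [show s + t + -s = t by abel] at h
  exact h.mono (by linarith)

theorem kerAct_add (p q F : G → ℝ) (x : G) :
    kerAct (fun t => p t + q t) F x = kerAct p F x + kerAct q F x := by
  simp only [kerAct, add_mul, Finset.sum_add_distrib]

theorem kerAct_sub (p q F : G → ℝ) (x : G) :
    kerAct (fun t => p t - q t) F x = kerAct p F x - kerAct q F x := by
  simp only [kerAct, sub_mul, Finset.sum_sub_distrib]

/-- Fine and coarse antidiagonal averages agree in mean square, up to the drop in box energy. -/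
theorem sum_sq_antiDiagAvg_sub_le {a b c w f : G → ℝ} {η ς β : ℝ}
    (ha : IsProbKer a) (hb : IsProbKer b) (hc : IsProbKer c)
    (hw : ∀ s, 0 ≤ w s) (hf : ∀ x, |f x| ≤ 1) (hη : 0 ≤ η) (hς : 0 < ς) (hς1 : ς ≤ 1)
    (haw : ∀ t, a t ≠ 0 → ∀ φ : G → ℝ, (∀ x, |φ x| ≤ 1) →
      |∑ s, w s * φ (s + s + t) - ∑ s, w s * φ (s + s)| ≤ η * ∑ s, w s)
    (hab : ∀ t, a t ≠ 0 → NearInv b t η) (hac : ∀ t, a t ≠ 0 → NearInv c t η)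
    (hbc : ∀ t, b t ≠ 0 → NearInv c t η) (hwc : ∀ s, w s ≠ 0 → NearInv c (s + s) η)
    (hηβ : η ≤ β) (hE : boxEnergy f a a - boxEnergy f c c ≤ β * Fintype.card G) :
    ∑ s, w s * ∑ x, antiDiagAvg f (fun t => a t - kerCorr b t) x (x + (s + s)) ^ 2
      ≤ (∑ s, w s) * Fintype.card G * (2 * ς + 57 * β / ς) := by
  set V : ℝ := (Fintype.card G : ℝ) with hV
  have hV0 : 0 ≤ V := Nat.cast_nonneg _
  obtain ⟨W, hW⟩ : ∃ W, W = ∑ s, w s := ⟨_, rfl⟩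
  have hW0 : 0 ≤ W := hW ▸ Finset.sum_nonneg fun s _ => hw s
  have hP := fun r x => abs_pairProd_le hf r x
  set θ : G → ℝ := fun t => a t - kerCorr b t with hθ
  set φ : G → ℝ := fun t => a t + kerCorr b t with hφ
  have hφ0 : ∀ t, 0 ≤ φ t := fun t => add_nonneg (ha.nonneg t) (hb.kerCorr.nonneg t)
  have hθφ : ∀ t, |θ t| ≤ φ t := fun t => by
    have h1 := ha.nonneg t
    have h2 := hb.kerCorr.nonneg t
    rw [abs_le]; constructor <;> simp only [hθ, hφ] <;> linarith
  have hφs : ∑ t, φ t = 2 := by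
    simp only [hφ, Finset.sum_add_distrib, ha.sum_one, hb.kerCorr.sum_one]; norm_num
  have hφc : ∀ t, φ t ≠ 0 → NearInv c t (2 * η) := by
    intro t ht
    by_cases h : a t = 0
    · exact NearInv.of_kerCorr hbc (fun h' => ht (by simp [hφ, h, h']))
    · exact (hac t h).mono (by linarith)
  have hφcF : ∀ F : G → ℝ, (∀ x, |F x| ≤ 1) →
      4 * energy c F ≤ energy φ F + 12 * η * V := by
    intro F hF
    have h1 := hc.energy_le (kerAct φ F)
    have h2 := sum_sq_le_sum_sq_add (X := fun x => 2 * kerAct c F x)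
      (Y := fun x => kerAct c (kerAct φ F) x) (η := 3 * η) (C := 2)
      (fun x => by
        rw [abs_mul, abs_two]; linarith [hc.abs_kerAct_le hF x])
      (fun x => by
        refine hc.abs_sum_le fun t _ => ?_
        rw [kerAct_add]
        exact (abs_add_le _ _).trans
          (by linarith [ha.abs_kerAct_le hF (x + t), hb.kerCorr.abs_kerAct_le hF (x + t)]))
      (fun x => by
        have e : kerAct c (kerAct φ F) x
            = kerAct c (kerAct a F) x + kerAct c (kerAct (kerCorr b) F) x := by
          conv_lhs => rw [kerAct]
          simp only [hφ, kerAct_add, mul_add, Finset.sum_add_distrib]; rfl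
        have h3 := kerAct_kerAct_sub ha hac hF x
        have h4 := kerAct_kerAct_sub hb.kerCorr (fun t ht => NearInv.of_kerCorr hbc ht) hF x
        rw [e, abs_le]; rw [abs_le] at h3 h4
        constructor <;> linarith)
    have e1 : ∑ x, (2 * kerAct c F x) ^ 2 = 4 * energy c F := by
      rw [energy, Finset.mul_sum]; exact Finset.sum_congr rfl fun x _ => by ring
    have e2 : ∑ x, kerAct φ F x ^ 2 = energy φ F := rfl
    have e3 : ∑ x, kerAct c (kerAct φ F) x ^ 2 = energy c (kerAct φ F) := rfl
    rw [e1, e3] at h2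
    rw [e2] at h1
    linarith
  have hφaF : ∀ F : G → ℝ, (∀ x, |F x| ≤ 1) → energy φ F ≤ 4 * energy a F + 4 * η * V := by
    intro F hF
    have h1 : energy φ F ≤ 2 * energy a F + 2 * ∑ x, kerAct (kerCorr b) F x ^ 2 := by
      rw [energy, energy, Finset.mul_sum, Finset.mul_sum, ← Finset.sum_add_distrib]
      refine Finset.sum_le_sum fun x _ => ?_
      rw [kerAct_add]
      nlinarith [sq_nonneg (kerAct a F x - kerAct (kerCorr b) F x)]
    have h2 : ∑ x, kerAct (kerCorr b) F x ^ 2 ≤ energy b F := by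
      simp only [kerAct_kerCorr]; exact hb.neg.energy_le _
    have h3 := energy_le_energy_add ha hb hab hF
    linarith
  -- the three comparisons of box energies
  have b1 : boxEnergy f θ c ≤ boxEnergy f a a - boxEnergy f c c + 10 * η * V := by
    have h1 : boxEnergy f c θ ≤ boxEnergy f c a - boxEnergy f c b + 6 * η * V := by
      have e : boxEnergy f c a - boxEnergy f c b + 6 * η * V
          = ∑ t, ∑ t', c t * c t' * (energy a (pairProd f (t' - t))
            - energy b (pairProd f (t' - t)) + 6 * η * V) := by
        simp only [boxEnergy, mul_add, mul_sub, Finset.sum_add_distrib, Finset.sum_sub_distrib]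
        simp only [← Finset.sum_mul, ← Finset.mul_sum, hc.sum_one, mul_one, one_mul]
      rw [e]
      refine Finset.sum_le_sum fun t _ => Finset.sum_le_sum fun t' _ =>
        mul_le_mul_of_nonneg_left ?_ (mul_nonneg (hc.nonneg _) (hc.nonneg _))
      have := sum_sq_sub_le_energy_sub ha hb hab (hP (t' - t))
      simp only [← kerAct_sub] at this
      exact this
    have h2 : boxEnergy f a c ≤ boxEnergy f a a + 2 * η * V := by
      simpa [ha.sum_one] using boxEnergy_le_boxEnergy_add (f := f) ha.nonneg
        (fun r => energy_le_energy_add ha hc hac (hP r))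
    have h3 : boxEnergy f c c ≤ boxEnergy f c b + 2 * η * V := by
      simpa [hc.sum_one] using boxEnergy_le_boxEnergy_add (f := f) hc.nonneg
        (fun r => energy_le_energy_add hb hc hbc (hP r))
    rw [boxEnergy_comm f θ c]
    rw [boxEnergy_comm f a c] at h2
    linarith
  have b2 : boxEnergy f φ a ≤ 4 * boxEnergy f a a + 4 * η * V := by
    rw [boxEnergy_comm]
    have e : 4 * boxEnergy f a a + 4 * η * V
        = ∑ t, ∑ t', a t * a t' * (4 * energy a (pairProd f (t' - t)) + 4 * η * V) := by
      simp only [boxEnergy, mul_add, Finset.sum_add_distrib]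
      simp only [← Finset.sum_mul, ← Finset.mul_sum, ha.sum_one, mul_one, one_mul]
      simp only [Finset.mul_sum]
      congr 1
      exact Finset.sum_congr rfl fun _ _ => Finset.sum_congr rfl fun _ _ => by ring
    rw [e]
    exact Finset.sum_le_sum fun t _ => Finset.sum_le_sum fun t' _ =>
        mul_le_mul_of_nonneg_left (hφaF _ (hP _)) (mul_nonneg (ha.nonneg _) (ha.nonneg _))
  have b3 : 4 * boxEnergy f c c ≤ boxEnergy f φ c + 12 * η * V := by
    rw [boxEnergy_comm f φ c]
    have e1 : 4 * boxEnergy f c c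
        = ∑ t, ∑ t', c t * c t' * (4 * energy c (pairProd f (t' - t))) := by
      simp only [boxEnergy, Finset.mul_sum]
      exact Finset.sum_congr rfl fun _ _ => Finset.sum_congr rfl fun _ _ => by ring
    have e2 : boxEnergy f c φ + 12 * η * V
        = ∑ t, ∑ t', c t * c t' * (energy φ (pairProd f (t' - t)) + 12 * η * V) := by
      simp only [boxEnergy, mul_add, Finset.sum_add_distrib]
      simp only [← Finset.sum_mul, ← Finset.mul_sum, hc.sum_one, mul_one, one_mul]
    rw [e1, e2]
    exact Finset.sum_le_sum fun t _ => Finset.sum_le_sum fun t' _ =>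
        mul_le_mul_of_nonneg_left (hφcF _ (hP _)) (mul_nonneg (hc.nonneg _) (hc.nonneg _))
  rw [sum_sq_antiDiagAvg]
  have hterm : ∀ t t', θ t * θ t' * ∑ s, w s * quadSum f (t' - t) (s + s + (t + t'))
      ≤ W * (θ t * θ t' * energy c (pairProd f (t' - t)))
        + W * (φ t * φ t' * (6 * η * V + (ς * V + 6 * η * V / ς) / 2))
        + W / (2 * ς) * (φ t * φ t' * energy a (pairProd f (t' - t)))
        - W / (2 * ς) * (φ t * φ t' * energy c (pairProd f (t' - t))) := by
    intro t t'
    by_cases h0 : φ t * φ t' = 0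
    · have : θ t * θ t' = 0 := by
        have := hθφ t; have := hθφ t'
        rcases mul_eq_zero.mp h0 with h | h
        · have : θ t = 0 := abs_eq_zero.mp (le_antisymm (h ▸ hθφ t) (abs_nonneg _))
          simp [this]
        · have : θ t' = 0 := abs_eq_zero.mp (le_antisymm (h ▸ hθφ t') (abs_nonneg _))
          simp [this]
      simp [h0, this]
    · have hz : NearInv c (t + t') (4 * η) :=
        ((hφc t (left_ne_zero_of_mul h0)).add (hφc t' (right_ne_zero_of_mul h0))).mono
          (by linarith)
      have h1 := abs_sum_quadSum_sub_le (r := t' - t) ha hc hw hf hς haw hac hwc hz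
      rw [← hW] at h1
      set S := ∑ s, w s * quadSum f (t' - t) (s + s + (t + t'))
      set e := energy c (pairProd f (t' - t))
      set ea := energy a (pairProd f (t' - t))
      have h2 : θ t * θ t' * (S - W * e) ≤ φ t * φ t' *
          (W * (6 * η * V + (ς * V + (ea - e + 6 * η * V) / ς) / 2)) := by
        refine (le_abs_self _).trans ?_
        rw [abs_mul, abs_mul]
        exact mul_le_mul (mul_le_mul (hθφ t) (hθφ t') (abs_nonneg _) (hφ0 t)) h1 (abs_nonneg _)
          (mul_nonneg (hφ0 t) (hφ0 t'))
      have h3 : φ t * φ t' * (W * (6 * η * V + (ς * V + (ea - e + 6 * η * V) / ς) / 2))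
          = W * (φ t * φ t' * (6 * η * V + (ς * V + 6 * η * V / ς) / 2))
        + W / (2 * ς) * (φ t * φ t' * ea) - W / (2 * ς) * (φ t * φ t' * e) := by
        field_simp; ring
      rw [h3] at h2
      linarith
  have hsum := Finset.sum_le_sum fun t (_ : t ∈ Finset.univ) =>
    Finset.sum_le_sum fun t' (_ : t' ∈ Finset.univ) => hterm t t'
  simp only [Finset.sum_add_distrib, Finset.sum_sub_distrib, ← Finset.mul_sum] at hsum
  have hφφ : ∑ t, φ t * ∑ t', φ t' * (6 * η * V + (ς * V + 6 * η * V / ς) / 2)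
      = 4 * (6 * η * V + (ς * V + 6 * η * V / ς) / 2) := by
    simp only [← Finset.sum_mul, hφs]; ring
  have hb : ∀ φ u : G → ℝ, ∑ t, ∑ t', φ t * φ t' * energy u (pairProd f (t' - t))
    = boxEnergy f φ u := fun _ _ => rfl
  simp only [mul_assoc (φ _), ← Finset.mul_sum] at hsum
  rw [hφφ] at hsum
  simp only [Finset.mul_sum, ← mul_assoc (φ _), hb] at hsum
  simp only [Finset.mul_sum] at hsum ⊢
  refine hsum.trans ?_
  rw [← Finset.sum_mul] at *
  rw [← hW]
  have f1 : W * boxEnergy f θ c ≤ W * (11 * β * V) := by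
    refine mul_le_mul_of_nonneg_left ?_ hW0
    have := mul_le_mul_of_nonneg_right hηβ hV0
    linarith
  have f2 : W / (2 * ς) * boxEnergy f φ a - W / (2 * ς) * boxEnergy f φ c
      ≤ W / (2 * ς) * (20 * β * V) := by
    rw [← mul_sub]
    refine mul_le_mul_of_nonneg_left ?_ (by positivity)
    have := mul_le_mul_of_nonneg_right hηβ hV0
    linarith
  have f3 : W * (4 * (6 * η * V + (ς * V + 6 * η * V / ς) / 2))
      ≤ W * (4 * (6 * β * V + (ς * V + 6 * β * V / ς) / 2)) := by gcongr
  have f4 : W * (11 * β * V) + W * (4 * (6 * β * V + (ς * V + 6 * β * V / ς) / 2))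
      + W / (2 * ς) * (20 * β * V) = W * V * (35 * β + 2 * ς + 22 * β / ς) := by
    field_simp; ring
  have hβ : β ≤ β / ς := by
    rw [le_div_iff₀ hς]; nlinarith
  have f5 : W * V * (35 * β + 2 * ς + 22 * β / ς) ≤ W * V * (2 * ς + 57 * β / ς) := by
    refine mul_le_mul_of_nonneg_left ?_ (by positivity)
    rw [mul_div_assoc, mul_div_assoc]; linarith
  linarith

/-- The count of progressions weighted by `w` is close to the count weighted by `w` smoothed at
the coarser scale `b`, provided that the box energy does not drop much. -/
theorem abs_sum_apCount_sub_le {a b c w f : G → ℝ} {η ε : ℝ}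
    (ha : IsProbKer a) (hb : IsProbKer b) (hc : IsProbKer c)
    (hw : ∀ s, 0 ≤ w s) (hf : ∀ x, |f x| ≤ 1) (hη : 0 ≤ η) (hε : 0 < ε) (hε1 : ε ≤ 1)
    (haw' : ∀ t, a t ≠ 0 → NearInv w t (η * ∑ s, w s))
    (haw : ∀ t, a t ≠ 0 → ∀ φ : G → ℝ, (∀ x, |φ x| ≤ 1) →
      |∑ s, w s * φ (s + s + t) - ∑ s, w s * φ (s + s)| ≤ η * ∑ s, w s)
    (hab : ∀ t, a t ≠ 0 → NearInv b t η) (hac : ∀ t, a t ≠ 0 → NearInv c t η)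
    (hbc : ∀ t, b t ≠ 0 → NearInv c t η) (hwc : ∀ s, w s ≠ 0 → NearInv c (s + s) η)
    (hηε : η ≤ ε ^ 4 / 1000)
    (hE : boxEnergy f a a - boxEnergy f c c ≤ ε ^ 4 / 1000 * Fintype.card G) :
    |∑ s, w s * apCount f s - ∑ s, w s * ∑ t, kerCorr b t * apCount f (s + t)|
      ≤ 2 * ε * (∑ s, w s) * Fintype.card G := by
  set V : ℝ := (Fintype.card G : ℝ) with hV
  have hV0 : 0 ≤ V := Nat.cast_nonneg _
  obtain ⟨W, hW⟩ : ∃ W, W = ∑ s, w s := ⟨_, rfl⟩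
  have hW0 : 0 ≤ W := hW ▸ Finset.sum_nonneg fun s _ => hw s
  have hD := sum_sq_antiDiagAvg_sub_le (ς := ε ^ 2 / 4) ha hb hc hw hf hη (by positivity)
    (by nlinarith) haw hab hac hbc hwc hηε hE
  set θ : G → ℝ := fun t => a t - kerCorr b t with hθ
  rw [← hW] at haw' hD ⊢
  have s1 : |∑ s, w s * apCount f s - ∑ s, w s * ∑ t, a t * apCount f (s + t)| ≤ η * W * V := by
    have e : ∑ s, w s * apCount f s - ∑ s, w s * ∑ t, a t * apCount f (s + t)
        = ∑ x, f x * ∑ t, a t * (∑ s, w s * (f (x + s) * f (x + s + s))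
          - ∑ s, w s * (f (x + (s + t)) * f (x + (s + t) + (s + t)))) := by
      have e1 : ∀ x, ∑ t, a t * (∑ s, w s * (f (x + s) * f (x + s + s))
          - ∑ s, w s * (f (x + (s + t)) * f (x + (s + t) + (s + t))))
          = ∑ s, w s * (f (x + s) * f (x + s + s))
            - ∑ s, ∑ t, w s * (a t * (f (x + (s + t)) * f (x + (s + t) + (s + t)))) := by
        intro x
        simp only [mul_sub, Finset.sum_sub_distrib]
        rw [← Finset.sum_mul, ha.sum_one, one_mul]
        congr 1
        simp only [Finset.mul_sum]
        rw [Finset.sum_comm]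
        exact Finset.sum_congr rfl fun s _ => Finset.sum_congr rfl fun t _ => by ring
      simp only [e1]
      simp only [mul_sub, Finset.sum_sub_distrib, Finset.mul_sum, apCount]
      congr 1
      · rw [Finset.sum_comm]
        exact Finset.sum_congr rfl fun s _ => Finset.sum_congr rfl fun t _ => by ring
      · conv_rhs => rw [Finset.sum_comm]
        refine Finset.sum_congr rfl fun s _ => ?_
        rw [Finset.sum_comm]
        refine Finset.sum_congr rfl fun x _ => Finset.sum_congr rfl fun t _ => ?_
        ring
    rw [e]
    refine abs_sum_le_card_mul fun x => ?_
    rw [abs_mul]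
    have h1 : |∑ t, a t * (∑ s, w s * (f (x + s) * f (x + s + s))
          - ∑ s, w s * (f (x + (s + t)) * f (x + (s + t) + (s + t))))| ≤ η * W := by
      refine ha.abs_sum_le fun t ht => ?_
      rw [abs_sub_comm]
      refine haw' t ht (fun y => f (x + y) * f (x + y + y)) (fun y => ?_)
      rw [abs_mul]
      exact mul_le_one₀ (hf _) (abs_nonneg _) (hf _)
    exact (mul_le_of_le_one_left (abs_nonneg _) (hf x)).trans h1
  have s2 : |∑ s, w s * ∑ t, a t * apCount f (s + t)
      - ∑ s, w s * ∑ t, kerCorr b t * apCount f (s + t)| ≤ ε * W * V := by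
    have e : ∑ s, w s * ∑ t, a t * apCount f (s + t)
        - ∑ s, w s * ∑ t, kerCorr b t * apCount f (s + t)
        = ∑ s, w s * ∑ x, f (x + s) * antiDiagAvg f θ x (x + (s + s)) := by
      rw [← sum_ker_apCount, ← Finset.sum_sub_distrib]
      refine Finset.sum_congr rfl fun s _ => ?_
      rw [← mul_sub, ← Finset.sum_sub_distrib]
      simp only [hθ, sub_mul]
    rw [e]
    have h1 : |∑ s, w s * ∑ x, f (x + s) * antiDiagAvg f θ x (x + (s + s))|
        ≤ ∑ s, w s * ∑ x, (ε + antiDiagAvg f θ x (x + (s + s)) ^ 2 / ε) / 2 := by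
      refine (Finset.abs_sum_le_sum_abs _ _).trans (Finset.sum_le_sum fun s _ => ?_)
      rw [abs_mul, abs_of_nonneg (hw s)]
      refine mul_le_mul_of_nonneg_left ?_ (hw s)
      refine (Finset.abs_sum_le_sum_abs _ _).trans (Finset.sum_le_sum fun x _ => ?_)
      obtain ⟨y, hy⟩ : ∃ y, y = antiDiagAvg f θ x (x + (s + s)) := ⟨_, rfl⟩
      rw [← hy, abs_mul]
      refine (mul_le_of_le_one_left (abs_nonneg _) (hf (x + s))).trans ?_
      rw [le_div_iff₀ two_pos, ← sub_nonneg]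
      have : ε + y ^ 2 / ε - |y| * 2 = (ε - |y|) ^ 2 / ε := by
        field_simp; rw [sub_sq, sq_abs]; ring
      rw [this]; positivity
    refine h1.trans ?_
    have e2 : ∑ s, w s * ∑ x, (ε + antiDiagAvg f θ x (x + (s + s)) ^ 2 / ε) / 2
        = ε / 2 * W * V
          + (∑ s, w s * ∑ x, antiDiagAvg f θ x (x + (s + s)) ^ 2) / (2 * ε) := by
      rw [hW, Finset.mul_sum, Finset.sum_mul, Finset.sum_div, ← Finset.sum_add_distrib]
      refine Finset.sum_congr rfl fun s _ => ?_
      rw [← Finset.sum_div, Finset.sum_add_distrib, ← Finset.sum_div]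
      simp only [Finset.sum_const, Finset.card_univ, nsmul_eq_mul]
      field_simp
      ring
    rw [e2]
    have h3 : (∑ s, w s * ∑ x, antiDiagAvg f θ x (x + (s + s)) ^ 2) / (2 * ε)
        ≤ ε / 2 * W * V := by
      rw [div_le_iff₀ (by positivity)]
      refine hD.trans ?_
      have : 2 * (ε ^ 2 / 4) + 57 * (ε ^ 4 / 1000) / (ε ^ 2 / 4) ≤ ε ^ 2 := by
        field_simp; nlinarith [sq_nonneg ε]
      calc W * V * (2 * (ε ^ 2 / 4) + 57 * (ε ^ 4 / 1000) / (ε ^ 2 / 4)) ≤ W * V * ε ^ 2 :=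
            mul_le_mul_of_nonneg_left this (by positivity)
        _ = _ := by ring
    linarith
  have hηε' : η ≤ ε := hηε.trans (by
    have : ε ^ 4 ≤ ε := pow_le_of_le_one hε.le hε1 (by norm_num)
    linarith)
  have s3 : η * W * V ≤ ε * W * V := by gcongr
  have := abs_sub_le (∑ s, w s * apCount f s) (∑ s, w s * ∑ t, a t * apCount f (s + t))
    (∑ s, w s * ∑ t, kerCorr b t * apCount f (s + t))
  linarith

end Trilinear

section BoxKernels

set_option linter.unusedSectionVars false

variable {G : Type} [AddCommGroup G] [Fintype G] {ι : Type} {d : ℕ}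

open Classical in
/-- The push-forward to `G` of the weights `ω` on the finite set `B`. -/
noncomputable def pushKer (B : Finset ι) (ω : ι → ℝ) (π : ι → G) (g : G) : ℝ :=
  ∑ s ∈ B with π s = g, ω s

theorem sum_pushKer_mul (B : Finset ι) (ω : ι → ℝ) (π : ι → G) (φ : G → ℝ) :
    ∑ g, pushKer B ω π g * φ g = ∑ s ∈ B, ω s * φ (π s) := by
  classical
  rw [← Finset.sum_fiberwise B π]
  refine Finset.sum_congr rfl fun g _ => ?_
  rw [pushKer, Finset.sum_mul]
  refine Finset.sum_congr (by ext; simp) fun s hs => ?_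
  rw [(Finset.mem_filter.1 hs).2]

theorem sum_pushKer (B : Finset ι) (ω : ι → ℝ) (π : ι → G) :
    ∑ g, pushKer B ω π g = ∑ s ∈ B, ω s := by
  simpa using sum_pushKer_mul B ω π (fun _ => 1)

theorem pushKer_nonneg {B : Finset ι} {ω : ι → ℝ} (π : ι → G) (h : ∀ s ∈ B, 0 ≤ ω s) (g : G) :
    0 ≤ pushKer B ω π g := by
  classical
  exact Finset.sum_nonneg fun s hs => h s (Finset.mem_filter.1 hs).1

theorem exists_of_pushKer_ne_zero {B : Finset ι} {ω : ι → ℝ} {π : ι → G} {g : G}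
    (h : pushKer B ω π g ≠ 0) : ∃ s ∈ B, π s = g := by
  classical
  obtain ⟨s, hs, _⟩ := Finset.exists_ne_zero_of_sum_ne_zero h
  exact ⟨s, (Finset.mem_filter.1 hs).1, (Finset.mem_filter.1 hs).2⟩

/-- The integer points of the cube `[a, b)^d`. -/
noncomputable def intBox (d : ℕ) (a b : ℤ) : Finset (Fin d → ℤ) := Fintype.piFinset fun _ => Finset.Ico a b

theorem mem_intBox {a b : ℤ} {s : Fin d → ℤ} : s ∈ intBox d a b ↔ ∀ i, a ≤ s i ∧ s i < b := by
  simp [intBox, Fintype.mem_piFinset]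

theorem card_intBox (a b : ℤ) : (intBox d a b).card = (b - a).toNat ^ d := by
  simp [intBox]

theorem card_intBox_zero (L : ℕ) : (intBox d 0 L).card = L ^ d := by
  rw [card_intBox, sub_zero, Int.toNat_natCast]

theorem card_filter_add_notMem_intBox_le {a b : ℤ} (hab : a ≤ b) (τ : Fin d → ℤ) :
    (((intBox d a b).filter fun s => s + τ ∉ intBox d a b).card : ℝ)
      ≤ (∑ i, |(τ i : ℝ)|) * ((b - a : ℤ) : ℝ) ^ (d - 1) := by
  classical
  have hL : ((b - a).toNat : ℝ) = ((b - a : ℤ) : ℝ) := by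
    rw [← Int.cast_natCast, Int.toNat_of_nonneg (by omega)]
  let S : Fin d → Finset (Fin d → ℤ) := fun i =>
    Fintype.piFinset fun j => if j = i then
      (Finset.Ico a b).filter (fun x => x + τ i ∉ Finset.Ico a b) else Finset.Ico a b
  have hsub : ((intBox d a b).filter fun s => s + τ ∉ intBox d a b) ⊆ Finset.univ.biUnion S := by
    intro s hs
    rw [Finset.mem_filter] at hs
    obtain ⟨h1, h2⟩ := hs
    rw [mem_intBox] at h1 h2
    push Not at h2
    obtain ⟨i, hi⟩ := h2
    rw [Finset.mem_biUnion]
    refine ⟨i, Finset.mem_univ _, ?_⟩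
    rw [Fintype.mem_piFinset]
    intro j
    split_ifs with hj
    · subst hj
      rw [Finset.mem_filter, Finset.mem_Ico, Finset.mem_Ico]
      have := h1 j
      simp only [Pi.add_apply] at hi
      exact ⟨this, fun h => by have := hi h.1; omega⟩
    · exact Finset.mem_Ico.2 (h1 j)
  have hcard : ∀ i, ((S i).card : ℝ) ≤ |(τ i : ℝ)| * ((b - a : ℤ) : ℝ) ^ (d - 1) := by
    intro i
    have h1 : (S i).card = ((Finset.Ico a b).filter (fun x => x + τ i ∉ Finset.Ico a b)).card
        * (b - a).toNat ^ (d - 1) := by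
      simp only [S, Fintype.card_piFinset]
      rw [← Finset.mul_prod_erase _ _ (Finset.mem_univ i), if_pos rfl]
      congr 1
      rw [Finset.prod_congr rfl (g := fun _ => (b - a).toNat)]
      · simp
      · intro j hj
        rw [if_neg (Finset.ne_of_mem_erase hj), Int.card_Ico]
    have h2 : ((Finset.Ico a b).filter (fun x => x + τ i ∉ Finset.Ico a b)).card
        ≤ (τ i).natAbs := by
      rcases le_total 0 (τ i) with h | h
      · calc _ ≤ (Finset.Ico (b - τ i) b).card := by
              refine Finset.card_le_card fun x hx => ?_
              simp only [Finset.mem_filter, Finset.mem_Ico] at hx ⊢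
              omega
          _ = _ := by rw [Int.card_Ico]; omega
      · calc _ ≤ (Finset.Ico a (a - τ i)).card := by
              refine Finset.card_le_card fun x hx => ?_
              simp only [Finset.mem_filter, Finset.mem_Ico] at hx ⊢
              omega
          _ = _ := by rw [Int.card_Ico]; omega
    rw [h1, Nat.cast_mul, Nat.cast_pow, hL]
    refine mul_le_mul_of_nonneg_right ?_ (pow_nonneg (by exact_mod_cast sub_nonneg.2 hab) _)
    calc _ ≤ (((τ i).natAbs : ℕ) : ℝ) := by exact_mod_cast h2
      _ = _ := by rw [Nat.cast_natAbs, Int.cast_abs]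
  calc _ ≤ ((Finset.univ.biUnion S).card : ℝ) := by exact_mod_cast Finset.card_le_card hsub
    _ ≤ ∑ i, ((S i).card : ℝ) := by exact_mod_cast Finset.card_biUnion_le
    _ ≤ _ := by rw [Finset.sum_mul]; exact Finset.sum_le_sum fun i _ => hcard i

/-- A slowly varying weight on a cube is nearly invariant under small translations. -/
theorem abs_sum_intBox_shift_sub_le {a b : ℤ} (hab : a ≤ b) {w ψ : (Fin d → ℤ) → ℝ} {K ε : ℝ}
    (τ : Fin d → ℤ) (hψ : ∀ s, |ψ s| ≤ 1) (hw : ∀ s ∈ intBox d a b, |w s| ≤ K)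
    (hw' : ∀ s ∈ intBox d a b, s + τ ∈ intBox d a b → |w s - w (s + τ)| ≤ ε) (hε : 0 ≤ ε)
    (hK : 0 ≤ K) :
    |∑ s ∈ intBox d a b, w s * ψ (s + τ) - ∑ s ∈ intBox d a b, w s * ψ s|
      ≤ ε * ((b - a : ℤ) : ℝ) ^ d
        + 2 * K * ((∑ i, |(τ i : ℝ)|) * ((b - a : ℤ) : ℝ) ^ (d - 1)) := by
  classical
  obtain ⟨B, hB⟩ : ∃ B, B = intBox d a b := ⟨_, rfl⟩
  have hcard : ((B.card : ℕ) : ℝ) = ((b - a : ℤ) : ℝ) ^ d := by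
    rw [hB, card_intBox, Nat.cast_pow, ← Int.cast_natCast, Int.toNat_of_nonneg (by omega)]
  have c1 := card_filter_add_notMem_intBox_le hab τ
  have c2 := card_filter_add_notMem_intBox_le hab (-τ)
  simp only [Pi.neg_apply, Int.cast_neg, abs_neg] at c2
  rw [← hB] at hw hw' c1 c2 ⊢
  have e1 : ∑ s ∈ B, w s * ψ (s + τ) = ∑ s ∈ B with s + τ ∈ B, w s * ψ (s + τ)
      + ∑ s ∈ B with s + τ ∉ B, w s * ψ (s + τ) := (Finset.sum_filter_add_sum_filter_not _ _ _).symm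
  have e2 : ∑ s ∈ B, w s * ψ s = ∑ s ∈ B with s + -τ ∈ B, w s * ψ s
      + ∑ s ∈ B with s + -τ ∉ B, w s * ψ s := (Finset.sum_filter_add_sum_filter_not _ _ _).symm
  have e3 : ∑ s ∈ B with s + -τ ∈ B, w s * ψ s
      = ∑ s ∈ B with s + τ ∈ B, w (s + τ) * ψ (s + τ) := by
    symm
    refine Finset.sum_bij' (fun s _ => s + τ) (fun s _ => s + -τ) ?_ ?_ ?_ ?_ ?_
    · intro s hs; rw [Finset.mem_filter] at hs ⊢; simpa using hs.symm
    · intro s hs; rw [Finset.mem_filter] at hs ⊢; simpa using hs.symm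
    · intro s _; simp
    · intro s _; simp
    · intro s _; rfl
  have b1 : |∑ s ∈ B with s + τ ∈ B, (w s - w (s + τ)) * ψ (s + τ)| ≤ ε * B.card := by
    refine (Finset.abs_sum_le_sum_abs _ _).trans ?_
    calc _ ≤ ∑ s ∈ B with s + τ ∈ B, ε := Finset.sum_le_sum fun s hs => by
          rw [Finset.mem_filter] at hs
          rw [abs_mul]
          exact (mul_le_of_le_one_right (abs_nonneg _) (hψ _)).trans (hw' s hs.1 hs.2)
      _ ≤ ∑ s ∈ B, ε := Finset.sum_le_sum_of_subset_of_nonneg (Finset.filter_subset _ _)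
          fun _ _ _ => hε
      _ = _ := by rw [Finset.sum_const, nsmul_eq_mul, mul_comm]
  have b2 : ∀ (P : (Fin d → ℤ) → Prop) [DecidablePred P] (χ : (Fin d → ℤ) → ℝ), (∀ s, |χ s| ≤ 1) →
      |∑ s ∈ B with P s, w s * χ s| ≤ K * (B.filter P).card := by
    intro P _ χ hχ
    refine (Finset.abs_sum_le_sum_abs _ _).trans ?_
    calc _ ≤ ∑ s ∈ B with P s, K := Finset.sum_le_sum fun s hs => by
          rw [abs_mul]
          exact (mul_le_of_le_one_right (abs_nonneg _) (hχ _)).trans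
            (hw s (Finset.mem_filter.1 hs).1)
      _ = _ := by rw [Finset.sum_const, nsmul_eq_mul, mul_comm]
  have b3 := b2 (fun s => s + τ ∉ B) (fun s => ψ (s + τ)) (fun s => hψ _)
  have b4 := b2 (fun s => s + -τ ∉ B) ψ hψ
  have b5 := mul_le_mul_of_nonneg_left c1 hK
  have b6 := mul_le_mul_of_nonneg_left c2 hK
  have e : ∑ s ∈ B, w s * ψ (s + τ) - ∑ s ∈ B, w s * ψ s
      = ∑ s ∈ B with s + τ ∈ B, (w s - w (s + τ)) * ψ (s + τ)
        + ∑ s ∈ B with s + τ ∉ B, w s * ψ (s + τ) - ∑ s ∈ B with s + -τ ∉ B, w s * ψ s := by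
    rw [e1, e2, e3]
    simp only [sub_mul, Finset.sum_sub_distrib]
    ring
  rw [e]
  rw [hcard] at b1
  have t1 := abs_add_le (∑ s ∈ B with s + τ ∈ B, (w s - w (s + τ)) * ψ (s + τ)
        + ∑ s ∈ B with s + τ ∉ B, w s * ψ (s + τ)) (-∑ s ∈ B with s + -τ ∉ B, w s * ψ s)
  rw [abs_neg, ← sub_eq_add_neg] at t1
  have t2 := abs_add_le (∑ s ∈ B with s + τ ∈ B, (w s - w (s + τ)) * ψ (s + τ))
    (∑ s ∈ B with s + τ ∉ B, w s * ψ (s + τ))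
  linarith

/-- The law of `ρ (2 t)` for `t` uniform in `[0, L)^d`. -/
noncomputable def boxKer (ρ : (Fin d → ℤ) →+ G) (L : ℕ) : G → ℝ :=
  pushKer (intBox d 0 L) (fun _ => ((L : ℝ) ^ d)⁻¹) (fun t => ρ (t + t))

theorem isProbKer_boxKer (ρ : (Fin d → ℤ) →+ G) {L : ℕ} (hL : 0 < L) : IsProbKer (boxKer ρ L) := by
  refine ⟨pushKer_nonneg _ fun _ _ => by positivity, ?_⟩
  rw [boxKer, sum_pushKer, Finset.sum_const, card_intBox, nsmul_eq_mul]
  have : (0 : ℝ) < L := by exact_mod_cast hL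
  simp
  field_simp

theorem nearInv_boxKer (ρ : (Fin d → ℤ) →+ G) {L : ℕ} (hL : 0 < L) (τ : Fin d → ℤ) :
    NearInv (boxKer ρ L) (ρ (τ + τ)) (2 * (∑ i, |(τ i : ℝ)|) / L) := by
  intro φ hφ
  have hL' : (0 : ℝ) < L := by exact_mod_cast hL
  have h := abs_sum_intBox_shift_sub_le (d := d) (a := 0) (b := L) (by positivity)
    (w := fun _ => ((L : ℝ) ^ d)⁻¹) (ψ := fun s => φ (ρ (s + s))) (K := ((L : ℝ) ^ d)⁻¹) (ε := 0) τ
    (fun s => hφ _) (fun s _ => by rw [abs_of_nonneg (by positivity)]) (fun s _ _ => by simp)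
    le_rfl (by positivity)
  rw [boxKer, sum_pushKer_mul _ _ _ φ, sum_pushKer_mul _ _ _ (fun s => φ (s + ρ (τ + τ)))]
  simp only [← map_add]
  simp only [add_add_add_comm _ τ _ τ] at h
  refine h.trans ?_
  rcases Nat.eq_zero_or_pos d with rfl | hd
  · simp
  · obtain ⟨e, rfl⟩ : ∃ e, d = e + 1 := ⟨d - 1, by omega⟩
    simp only [zero_mul, zero_add, Nat.add_sub_cancel, sub_zero, Int.cast_natCast]
    apply le_of_eq
    field_simp
    ring

end BoxKernels

section Roth

variable {G : Type} [AddCommGroup G] [Fintype G] {d : ℕ}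

theorem exists_ap_of_not_threeAPFree {A : Finset ℕ} (h : ¬ ThreeAPFree (A : Set ℕ)) :
    ∃ i k, 0 < k ∧ i ∈ A ∧ i + k ∈ A ∧ i + k + k ∈ A := by
  simp only [ThreeAPFree, not_forall] at h
  obtain ⟨a, ha, b, hb, c, hc, habc, hab⟩ := h
  rw [Finset.mem_coe] at ha hb hc
  rcases lt_or_gt_of_ne hab with h | h
  · refine ⟨a, b - a, by omega, ha, ?_, ?_⟩
    · rwa [show a + (b - a) = b by omega]
    · rwa [show a + (b - a) + (b - a) = c by omega]
  · refine ⟨c, b - c, by omega, hc, ?_, ?_⟩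
    · rwa [show c + (b - c) = b by omega]
    · rwa [show c + (b - c) + (b - c) = a by omega]

/-- Roth's theorem in averaged form, along the multiples of a fixed group element. -/
theorem exists_le_sum_apCount_nsmul {δ : ℝ} (hδ : 0 < δ) : ∃ n : ℕ, 0 < n ∧
    ∀ (G : Type) [AddCommGroup G] [Fintype G] (f : G → ℝ), (∀ x, f x = 0 ∨ f x = 1) →
      δ * Fintype.card G ≤ ∑ x, f x → ∀ v : G,
        δ / (2 * n) * Fintype.card G ≤ ∑ k ∈ Finset.range n with 0 < k, apCount f (k • v) := by
  classical
  refine ⟨max 1 (cornersTheoremBound (δ / 2 / 3)), by positivity, ?_⟩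
  intro G _ _ f hf hsum v
  obtain ⟨n, hn⟩ : ∃ n, n = max 1 (cornersTheoremBound (δ / 2 / 3)) := ⟨_, rfl⟩
  rw [← hn]
  have hn1 : 1 ≤ n := hn ▸ le_max_left _ _
  have hn0 : (0 : ℝ) < n := by exact_mod_cast hn1
  have hf0 : ∀ x, 0 ≤ f x := fun x => by rcases hf x with h | h <;> simp [h]
  have hf1 : ∀ x, f x ≤ 1 := fun x => by rcases hf x with h | h <;> simp [h]
  have key : ∀ x : G, ∑ i ∈ Finset.range n, f (x + i • v) ≤ δ / 2 * n
      + n * ∑ i ∈ Finset.range n, ∑ k ∈ Finset.range n with 0 < k,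
        f (x + i • v) * f (x + i • v + k • v) * f (x + i • v + k • v + k • v) := by
    intro x
    have hS : 0 ≤ ∑ i ∈ Finset.range n, ∑ k ∈ Finset.range n with 0 < k,
        f (x + i • v) * f (x + i • v + k • v) * f (x + i • v + k • v + k • v) :=
      Finset.sum_nonneg fun i _ => Finset.sum_nonneg fun k _ =>
        mul_nonneg (mul_nonneg (hf0 _) (hf0 _)) (hf0 _)
    obtain ⟨A, hA⟩ : ∃ A, A = (Finset.range n).filter fun i => f (x + i • v) = 1 := ⟨_, rfl⟩
    have hcard : ∑ i ∈ Finset.range n, f (x + i • v) = A.card := by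
      rw [hA, Finset.card_filter, Nat.cast_sum]
      refine Finset.sum_congr rfl fun i _ => ?_
      rcases hf (x + i • v) with h | h <;> simp [h]
    rw [hcard]
    rcases lt_or_ge (A.card : ℝ) (δ / 2 * n) with h | h
    · have := mul_nonneg hn0.le hS
      linarith
    · obtain ⟨i, k, hk, h1, h2, h3⟩ := exists_ap_of_not_threeAPFree
        (roth_3ap_theorem_nat (n := n) (δ / 2) (by positivity) (hn ▸ le_max_right _ _) A
          (hA ▸ Finset.filter_subset _ _) h)
      rw [hA, Finset.mem_filter, Finset.mem_range] at h1 h2 h3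
      have hle : 1 ≤ ∑ i ∈ Finset.range n, ∑ k ∈ Finset.range n with 0 < k,
          f (x + i • v) * f (x + i • v + k • v) * f (x + i • v + k • v + k • v) := by
        calc (1 : ℝ) = f (x + i • v) * f (x + i • v + k • v) * f (x + i • v + k • v + k • v) := by
              have e2 := h2.2
              have e3 := h3.2
              rw [add_smul, ← add_assoc] at e2
              rw [add_smul, add_smul, ← add_assoc, ← add_assoc] at e3
              rw [h1.2, e2, e3]; norm_num
          _ ≤ ∑ k ∈ Finset.range n with 0 < k,
              f (x + i • v) * f (x + i • v + k • v) * f (x + i • v + k • v + k • v) :=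
            Finset.single_le_sum (f := fun k : ℕ =>
              f (x + i • v) * f (x + i • v + k • v) * f (x + i • v + k • v + k • v))
              (fun k _ => mul_nonneg (mul_nonneg (hf0 _) (hf0 _)) (hf0 _))
              (Finset.mem_filter.2 ⟨Finset.mem_range.2 (by omega), hk⟩)
          _ ≤ _ := Finset.single_le_sum (f := fun i : ℕ => ∑ k ∈ Finset.range n with 0 < k,
              f (x + i • v) * f (x + i • v + k • v) * f (x + i • v + k • v + k • v))
              (fun i _ => Finset.sum_nonneg fun k _ =>
                mul_nonneg (mul_nonneg (hf0 _) (hf0 _)) (hf0 _)) (Finset.mem_range.2 h1.1)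
      have hAn : (A.card : ℝ) ≤ n := by
        have := Finset.card_le_card (hA ▸ Finset.filter_subset _ _ : A ⊆ Finset.range n)
        rw [Finset.card_range] at this
        exact_mod_cast this
      have := mul_le_mul_of_nonneg_left hle hn0.le
      have : 0 ≤ δ / 2 * n := by positivity
      linarith
  have hs := Finset.sum_le_sum (s := Finset.univ) fun x _ => key x
  have e1 : ∀ i : ℕ, ∑ x, f (x + i • v) = ∑ x, f x := fun i => sum_shift f _
  have e2 : ∀ i : ℕ, ∑ x, ∑ k ∈ Finset.range n with 0 < k,
      f (x + i • v) * f (x + i • v + k • v) * f (x + i • v + k • v + k • v)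
      = ∑ k ∈ Finset.range n with 0 < k, apCount f (k • v) := by
    intro i
    rw [Finset.sum_comm]
    refine Finset.sum_congr rfl fun k _ => ?_
    exact sum_shift (fun x => f x * f (x + k • v) * f (x + k • v + k • v)) _
  rw [Finset.sum_comm, Finset.sum_add_distrib, ← Finset.mul_sum, ← Finset.mul_sum,
    Finset.sum_comm (f := fun (x : G) (i : ℕ) => ∑ k ∈ Finset.range n with 0 < k,
      f (x + i • v) * f (x + i • v + k • v) * f (x + i • v + k • v + k • v))] at hs
  simp only [e1, e2, Finset.sum_const, Finset.card_range, nsmul_eq_mul, Finset.card_univ] at hs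
  have h1 := mul_le_mul_of_nonneg_left hsum hn0.le
  set V : ℝ := (Fintype.card G : ℝ)
  set S := ∑ k ∈ Finset.range n with 0 < k, apCount f (k • v)
  have h2 : n * (δ / 2 * V) ≤ n * (n * S) := by linarith
  have h3 := le_of_mul_le_mul_left h2 hn0
  have : δ / (2 * n) * V = (δ / 2 * V) / n := by field_simp
  rw [this, div_le_iff₀ hn0]
  linarith

theorem apCount_nonneg {f : G → ℝ} (hf : ∀ x, 0 ≤ f x) (s : G) : 0 ≤ apCount f s :=
  Finset.sum_nonneg fun _ _ => mul_nonneg (mul_nonneg (hf _) (hf _)) (hf _)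

theorem sum_kerCorr_boxKer_mul (ρ : (Fin d → ℤ) →+ G) (L : ℕ) (φ : G → ℝ) :
    ∑ g, kerCorr (boxKer ρ L) g * φ g = ((L : ℝ) ^ d)⁻¹ * ((L : ℝ) ^ d)⁻¹
      * ∑ t ∈ intBox d 0 L, ∑ t' ∈ intBox d 0 L, φ (ρ (t' - t + (t' - t))) := by
  rw [sum_kerCorr_mul, boxKer, sum_pushKer_mul, Finset.mul_sum]
  refine Finset.sum_congr rfl fun t _ => ?_
  rw [sum_pushKer_mul _ _ _ (fun s => φ (s - ρ (t + t))), Finset.mul_sum, Finset.mul_sum]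
  refine Finset.sum_congr rfl fun t' _ => ?_
  rw [← map_sub, show t' + t' - (t + t) = t' - t + (t' - t) by abel]
  ring

/-- Roth's theorem for common differences distributed like the autocorrelation of a box. -/
theorem exists_le_sum_kerCorr_boxKer (d : ℕ) {δ : ℝ} (hδ : 0 < δ) : ∃ n : ℕ, ∃ c : ℝ, 0 < n ∧ 0 < c ∧
    ∀ (G : Type) [AddCommGroup G] [Fintype G] (f : G → ℝ), (∀ x, f x = 0 ∨ f x = 1) →
      δ * Fintype.card G ≤ ∑ x, f x → ∀ (ρ : (Fin d → ℤ) →+ G) (l : ℕ), 0 < l →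
        c * Fintype.card G ≤ ∑ g, kerCorr (boxKer ρ (2 * n * l)) g * apCount f g := by
  classical
  obtain ⟨n, hn, H⟩ := exists_le_sum_apCount_nsmul hδ
  have hn0 : (0 : ℝ) < n := by exact_mod_cast hn
  refine ⟨n, δ / (2 * n * n) * ((4 * n : ℝ) ^ d)⁻¹, hn, by positivity, ?_⟩
  intro G _ _ f hf hsum ρ l hl
  have hl0 : (0 : ℝ) < l := by exact_mod_cast hl
  have hf0 : ∀ x, 0 ≤ f x := fun x => by rcases hf x with h | h <;> simp [h]
  set V : ℝ := (Fintype.card G : ℝ)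
  rw [sum_kerCorr_boxKer_mul]
  set S := ∑ t ∈ intBox d 0 (2 * n * l : ℕ), ∑ t' ∈ intBox d 0 (2 * n * l : ℕ),
    apCount f (ρ (t' - t + (t' - t))) with hS
  have h1 : ∀ k ∈ (Finset.range n).filter (fun k => 0 < k),
      ((n * l : ℕ) : ℝ) ^ d * ∑ y ∈ intBox d 0 l, apCount f (k • ρ (y + y)) ≤ S := by
    intro k hk
    rw [Finset.mem_filter, Finset.mem_range] at hk
    obtain ⟨hkn, hk0⟩ := hk
    have hcard : (((n * l : ℕ) : ℝ)) ^ d = ((intBox d 0 (n * l : ℕ)).card : ℝ) := by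
      rw [card_intBox_zero, Nat.cast_pow]
    rw [hcard, ← nsmul_eq_mul, ← Finset.sum_const]
    have hsub : intBox d 0 (n * l : ℕ) ⊆ intBox d 0 (2 * n * l : ℕ) := by
      intro t ht
      rw [mem_intBox] at ht ⊢
      intro i
      have := ht i
      push_cast at this ⊢
      exact ⟨this.1, by nlinarith⟩
    refine (Finset.sum_le_sum fun t ht => ?_).trans
      (Finset.sum_le_sum_of_subset_of_nonneg hsub fun t _ _ =>
        Finset.sum_nonneg fun t' _ => apCount_nonneg hf0 _)
    have e : ∑ y ∈ intBox d 0 l, apCount f (k • ρ (y + y))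
        = ∑ t' ∈ (intBox d 0 l).image (fun y => t + k • y),
          apCount f (ρ (t' - t + (t' - t))) := by
      rw [Finset.sum_image]
      · refine Finset.sum_congr rfl fun y _ => ?_
        rw [add_sub_cancel_left, ← smul_add, map_nsmul]
      · intro y _ y' _ h
        have h' := add_left_cancel h
        funext i
        have := congrFun h' i
        simp only [Pi.smul_apply] at this
        rw [nsmul_eq_mul, nsmul_eq_mul] at this
        exact mul_left_cancel₀ (by exact_mod_cast hk0.ne') this
    rw [e]
    refine Finset.sum_le_sum_of_subset_of_nonneg ?_ fun t' _ _ => apCount_nonneg hf0 _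
    intro t' ht'
    obtain ⟨y, hy, rfl⟩ := Finset.mem_image.1 ht'
    rw [mem_intBox] at ht hy ⊢
    intro i
    have a1 := ht i
    have a2 := hy i
    simp only [Pi.add_apply, Pi.smul_apply]
    rw [nsmul_eq_mul]
    push_cast at a1 ⊢
    have a3 : (k : ℤ) * y i ≤ n * l := by
      have : (k : ℤ) ≤ n := by exact_mod_cast hkn.le
      exact mul_le_mul this a2.2.le a2.1 (by positivity)
    have a4 : 0 ≤ (k : ℤ) * y i := mul_nonneg (by positivity) a2.1
    constructor <;> linarith
  have h2 := Finset.sum_le_sum h1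
  rw [← Finset.mul_sum, Finset.sum_comm, Finset.sum_const, nsmul_eq_mul] at h2
  have h3 : (l : ℝ) ^ d * (δ / (2 * n) * V)
      ≤ ∑ y ∈ intBox d 0 l, ∑ k ∈ Finset.range n with 0 < k, apCount f (k • ρ (y + y)) := by
    have hcard : ((l : ℝ)) ^ d = ((intBox d 0 l).card : ℝ) := by
      rw [card_intBox_zero, Nat.cast_pow]
    rw [hcard, ← nsmul_eq_mul, ← Finset.sum_const]
    exact Finset.sum_le_sum fun y _ => H G f hf hsum _
  have hS0 : 0 ≤ S := Finset.sum_nonneg fun t _ => Finset.sum_nonneg fun t' _ => apCount_nonneg hf0 _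
  have h4 : (((Finset.range n).filter (fun k => 0 < k)).card : ℝ) * S ≤ n * S := by
    refine mul_le_mul_of_nonneg_right ?_ hS0
    exact_mod_cast (Finset.card_filter_le _ _).trans (Finset.card_range n).le
  have h5 := (mul_le_mul_of_nonneg_left h3 (by positivity : (0 : ℝ) ≤ ((n * l : ℕ) : ℝ) ^ d)).trans
    (h2.trans h4)
  have e : δ / (2 * n * n) * ((4 * n : ℝ) ^ d)⁻¹ * V = (((2 * n * l : ℕ) : ℝ) ^ d)⁻¹
      * (((2 * n * l : ℕ) : ℝ) ^ d)⁻¹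
      * ((((n * l : ℕ) : ℝ) ^ d * ((l : ℝ) ^ d * (δ / (2 * n) * V))) / n) := by
    push_cast
    have : (4 : ℝ) ^ d = 2 ^ d * 2 ^ d := by rw [← mul_pow]; norm_num
    simp only [mul_pow, this]
    field_simp
  rw [e]
  refine mul_le_mul_of_nonneg_left ?_ (by positivity)
  rw [div_le_iff₀ hn0]
  linarith

end Roth

section CauchySchwarz

open scoped ComplexConjugate

variable {G : Type} [AddCommGroup G] [Fintype G] {Z : Type} [AddCommGroup Z]

theorem sum_sum_eq_sum_sum_add {B H : Finset Z} (hH : ∀ s ∈ B, ∀ s' ∈ B, s' - s ∈ H)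
    {A : Z → Z → ℂ} (hA : ∀ s' ∉ B, ∀ s, A s' s = 0) :
    ∑ s' ∈ B, ∑ s ∈ B, A s' s = ∑ h ∈ H, ∑ s ∈ B, A (s + h) s := by
  classical
  rw [Finset.sum_comm, Finset.sum_comm (s := H)]
  refine Finset.sum_congr rfl fun s hs => ?_
  rw [← Finset.sum_image (s := H) (g := fun h => s + h) (f := fun s' => A s' s)
    fun h _ h' _ e => add_left_cancel e]
  refine Finset.sum_subset (fun s' hs' => ?_) fun s' _ hs' => hA s' hs' s
  exact Finset.mem_image.2 ⟨s' - s, hH s hs s' hs', by abel⟩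

theorem sum_norm_sq_sum_eq {X : Type} [Fintype X] {B H : Finset Z}
    (hH : ∀ s ∈ B, ∀ s' ∈ B, s' - s ∈ H) {w : Z → ℂ} (hw : ∀ s ∉ B, w s = 0) (Φ : X → Z → ℝ) :
    ((∑ x, ‖∑ s ∈ B, w s * (Φ x s : ℂ)‖ ^ 2 : ℝ) : ℂ)
      = ∑ h ∈ H, ∑ s ∈ B, w (s + h) * conj (w s) * ((∑ x, Φ x (s + h) * Φ x s : ℝ) : ℂ) := by
  have h1 : ∀ x, ((‖∑ s ∈ B, w s * (Φ x s : ℂ)‖ ^ 2 : ℝ) : ℂ)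
      = ∑ s' ∈ B, ∑ s ∈ B, w s' * conj (w s) * ((Φ x s' * Φ x s : ℝ) : ℂ) := by
    intro x
    rw [Complex.ofReal_pow, ← Complex.mul_conj', map_sum, Finset.sum_mul_sum]
    refine Finset.sum_congr rfl fun s' _ => Finset.sum_congr rfl fun s _ => ?_
    rw [map_mul, Complex.conj_ofReal]
    push_cast
    ring
  rw [Complex.ofReal_sum]
  simp only [h1]
  rw [← sum_sum_eq_sum_sum_add hH
    (A := fun s' s => w s' * conj (w s) * ((∑ x, Φ x s' * Φ x s : ℝ) : ℂ))
    (fun s' hs' s => by simp [hw s' hs']), Finset.sum_comm]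
  refine Finset.sum_congr rfl fun s' _ => ?_
  rw [Finset.sum_comm]
  refine Finset.sum_congr rfl fun s _ => ?_
  rw [Complex.ofReal_sum, Finset.mul_sum]

theorem norm_sum_mul_sq_le {X : Type} [Fintype X] {c : X → ℝ} (hc : ∀ x, |c x| ≤ 1) (T : X → ℂ) :
    ‖∑ x, (c x : ℂ) * T x‖ ^ 2 ≤ Fintype.card X * ∑ x, ‖T x‖ ^ 2 := by
  have h1 : ‖∑ x, (c x : ℂ) * T x‖ ≤ ∑ x, ‖T x‖ :=
    (norm_sum_le _ _).trans (Finset.sum_le_sum fun x _ => by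
      rw [norm_mul, Complex.norm_real, Real.norm_eq_abs]
      exact mul_le_of_le_one_left (norm_nonneg _) (hc x))
  exact (pow_le_pow_left₀ (norm_nonneg _) h1 2).trans
    (sq_sum_le_card_mul_sum_sq (s := Finset.univ) (f := fun x => ‖T x‖))

/-- Two applications of the Cauchy-Schwarz inequality bound a weighted count of three-term
progressions by the second-order differences of the weight. -/
theorem norm_sum_mul_apCount_pow_four_le {B H : Finset Z} (hH : ∀ s ∈ B, ∀ s' ∈ B, s' - s ∈ H)
    {w : Z → ℂ} (hw : ∀ s ∉ B, w s = 0) (ρ : Z →+ G) {f : G → ℝ} (hf : ∀ x, |f x| ≤ 1) :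
    ‖∑ s ∈ B, w s * (apCount f (ρ s) : ℂ)‖ ^ 4 ≤ (Fintype.card G : ℝ) ^ 4 * H.card
      * ∑ h ∈ H, ∑ h' ∈ H,
        ‖∑ s ∈ B, w (s + h' + h) * conj (w (s + h')) * conj (w (s + h) * conj (w s))‖ := by
  set V : ℝ := (Fintype.card G : ℝ) with hV
  have hV0 : 0 ≤ V := Nat.cast_nonneg _
  set T : G → ℂ := fun x => ∑ s ∈ B, w s * ((f (x + ρ s) * f (x + ρ s + ρ s) : ℝ) : ℂ) with hT
  set wh : Z → Z → ℂ := fun h s => w (s + h) * conj (w s) with hwh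
  set Th : Z → G → ℂ := fun h x => ∑ s ∈ B, wh h s * ((pairProd f (ρ h + ρ h) (x + ρ s) : ℝ) : ℂ)
    with hTh
  have s1 : ‖∑ s ∈ B, w s * (apCount f (ρ s) : ℂ)‖ ^ 2 ≤ V * ∑ x, ‖T x‖ ^ 2 := by
    have e : ∑ s ∈ B, w s * (apCount f (ρ s) : ℂ) = ∑ x, (f x : ℂ) * T x := by
      simp only [hT, apCount, Complex.ofReal_sum, Finset.mul_sum]
      rw [Finset.sum_comm]
      refine Finset.sum_congr rfl fun x _ => Finset.sum_congr rfl fun s _ => ?_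
      push_cast; ring
    rw [e]
    exact norm_sum_mul_sq_le hf T
  have s2 : ((∑ x, ‖T x‖ ^ 2 : ℝ) : ℂ)
      = ∑ h ∈ H, ∑ x, ((pairProd f (ρ h) x : ℝ) : ℂ) * Th h x := by
    rw [hT, sum_norm_sq_sum_eq hH hw (fun x s => f (x + ρ s) * f (x + ρ s + ρ s))]
    refine Finset.sum_congr rfl fun h _ => ?_
    simp only [hTh, Finset.mul_sum]
    rw [Finset.sum_comm]
    refine Finset.sum_congr rfl fun s _ => ?_
    have : ∑ x, f (x + ρ (s + h)) * f (x + ρ (s + h) + ρ (s + h)) * (f (x + ρ s) * f (x + ρ s + ρ s))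
        = ∑ x, pairProd f (ρ h) x * pairProd f (ρ h + ρ h) (x + ρ s) := by
      rw [← sum_shift (fun x => pairProd f (ρ h) x * pairProd f (ρ h + ρ h) (x + ρ s)) (ρ s)]
      refine Finset.sum_congr rfl fun x _ => ?_
      simp only [pairProd, map_add]
      rw [show x + (ρ s + ρ h) + (ρ s + ρ h) = x + ρ s + ρ s + (ρ h + ρ h) by abel,
        show x + (ρ s + ρ h) = x + ρ s + ρ h by abel]
      ring
    rw [this, Complex.ofReal_sum, Finset.mul_sum]
    refine Finset.sum_congr rfl fun x _ => ?_
    simp only [hwh]; push_cast; ring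
  have s3 : (∑ x, ‖T x‖ ^ 2) ^ 2 ≤ H.card * ∑ h ∈ H, V * ∑ x, ‖Th h x‖ ^ 2 := by
    have h0 : 0 ≤ ∑ x, ‖T x‖ ^ 2 := Finset.sum_nonneg fun x _ => sq_nonneg _
    have h1 : ∑ x, ‖T x‖ ^ 2 ≤ ∑ h ∈ H, ‖∑ x, ((pairProd f (ρ h) x : ℝ) : ℂ) * Th h x‖ := by
      have := congrArg norm s2
      rw [Complex.norm_real, Real.norm_eq_abs, abs_of_nonneg h0] at this
      rw [this]; exact norm_sum_le _ _
    refine (pow_le_pow_left₀ h0 h1 2).trans (sq_sum_le_card_mul_sum_sq.trans ?_)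
    refine mul_le_mul_of_nonneg_left (Finset.sum_le_sum fun h _ => ?_) (Nat.cast_nonneg _)
    exact norm_sum_mul_sq_le (fun x => abs_pairProd_le hf _ x) _
  have s4 : ∀ h, ∑ x, ‖Th h x‖ ^ 2 ≤ V * ∑ h' ∈ H,
      ‖∑ s ∈ B, w (s + h' + h) * conj (w (s + h')) * conj (w (s + h) * conj (w s))‖ := by
    intro h
    have h0 : 0 ≤ ∑ x, ‖Th h x‖ ^ 2 := Finset.sum_nonneg fun x _ => sq_nonneg _
    have e := sum_norm_sq_sum_eq hH (w := wh h) (fun s hs => by simp [hwh, hw s hs])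
      (fun (x : G) s => pairProd f (ρ h + ρ h) (x + ρ s))
    have e' : ∀ h' s, ∑ x, pairProd f (ρ h + ρ h) (x + ρ (s + h')) * pairProd f (ρ h + ρ h) (x + ρ s)
        = ∑ x, pairProd f (ρ h + ρ h) (x + ρ h') * pairProd f (ρ h + ρ h) x := by
      intro h' s
      rw [← sum_shift (fun x => pairProd f (ρ h + ρ h) (x + ρ h') * pairProd f (ρ h + ρ h) x) (ρ s)]
      refine Finset.sum_congr rfl fun x _ => ?_
      rw [map_add, show x + (ρ s + ρ h') = x + ρ s + ρ h' by abel]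
    simp only [e', ← Finset.sum_mul] at e
    have := congrArg norm e
    rw [Complex.norm_real, Real.norm_eq_abs, abs_of_nonneg h0] at this
    rw [this, Finset.mul_sum]
    refine (norm_sum_le _ _).trans (Finset.sum_le_sum fun h' _ => ?_)
    rw [norm_mul, mul_comm, Complex.norm_real, Real.norm_eq_abs]
    refine mul_le_mul_of_nonneg_right ?_ (norm_nonneg _)
    refine (abs_sum_le_card_mul (C := 1) fun x => ?_).trans (by rw [one_mul])
    rw [abs_mul]
    exact mul_le_one₀ (abs_pairProd_le hf _ _) (abs_nonneg _) (abs_pairProd_le hf _ _)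
  calc ‖∑ s ∈ B, w s * (apCount f (ρ s) : ℂ)‖ ^ 4
      = (‖∑ s ∈ B, w s * (apCount f (ρ s) : ℂ)‖ ^ 2) ^ 2 := by ring
    _ ≤ (V * ∑ x, ‖T x‖ ^ 2) ^ 2 := pow_le_pow_left₀ (sq_nonneg _) s1 2
    _ = V ^ 2 * (∑ x, ‖T x‖ ^ 2) ^ 2 := by ring
    _ ≤ V ^ 2 * (H.card * ∑ h ∈ H, V * (V * ∑ h' ∈ H,
        ‖∑ s ∈ B, w (s + h' + h) * conj (w (s + h')) * conj (w (s + h) * conj (w s))‖)) := by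
      refine mul_le_mul_of_nonneg_left (s3.trans ?_) (by positivity)
      exact mul_le_mul_of_nonneg_left (Finset.sum_le_sum fun h _ =>
        mul_le_mul_of_nonneg_left (s4 h) hV0) (Nat.cast_nonneg _)
    _ = _ := by rw [← Finset.mul_sum, ← Finset.mul_sum]; ring

/-- The product form of `norm_sum_mul_apCount_pow_four_le` on cubes. -/
theorem norm_sum_prod_mul_apCount_pow_four_le {d : ℕ} {I H : Finset ℤ}
    (hH : ∀ s ∈ I, ∀ s' ∈ I, s' - s ∈ H) {ω : ℤ → ℂ} (hω : ∀ s ∉ I, ω s = 0)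
    (ρ : (Fin d → ℤ) →+ G) {f : G → ℝ} (hf : ∀ x, |f x| ≤ 1) :
    ‖∑ s ∈ Fintype.piFinset (fun _ : Fin d => I), (∏ i, ω (s i)) * (apCount f (ρ s) : ℂ)‖ ^ 4
      ≤ (Fintype.card G : ℝ) ^ 4 * (H.card * ∑ h ∈ H, ∑ h' ∈ H,
        ‖∑ t ∈ I, ω (t + h' + h) * conj (ω (t + h')) * conj (ω (t + h) * conj (ω t))‖) ^ d := by
  have h := norm_sum_mul_apCount_pow_four_le (B := Fintype.piFinset (fun _ : Fin d => I))
    (H := Fintype.piFinset (fun _ : Fin d => H)) (w := fun s => ∏ i, ω (s i))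
    (fun s hs s' hs' => by
      rw [Fintype.mem_piFinset] at *
      exact fun i => hH _ (hs i) _ (hs' i))
    (fun s hs => by
      rw [Fintype.mem_piFinset] at hs
      push Not at hs
      obtain ⟨i, hi⟩ := hs
      exact Finset.prod_eq_zero (Finset.mem_univ i) (hω _ hi)) ρ hf
  refine h.trans (le_of_eq ?_)
  rw [Fintype.card_piFinset_const, Nat.cast_pow, mul_pow, mul_assoc]
  congr 2
  simp only [map_mul, map_prod, ← Finset.prod_mul_distrib, Pi.add_apply]
  have e1 : ∀ h h' : Fin d → ℤ, ∑ s ∈ Fintype.piFinset (fun _ : Fin d => I),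
      ∏ i, ω (s i + h' i + h i) * conj (ω (s i + h' i)) *
        (conj (ω (s i + h i)) * conj (conj (ω (s i))))
      = ∏ i, ∑ t ∈ I, ω (t + h' i + h i) * conj (ω (t + h' i)) *
        (conj (ω (t + h i)) * conj (conj (ω t))) := fun h h' =>
    Finset.sum_prod_piFinset I fun i t => ω (t + h' i + h i) * conj (ω (t + h' i)) *
        (conj (ω (t + h i)) * conj (conj (ω t)))
  simp only [e1, norm_prod]
  have e2 : ∀ h : Fin d → ℤ, ∑ h' ∈ Fintype.piFinset (fun _ : Fin d => H),
      ∏ i, ‖∑ t ∈ I, ω (t + h' i + h i) * conj (ω (t + h' i)) *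
        (conj (ω (t + h i)) * conj (conj (ω t)))‖
      = ∏ i, ∑ h' ∈ H, ‖∑ t ∈ I, ω (t + h' + h i) * conj (ω (t + h')) *
        (conj (ω (t + h i)) * conj (conj (ω t)))‖ := fun h =>
    Finset.sum_prod_piFinset H fun i h' => ‖∑ t ∈ I, ω (t + h' + h i) * conj (ω (t + h')) *
        (conj (ω (t + h i)) * conj (conj (ω t)))‖
  simp only [e2]
  rw [Finset.sum_prod_piFinset H fun _ h => ∑ h' ∈ H, ‖∑ t ∈ I, ω (t + h' + h) * conj (ω (t + h')) *
        (conj (ω (t + h)) * conj (conj (ω t)))‖]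
  simp

end CauchySchwarz

section DividedDifferences

/-- Iterated difference quotients of `g` with the listed steps. -/
noncomputable def iterSlope : List ℝ → (ℝ → ℝ) → ℝ → ℝ
  | [], g, x => g x
  | h :: l, g, x => (iterSlope l g (x + h) - iterSlope l g x) / h

/-- All points entering `iterSlope l g x` lie in `S`. -/
def StepsIn (S : Set ℝ) : List ℝ → ℝ → Prop
  | [], x => x ∈ S
  | h :: l, x => StepsIn S l x ∧ StepsIn S l (x + h)

theorem StepsIn.ordConnected {u v : ℝ} (l : List ℝ) :
    Set.OrdConnected {x | StepsIn (Set.Icc u v) l x} := by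
  induction l with
  | nil => exact Set.ordConnected_Icc
  | cons h l ih =>
    refine ⟨fun x hx y hy z hz => ?_⟩
    exact ⟨ih.out hx.1 hy.1 hz,
      ih.out hx.2 hy.2 ⟨add_le_add_left hz.1 h, add_le_add_left hz.2 h⟩⟩

theorem hasDerivAt_iterSlope {u v : ℝ} {g g' : ℝ → ℝ}
    (hg : ∀ x ∈ Set.Icc u v, HasDerivAt g (g' x) x) (l : List ℝ) {x : ℝ}
    (hx : StepsIn (Set.Icc u v) l x) : HasDerivAt (iterSlope l g) (iterSlope l g' x) x := by
  induction l generalizing x with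
  | nil => exact hg x hx
  | cons h l ih =>
    have h1 := ih hx.1
    have h2 := (ih hx.2).comp_add_const x h
    exact (h2.sub h1).div_const h

/-- Iterated difference quotients obey the bounds of the corresponding derivative. -/
theorem iterSlope_mem_Icc {u v m M : ℝ} {g : ℕ → ℝ → ℝ}
    (hg : ∀ n, ∀ x ∈ Set.Icc u v, HasDerivAt (g n) (g (n + 1) x) x) (l : List ℝ)
    (hl : ∀ h ∈ l, h ≠ 0) (n : ℕ) (hm : ∀ x ∈ Set.Icc u v, g (n + l.length) x ∈ Set.Icc m M)
    {x : ℝ} (hx : StepsIn (Set.Icc u v) l x) : iterSlope l (g n) x ∈ Set.Icc m M := by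
  induction l generalizing n x with
  | nil => exact hm x hx
  | cons h l ih =>
    have ih' := fun y hy => ih (fun h' hh' => hl h' (List.mem_cons_of_mem _ hh')) (n + 1)
      (x := y) (fun z hz => by
        have := hm z hz
        rwa [List.length_cons, add_comm l.length 1, ← add_assoc] at this) hy
    have hd := fun y (hy : StepsIn (Set.Icc u v) l y) => hasDerivAt_iterSlope (hg n) l hy
    have hoc := StepsIn.ordConnected (u := u) (v := v) l
    have main : ∀ a b : ℝ, a < b → StepsIn (Set.Icc u v) l a → StepsIn (Set.Icc u v) l b →
        (iterSlope l (g n) b - iterSlope l (g n) a) / (b - a) ∈ Set.Icc m M := by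
      intro a b hab ha hb
      obtain ⟨ξ, hξ, e⟩ := exists_hasDerivAt_eq_slope (iterSlope l (g n)) (iterSlope l (g (n + 1)))
        hab (fun y hy => (hd y (hoc.out ha hb hy)).continuousAt.continuousWithinAt)
        (fun y hy => hd y (hoc.out ha hb (Set.Ioo_subset_Icc_self hy)))
      rw [← e]
      exact ih' ξ (hoc.out ha hb (Set.Ioo_subset_Icc_self hξ))
    rcases lt_or_gt_of_ne (hl h List.mem_cons_self) with hneg | hpos
    · have := main (x + h) x (by linarith) hx.2 hx.1
      rw [show x - (x + h) = -h by ring, ← neg_sub, neg_div_neg_eq] at this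
      exact this
    · have := main x (x + h) (by linarith) hx.1 hx.2
      rwa [add_sub_cancel_left] at this

/-- The `n`-th derivative of `y ↦ y ^ p` on the positive half-line. -/
noncomputable def rpowDeriv (p : ℝ) (n : ℕ) (y : ℝ) : ℝ :=
  (∏ j ∈ Finset.range n, (p - j)) * y ^ (p - n)

theorem hasDerivAt_rpowDeriv (p : ℝ) (n : ℕ) {y : ℝ} (hy : 0 < y) :
    HasDerivAt (rpowDeriv p n) (rpowDeriv p (n + 1) y) y := by
  have h := (Real.hasDerivAt_rpow_const (x := y) (p := p - n) (Or.inl hy.ne')).const_mul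
    (∏ j ∈ Finset.range n, (p - j))
  have e : rpowDeriv p (n + 1) y
      = (∏ j ∈ Finset.range n, (p - j)) * ((p - n) * y ^ (p - n - 1)) := by
    rw [rpowDeriv, Finset.prod_range_succ, Nat.cast_add_one, ← sub_sub, mul_assoc]
  rw [e]
  exact h

theorem rpowDeriv_zero (p : ℝ) : rpowDeriv p 0 = fun y => y ^ p := by
  funext y; simp [rpowDeriv]

theorem continuousOn_rpowDeriv (p : ℝ) (n : ℕ) : ContinuousOn (rpowDeriv p n) (Set.Icc 1 3) :=
  fun _ hy => (hasDerivAt_rpowDeriv p n (lt_of_lt_of_le one_pos hy.1)).continuousAt.continuousWithinAt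

theorem exists_abs_iterSlope_rpow_le (p : ℝ) (n : ℕ) : ∃ C : ℝ, 0 < C ∧ ∀ l : List ℝ,
    l.length = n → (∀ h ∈ l, h ≠ 0) → ∀ x, StepsIn (Set.Icc 1 3) l x →
      |iterSlope l (fun y => y ^ p) x| ≤ C := by
  obtain ⟨C, hC⟩ := isCompact_Icc.exists_bound_of_continuousOn (continuousOn_rpowDeriv p n)
  refine ⟨max C 1, by positivity, fun l hl h0 x hx => ?_⟩
  have := iterSlope_mem_Icc (g := rpowDeriv p) (m := -max C 1) (M := max C 1)
    (fun n x hx => hasDerivAt_rpowDeriv p n (lt_of_lt_of_le one_pos hx.1)) l h0 0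
    (fun y hy => by
      rw [zero_add, hl, Set.mem_Icc, ← abs_le]
      exact (hC y hy).trans (le_max_left _ _)) hx
  rw [rpowDeriv_zero] at this
  exact abs_le.2 this

theorem exists_le_abs_iterSlope_rpow {p : ℝ} (h0 : p ≠ 0) (h1 : p ≠ 1) (h2 : p ≠ 2) :
    ∃ c : ℝ, 0 < c ∧ ∀ l : List ℝ, l.length = 3 → (∀ h ∈ l, h ≠ 0) →
      ∀ x, StepsIn (Set.Icc 1 3) l x → c ≤ |iterSlope l (fun y => y ^ p) x| := by
  obtain ⟨q, hq⟩ : ∃ q, q = ∏ j ∈ Finset.range 3, (p - (j : ℕ)) := ⟨_, rfl⟩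
  have hq0 : q ≠ 0 := by
    rw [hq]
    simp only [Finset.prod_range_succ, Finset.prod_range_zero]
    push_cast
    exact mul_ne_zero (mul_ne_zero (mul_ne_zero one_ne_zero (by simpa using h0))
      (sub_ne_zero.2 h1)) (sub_ne_zero.2 h2)
  obtain ⟨c, hc, hc'⟩ : ∃ c : ℝ, 0 < c ∧ ∀ y ∈ Set.Icc (1 : ℝ) 3, c ≤ y ^ (p - (3 : ℕ)) := by
    have hcont : ContinuousOn (fun y : ℝ => y ^ (p - (3 : ℕ))) (Set.Icc 1 3) := fun y hy =>
      (Real.continuousAt_rpow_const y _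
        (Or.inl (lt_of_lt_of_le one_pos hy.1).ne')).continuousWithinAt
    obtain ⟨z, hz, hmin⟩ := isCompact_Icc.exists_isMinOn (Set.nonempty_Icc.2 (by norm_num)) hcont
    exact ⟨_, Real.rpow_pos_of_pos (lt_of_lt_of_le one_pos hz.1) _, fun y hy => hmin hy⟩
  obtain ⟨C, hC⟩ := isCompact_Icc.exists_bound_of_continuousOn (continuousOn_rpowDeriv p 3)
  refine ⟨|q| * c, by positivity, fun l hl hl0 x hx => ?_⟩
  have key := fun m M hm => iterSlope_mem_Icc (g := rpowDeriv p) (m := m) (M := M)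
    (fun n x hx => hasDerivAt_rpowDeriv p n (lt_of_lt_of_le one_pos hx.1)) l hl0 0 hm hx
  rw [rpowDeriv_zero, hl, zero_add] at key
  rcases lt_or_gt_of_ne hq0 with h | h
  · have hk := key (-C) (q * c) fun y hy => ⟨(abs_le.1 (hC y hy)).1, by
      rw [rpowDeriv, ← hq]; exact mul_le_mul_of_nonpos_left (hc' y hy) h.le⟩
    rw [abs_of_neg h]
    have := neg_le_abs (iterSlope l (fun y => y ^ p) x)
    linarith [hk.2]
  · have := key (q * c) C fun y hy => ⟨by
      rw [rpowDeriv, ← hq]; exact mul_le_mul_of_nonneg_left (hc' y hy) h.le,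
      (abs_le.1 (hC y hy)).2⟩
    rw [abs_of_pos h]
    exact this.1.trans (le_abs_self _)

end DividedDifferences

section ExponentialSums

theorem norm_sum_range_le_of_eq_mul_sub {z c : ℕ → ℂ} {C D : ℝ} (N : ℕ) (hz : ∀ j, ‖z j‖ ≤ 1)
    (hc : ∀ j ≤ N, ‖c j‖ ≤ C) (hD : ∀ j < N, ‖c (j + 1) - c j‖ ≤ D)
    (h : ∀ j < N, z j = c j * (z (j + 1) - z j)) :
    ‖∑ j ∈ Finset.range N, z j‖ ≤ 2 * C + N * D := by
  have e : ∀ M ≤ N, ∑ j ∈ Finset.range M, z j = c M * z M - c 0 * z 0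
      - ∑ j ∈ Finset.range M, (c (j + 1) - c j) * z (j + 1) := by
    intro M
    induction M with
    | zero => intro; simp
    | succ M ih =>
      intro hM
      rw [Finset.sum_range_succ, ih (by omega), Finset.sum_range_succ]
      linear_combination h M (by omega)
  rw [e N le_rfl]
  have h1 : ∀ j ≤ N, ‖c j * z j‖ ≤ C := fun j hj => by
    rw [norm_mul]
    exact (mul_le_of_le_one_right (norm_nonneg _) (hz j)).trans (hc j hj)
  have h2 : ‖∑ j ∈ Finset.range N, (c (j + 1) - c j) * z (j + 1)‖ ≤ N * D := by
    refine (norm_sum_le _ _).trans ?_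
    calc _ ≤ ∑ j ∈ Finset.range N, D := Finset.sum_le_sum fun j hj => by
          rw [norm_mul]
          exact (mul_le_of_le_one_right (norm_nonneg _) (hz _)).trans (hD j (Finset.mem_range.1 hj))
      _ = _ := by simp
  have t1 := norm_sub_le (c N * z N - c 0 * z 0)
    (∑ j ∈ Finset.range N, (c (j + 1) - c j) * z (j + 1))
  have t2 := norm_sub_le (c N * z N) (c 0 * z 0)
  linarith [h1 N le_rfl, h1 0 (Nat.zero_le _)]

theorem le_norm_exp_mul_I_sub_one {x : ℝ} (hx : |x| ≤ Real.pi) :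
    |x| / 2 ≤ ‖Complex.exp (x * Complex.I) - 1‖ := by
  have h := Complex.norm_exp_I_mul_ofReal_sub_one x
  rw [mul_comm] at h
  rw [h, norm_mul, Real.norm_eq_abs, abs_two, Real.norm_eq_abs]
  have h1 := Real.mul_abs_le_abs_sin (x := x / 2) (by
    rw [abs_div, abs_two]; linarith)
  rw [abs_div, abs_two] at h1
  have h2 : (1 : ℝ) / 2 ≤ 2 / Real.pi := by
    rw [div_le_div_iff₀ (by norm_num) Real.pi_pos]
    linarith [Real.pi_le_four]
  have h3 : 1 / 2 * (|x| / 2) ≤ 2 / Real.pi * (|x| / 2) :=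
    mul_le_mul_of_nonneg_right h2 (by positivity)
  linarith

/-- A first-derivative estimate for exponential sums, in the style of Kusmin and Landau. -/
theorem norm_sum_exp_le {Ψ : ℕ → ℝ} {N : ℕ} {m δ : ℝ} (hm : 0 < m)
    (h1 : ∀ j ≤ N, m ≤ |Ψ (j + 1) - Ψ j|) (h2 : ∀ j ≤ N, |Ψ (j + 1) - Ψ j| ≤ Real.pi)
    (h3 : ∀ j < N, |Ψ (j + 1 + 1) - Ψ (j + 1) - (Ψ (j + 1) - Ψ j)| ≤ δ) :
    ‖∑ j ∈ Finset.range N, Complex.exp (Ψ j * Complex.I)‖ ≤ 4 / m + N * (4 * δ / m ^ 2) := by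
  set θ : ℕ → ℝ := fun j => Ψ (j + 1) - Ψ j with hθ
  set E : ℕ → ℂ := fun j => Complex.exp (θ j * Complex.I) - 1 with hE
  have hEn : ∀ j ≤ N, m / 2 ≤ ‖E j‖ := fun j hj =>
    le_trans (by linarith [h1 j hj]) (le_norm_exp_mul_I_sub_one (h2 j hj))
  have hE0 : ∀ j ≤ N, E j ≠ 0 := fun j hj h => by
    have := hEn j hj
    rw [h, norm_zero] at this
    linarith
  have hinv : ∀ j ≤ N, ‖(E j)⁻¹‖ ≤ 2 / m := fun j hj => by
    rw [norm_inv, show 2 / m = (m / 2)⁻¹ by rw [inv_div]]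
    exact inv_anti₀ (by positivity) (hEn j hj)
  have key := norm_sum_range_le_of_eq_mul_sub (z := fun j => Complex.exp (Ψ j * Complex.I))
    (c := fun j => (E j)⁻¹) (C := 2 / m) (D := 4 * δ / m ^ 2) N
    (fun j => by rw [Complex.norm_exp_ofReal_mul_I]) hinv
    (fun j hj => by
      rw [inv_sub_inv (hE0 _ hj) (hE0 _ hj.le), norm_div, norm_mul]
      have e1 : ‖E j - E (j + 1)‖ ≤ δ := by
        have : E j - E (j + 1) = -(Complex.exp (θ j * Complex.I)
            * (Complex.exp (Complex.I * ((θ (j + 1) - θ j : ℝ) : ℂ)) - 1)) := by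
          simp only [hE]
          rw [mul_sub, ← Complex.exp_add]
          push_cast
          rw [show (θ j : ℂ) * Complex.I + Complex.I * (θ (j + 1) - θ j)
            = θ (j + 1) * Complex.I by ring]
          ring
        rw [this, norm_neg, norm_mul, Complex.norm_exp_ofReal_mul_I, one_mul]
        exact (Real.norm_exp_I_mul_ofReal_sub_one_le).trans (h3 j hj)
      have e2 : (m / 2) * (m / 2) ≤ ‖E (j + 1)‖ * ‖E j‖ :=
        mul_le_mul (hEn _ hj) (hEn _ hj.le) (by positivity) (norm_nonneg _)
      have hδ : 0 ≤ δ := (norm_nonneg _).trans e1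
      calc _ ≤ δ / ((m / 2) * (m / 2)) := div_le_div₀ hδ e1 (by positivity) e2
        _ = _ := by field_simp; norm_num)
    (fun j hj => by
      have : Complex.exp (Ψ (j + 1) * Complex.I) - Complex.exp (Ψ j * Complex.I)
          = Complex.exp (Ψ j * Complex.I) * E j := by
        simp only [hE, hθ]
        rw [mul_sub, ← Complex.exp_add, mul_one]
        congr 2
        push_cast
        ring
      simp only [this]
      rw [mul_comm (E j)⁻¹, mul_assoc, mul_inv_cancel₀ (hE0 j hj.le), mul_one])
  calc _ ≤ _ := key
    _ = _ := by ring

end ExponentialSums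

section PowerPhases

open scoped ComplexConjugate

theorem mul_iterSlope_cons {s : ℝ} (hs : s ≠ 0) (l : List ℝ) (g : ℝ → ℝ) (x : ℝ) :
    s * iterSlope (s :: l) g x = iterSlope l g (x + s) - iterSlope l g x := by
  rw [iterSlope]; field_simp

theorem exists_norm_sum_exp_iterSlope_le {p : ℝ} (h0 : p ≠ 0) (h1 : p ≠ 1) (h2 : p ≠ 2) :
    ∃ C : ℝ, 0 < C ∧ ∀ (κ T a b x : ℝ) (N : ℕ), 0 < κ → 2 ≤ T → C * κ ≤ T → a ≠ 0 → b ≠ 0 →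
      |a| ≤ 1 → |b| ≤ 1 → (N : ℝ) ≤ 2 * T →
      (∀ j : ℕ, j ≤ N + 1 → StepsIn (Set.Icc 1 3) [a, b] (x + j * T⁻¹)) →
      ‖∑ j ∈ Finset.range N, Complex.exp ((κ * (a * (b *
        iterSlope [a, b] (fun y => y ^ p) (x + j * T⁻¹))) : ℝ) * Complex.I)‖
        ≤ C * T / (κ * (|a| * |b|)) := by
  obtain ⟨c, hc, hlow⟩ := exists_le_abs_iterSlope_rpow h0 h1 h2
  obtain ⟨C₃, hC₃, hup⟩ := exists_abs_iterSlope_rpow_le p 3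
  obtain ⟨C₄, hC₄, hup'⟩ := exists_abs_iterSlope_rpow_le p 4
  refine ⟨C₃ + (4 / c + 8 * C₄ / c ^ 2), by positivity, ?_⟩
  intro κ T a b x N hκ hT hCT ha hb ha1 hb1 hN hin
  have hTp : 0 < T := by linarith
  have hT0 : T⁻¹ ≠ 0 := inv_ne_zero hTp.ne'
  have hstep : ∀ j : ℕ, x + (j + 1 : ℕ) * T⁻¹ = x + j * T⁻¹ + T⁻¹ := fun j => by
    push_cast; ring
  have hin3 : ∀ j : ℕ, j ≤ N → StepsIn (Set.Icc 1 3) [T⁻¹, a, b] (x + j * T⁻¹) := fun j hj =>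
    ⟨hin j (by omega), by rw [← hstep]; exact hin (j + 1) (by omega)⟩
  have hin4 : ∀ j : ℕ, j < N → StepsIn (Set.Icc 1 3) [T⁻¹, T⁻¹, a, b] (x + j * T⁻¹) :=
    fun j hj => ⟨hin3 j hj.le, by rw [← hstep]; exact hin3 (j + 1) hj⟩
  have hne3 : ∀ h ∈ [T⁻¹, a, b], h ≠ 0 := by simp [ha, hb, hTp.ne']
  have hne4 : ∀ h ∈ [T⁻¹, T⁻¹, a, b], h ≠ 0 := by simp [ha, hb, hTp.ne']
  set Ψ : ℕ → ℝ := fun j => κ * (a * (b * iterSlope [a, b] (fun y => y ^ p) (x + j * T⁻¹)))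
    with hΨ
  have d1 : ∀ j, Ψ (j + 1) - Ψ j
      = κ * a * b * T⁻¹ * iterSlope [T⁻¹, a, b] (fun y => y ^ p) (x + j * T⁻¹) := fun j => by
    simp only [hΨ]
    rw [hstep]
    linear_combination (-κ * a * b) * mul_iterSlope_cons hT0 [a, b] (fun y => y ^ p) (x + j * T⁻¹)
  have d2 : ∀ j, Ψ (j + 1 + 1) - Ψ (j + 1) - (Ψ (j + 1) - Ψ j)
      = κ * a * b * T⁻¹ ^ 2 * iterSlope [T⁻¹, T⁻¹, a, b] (fun y => y ^ p) (x + j * T⁻¹) :=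
    fun j => by
    rw [d1, d1, hstep]
    linear_combination (-κ * a * b * T⁻¹) *
      mul_iterSlope_cons hT0 [T⁻¹, a, b] (fun y => y ^ p) (x + j * T⁻¹)
  have ha' : 0 < |a| := abs_pos.2 ha
  have hb' : 0 < |b| := abs_pos.2 hb
  have abs1 : |κ * a * b * T⁻¹| = κ * |a| * |b| * T⁻¹ := by
    rw [abs_mul, abs_mul, abs_mul, abs_of_pos hκ, abs_of_pos (inv_pos.2 hTp)]
  have abs2 : |κ * a * b * T⁻¹ ^ 2| = κ * |a| * |b| * T⁻¹ ^ 2 := by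
    rw [abs_mul, abs_mul, abs_mul, abs_of_pos hκ, abs_of_pos (pow_pos (inv_pos.2 hTp) 2)]
  have key := norm_sum_exp_le (Ψ := Ψ) (N := N) (m := κ * |a| * |b| * T⁻¹ * c)
    (δ := κ * |a| * |b| * T⁻¹ ^ 2 * C₄) (by positivity)
    (fun j hj => by
      rw [d1, abs_mul, abs1]
      exact mul_le_mul_of_nonneg_left (hlow _ rfl hne3 _ (hin3 j hj)) (by positivity))
    (fun j hj => by
      rw [d1, abs_mul, abs1]
      have e1 : κ * |a| * |b| * T⁻¹ * |iterSlope [T⁻¹, a, b] (fun y => y ^ p) (x + j * T⁻¹)|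
          ≤ κ * 1 * 1 * T⁻¹ * C₃ := by
        have := hup _ rfl hne3 _ (hin3 j hj)
        gcongr
      have e2 : κ * 1 * 1 * T⁻¹ * C₃ ≤ 1 := by
        rw [show κ * 1 * 1 * T⁻¹ * C₃ = C₃ * κ / T by field_simp, div_le_one hTp]
        refine le_trans ?_ hCT
        have : 0 ≤ (4 / c + 8 * C₄ / c ^ 2) * κ := by positivity
        nlinarith
      linarith [Real.pi_gt_three])
    (fun j hj => by
      rw [d2, abs_mul, abs2]
      exact mul_le_mul_of_nonneg_left (hup' _ rfl hne4 _ (hin4 j hj)) (by positivity))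
  refine key.trans ?_
  have e3 : (N : ℝ) * (4 * (κ * |a| * |b| * T⁻¹ ^ 2 * C₄) / (κ * |a| * |b| * T⁻¹ * c) ^ 2)
      ≤ 2 * T * (4 * (κ * |a| * |b| * T⁻¹ ^ 2 * C₄) / (κ * |a| * |b| * T⁻¹ * c) ^ 2) :=
    mul_le_mul_of_nonneg_right hN (by positivity)
  have e4 : 4 / (κ * |a| * |b| * T⁻¹ * c)
      + 2 * T * (4 * (κ * |a| * |b| * T⁻¹ ^ 2 * C₄) / (κ * |a| * |b| * T⁻¹ * c) ^ 2)
      = (4 / c + 8 * C₄ / c ^ 2) * T / (κ * (|a| * |b|)) := by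
    field_simp; ring
  have e5 : (4 / c + 8 * C₄ / c ^ 2) * T / (κ * (|a| * |b|))
      ≤ (C₃ + (4 / c + 8 * C₄ / c ^ 2)) * T / (κ * (|a| * |b|)) :=
    div_le_div_of_nonneg_right (mul_le_mul_of_nonneg_right (by linarith) hTp.le) (by positivity)
  linarith

/-- The scale-`T` dyadic block of integers. -/
noncomputable def dyadicBlock (T : ℝ) : Finset ℤ := Finset.Ico ⌈T⌉ ⌈2 * T⌉

theorem mem_dyadicBlock {T : ℝ} {t : ℤ} : t ∈ dyadicBlock T ↔ T ≤ t ∧ (t : ℝ) < 2 * T := by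
  rw [dyadicBlock, Finset.mem_Ico, Int.ceil_le, Int.lt_ceil]

theorem card_dyadicBlock_le {T : ℝ} (hT : 1 ≤ T) : ((dyadicBlock T).card : ℝ) ≤ 2 * T := by
  rw [dyadicBlock, Int.card_Ico]
  have h : (⌈T⌉ : ℤ) ≤ ⌈2 * T⌉ := Int.ceil_mono (by linarith)
  have e : (((⌈2 * T⌉ - ⌈T⌉).toNat : ℤ) : ℝ) = ((⌈2 * T⌉ - ⌈T⌉ : ℤ) : ℝ) := by
    rw [Int.toNat_of_nonneg (by omega)]
  rw [Int.cast_natCast] at e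
  rw [e]
  push_cast
  linarith [Int.ceil_lt_add_one (2 * T), Int.le_ceil T]

/-- The phase `κ (t / T) ^ p` restricted to the dyadic block at scale `T`. -/
noncomputable def blockPhase (p κ T : ℝ) (t : ℤ) : ℂ :=
  if t ∈ dyadicBlock T then Complex.exp ((κ * (t / T) ^ p : ℝ) * Complex.I) else 0

theorem norm_blockPhase_le (p κ T : ℝ) (t : ℤ) : ‖blockPhase p κ T t‖ ≤ 1 := by
  unfold blockPhase
  split_ifs
  · rw [Complex.norm_exp_ofReal_mul_I]
  · simp

/-- The multiplicative second difference of the block phase. -/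
noncomputable def blockCorr (p κ T : ℝ) (h h' : ℤ) : ℂ :=
  ∑ t ∈ dyadicBlock T, blockPhase p κ T (t + h' + h) * conj (blockPhase p κ T (t + h'))
    * conj (blockPhase p κ T (t + h) * conj (blockPhase p κ T t))

theorem norm_blockCorr_le_card (p κ T : ℝ) (h h' : ℤ) :
    ‖blockCorr p κ T h h'‖ ≤ (dyadicBlock T).card := by
  refine (norm_sum_le _ _).trans ?_
  calc _ ≤ ∑ t ∈ dyadicBlock T, (1 : ℝ) := Finset.sum_le_sum fun t _ => by
        simp only [norm_mul, RCLike.norm_conj]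
        have := norm_blockPhase_le p κ T
        exact mul_le_one₀ (mul_le_one₀ (this _) (norm_nonneg _) (this _)) (by positivity)
          (mul_le_one₀ (this _) (norm_nonneg _) (this _))
    _ = _ := by simp

theorem sum_Ico_int_eq_sum_range {M : Type*} [AddCommMonoid M] (F : ℤ → M) (A B : ℤ) :
    ∑ t ∈ Finset.Ico A B, F t = ∑ j ∈ Finset.range (B - A).toNat, F (A + j) := by
  refine (Finset.sum_nbij (fun j : ℕ => A + (j : ℤ)) ?_ ?_ ?_ ?_).symm
  · intro j hj
    simp only [Finset.mem_range, Finset.mem_Ico] at *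
    omega
  · intro i _ j _ h
    simpa using h
  · intro t ht
    simp only [Finset.coe_Ico, Set.mem_Ico] at ht
    refine ⟨(t - A).toNat, ?_, ?_⟩
    · simp only [Finset.coe_range, Set.mem_Iio]; omega
    · simp only; omega
  · intros; rfl

theorem exists_norm_blockCorr_le {p : ℝ} (h0 : p ≠ 0) (h1 : p ≠ 1) (h2 : p ≠ 2) :
    ∃ C : ℝ, 0 < C ∧ ∀ (κ T ς : ℝ) (h h' : ℤ), 0 < κ → 2 ≤ T → C * κ ≤ T → 0 < ς →
      ς * T ≤ |(h : ℝ)| → ς * T ≤ |(h' : ℝ)| →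
      ‖blockCorr p κ T h h'‖ ≤ C * T / (κ * ς ^ 2) := by
  obtain ⟨C, hC, key⟩ := exists_norm_sum_exp_iterSlope_le h0 h1 h2
  refine ⟨C, hC, fun κ T ς h h' hκ hT hCT hς hh hh' => ?_⟩
  have hTp : 0 < T := by linarith
  set A : ℤ := max (max ⌈T⌉ (⌈T⌉ - h)) (max (⌈T⌉ - h') (⌈T⌉ - h' - h)) with hA
  set B : ℤ := min (min ⌈2 * T⌉ (⌈2 * T⌉ - h)) (min (⌈2 * T⌉ - h') (⌈2 * T⌉ - h' - h)) with hB
  have hmem : ∀ t, t ∈ Finset.Ico A B ↔ t ∈ dyadicBlock T ∧ t + h ∈ dyadicBlock T ∧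
      t + h' ∈ dyadicBlock T ∧ t + h' + h ∈ dyadicBlock T := by
    intro t
    simp only [dyadicBlock, Finset.mem_Ico]
    omega
  rcases le_or_gt B A with hAB | hAB
  · have : blockCorr p κ T h h' = 0 := by
      refine Finset.sum_eq_zero fun t ht => ?_
      have hn : t ∉ Finset.Ico A B := by rw [Finset.Ico_eq_empty (by omega)]; simp
      rw [hmem] at hn
      by_cases c1 : t + h ∈ dyadicBlock T
      · by_cases c2 : t + h' ∈ dyadicBlock T
        · have c3 : t + h' + h ∉ dyadicBlock T := fun c3 => hn ⟨ht, c1, c2, c3⟩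
          simp [blockPhase, c3]
        · simp [blockPhase, c2]
      · simp [blockPhase, c1]
    rw [this, norm_zero]
    positivity
  have hA0 := (hmem A).1 (Finset.mem_Ico.2 ⟨le_rfl, hAB⟩)
  simp only [mem_dyadicBlock] at hA0
  push_cast at hA0
  obtain ⟨⟨a1, a2⟩, ⟨a3, a4⟩, ⟨a5, a6⟩, ⟨a7, a8⟩⟩ := hA0
  have hne : h ≠ 0 := by
    rintro rfl
    have : 0 < ς * T := by positivity
    simp at hh; linarith
  have hne' : h' ≠ 0 := by
    rintro rfl
    have : 0 < ς * T := by positivity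
    simp at hh'; linarith
  have hBle : (B : ℝ) ≤ 2 * T + 1 ∧ (B : ℝ) + h ≤ 2 * T + 1 ∧ (B : ℝ) + h' ≤ 2 * T + 1 ∧
      (B : ℝ) + h' + h ≤ 2 * T + 1 := by
    have hc := (Int.ceil_lt_add_one (2 * T)).le
    have b1 : B ≤ ⌈2 * T⌉ := by omega
    have b2 : B + h ≤ ⌈2 * T⌉ := by omega
    have b3 : B + h' ≤ ⌈2 * T⌉ := by omega
    have b4 : B + h' + h ≤ ⌈2 * T⌉ := by omega
    refine ⟨?_, ?_, ?_, ?_⟩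
    · exact le_trans (by exact_mod_cast b1) hc
    · exact le_trans (by exact_mod_cast b2) hc
    · exact le_trans (by exact_mod_cast b3) hc
    · exact le_trans (by exact_mod_cast b4) hc
  set N : ℕ := (B - A).toNat with hN
  have hNz : (N : ℤ) = B - A := Int.toNat_of_nonneg (by omega)
  have hNr : (N : ℝ) = B - A := by
    have := congrArg (Int.cast (R := ℝ)) hNz
    push_cast at this
    exact this
  have hx : ∀ j : ℕ, j ≤ N + 1 → StepsIn (Set.Icc 1 3) [h / T, h' / T] (A / T + j * T⁻¹) := by
    intro j hj
    have hj' : (j : ℝ) ≤ B - A + 1 := by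
      rw [← hNr]; exact_mod_cast hj
    have hj0 : (0 : ℝ) ≤ j := Nat.cast_nonneg j
    obtain ⟨b1, b2, b3, b4⟩ := hBle
    have conv : ∀ y : ℝ, T ≤ y → y ≤ 3 * T → y / T ∈ Set.Icc (1 : ℝ) 3 := fun y hy hy' =>
      ⟨by rwa [le_div_iff₀ hTp, one_mul], by rwa [div_le_iff₀ hTp]⟩
    have i1 := conv (A + j) (by linarith) (by linarith)
    have i2 := conv (A + j + h) (by linarith) (by linarith)
    have i3 := conv (A + j + h') (by linarith) (by linarith)
    have i4 := conv (A + j + h + h') (by linarith) (by linarith)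
    simp only [StepsIn]
    refine ⟨⟨?_, ?_⟩, ⟨?_, ?_⟩⟩
    · convert i1 using 1; ring
    · convert i3 using 1; ring
    · convert i2 using 1; ring
    · convert i4 using 1; ring
  have ha1 : |(h : ℝ) / T| ≤ 1 := by
    rw [abs_div, abs_of_pos hTp, div_le_one hTp, abs_le]
    constructor <;> linarith
  have hb1 : |(h' : ℝ) / T| ≤ 1 := by
    rw [abs_div, abs_of_pos hTp, div_le_one hTp, abs_le]
    constructor <;> linarith
  have hfin := key κ T (h / T) (h' / T) (A / T) N hκ hT hCT
    (div_ne_zero (by exact_mod_cast hne) hTp.ne') (div_ne_zero (by exact_mod_cast hne') hTp.ne')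
    ha1 hb1 (by rw [hNr]; linarith [hBle.1]) hx
  have hsum : blockCorr p κ T h h' = ∑ j ∈ Finset.range N, Complex.exp ((κ * (h / T * (h' / T *
        iterSlope [h / T, h' / T] (fun y => y ^ p) (A / T + j * T⁻¹))) : ℝ) * Complex.I) := by
    rw [blockCorr, ← Finset.sum_subset (s₁ := Finset.Ico A B) (fun t ht => ((hmem t).1 ht).1),
      sum_Ico_int_eq_sum_range]
    · refine Finset.sum_congr rfl fun j hj => ?_
      obtain ⟨m1, m2, m3, m4⟩ := (hmem (A + j)).1 (Finset.mem_Ico.2 (by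
        have := Finset.mem_range.1 hj; omega))
      simp only [blockPhase, if_pos m1, if_pos m2, if_pos m3, if_pos m4, map_mul, Complex.conj_conj]
      simp only [← Complex.exp_conj, map_mul, Complex.conj_ofReal, Complex.conj_I,
        ← Complex.exp_add, mul_neg]
      congr 1
      have e1 : (h : ℝ) / T ≠ 0 := div_ne_zero (by exact_mod_cast hne) hTp.ne'
      have e2 : (h' : ℝ) / T ≠ 0 := div_ne_zero (by exact_mod_cast hne') hTp.ne'
      have e3 := mul_iterSlope_cons e1 [(h' : ℝ) / T] (fun y => y ^ p) (A / T + j * T⁻¹)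
      have e4 := mul_iterSlope_cons e2 [] (fun y => y ^ p) (A / T + j * T⁻¹)
      have e5 := mul_iterSlope_cons e2 [] (fun y => y ^ p) (A / T + j * T⁻¹ + h / T)
      simp only [iterSlope] at e4 e5
      have e6 : (h : ℝ) / T * (h' / T * iterSlope [h / T, h' / T] (fun y => y ^ p)
          (A / T + j * T⁻¹)) = (((A + j + h' + h : ℤ) : ℝ) / T) ^ p - (((A + j + h' : ℤ) : ℝ) / T) ^ p
            - ((((A + j + h : ℤ) : ℝ) / T) ^ p - (((A + j : ℤ) : ℝ) / T) ^ p) := by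
        rw [mul_left_comm, e3, mul_sub]
        simp only [iterSlope]
        rw [e4, e5]
        push_cast
        rw [show ((A : ℝ) + j + h' + h) / T = A / T + j * T⁻¹ + h / T + h' / T by ring,
          show ((A : ℝ) + j + h') / T = A / T + j * T⁻¹ + h' / T by ring,
          show ((A : ℝ) + j + h) / T = A / T + j * T⁻¹ + h / T by ring,
          show ((A : ℝ) + j) / T = A / T + j * T⁻¹ by ring]
        ring
      rw [e6]
      simp only [Complex.ofReal_mul, Complex.ofReal_sub]
      ring
    · intro t ht hn
      rw [hmem] at hn
      by_cases c1 : t + h ∈ dyadicBlock T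
      · by_cases c2 : t + h' ∈ dyadicBlock T
        · have c3 : t + h' + h ∉ dyadicBlock T := fun c3 => hn ⟨ht, c1, c2, c3⟩
          simp [blockPhase, c3]
        · simp [blockPhase, c2]
      · simp [blockPhase, c1]
  rw [hsum]
  refine hfin.trans ?_
  have k1 : ς ≤ |(h : ℝ) / T| := by
    rwa [abs_div, abs_of_pos hTp, le_div_iff₀ hTp]
  have k2 : ς ≤ |(h' : ℝ) / T| := by
    rwa [abs_div, abs_of_pos hTp, le_div_iff₀ hTp]
  have k3 : ς ^ 2 ≤ |(h : ℝ) / T| * |(h' : ℝ) / T| := by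
    rw [sq]; exact mul_le_mul k1 k2 hς.le (abs_nonneg _)
  gcongr

end PowerPhases

section BlockPhaseSums

open scoped ComplexConjugate

/-- The possible differences of two elements of the dyadic block at scale `T`. -/
noncomputable def blockDiff (T : ℝ) : Finset ℤ := Finset.Icc (-⌊T⌋) ⌊T⌋

theorem mem_blockDiff {T : ℝ} {h : ℤ} : h ∈ blockDiff T ↔ |(h : ℝ)| ≤ T := by
  rw [blockDiff, Finset.mem_Icc, abs_le, Int.le_floor, neg_le, Int.le_floor]
  push_cast
  rw [neg_le]

theorem card_blockDiff_le {T : ℝ} (hT : 1 ≤ T) : ((blockDiff T).card : ℝ) ≤ 3 * T := by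
  have h0 : 0 ≤ ⌊T⌋ := Int.floor_nonneg.2 (by linarith)
  have e : ((((⌊T⌋ + 1 - -⌊T⌋).toNat : ℕ) : ℤ) : ℝ) = ((⌊T⌋ + 1 - -⌊T⌋ : ℤ) : ℝ) := by
    rw [Int.toNat_of_nonneg (by omega)]
  rw [Int.cast_natCast] at e
  rw [blockDiff, Int.card_Icc, e]
  push_cast
  linarith [Int.floor_le T]

theorem exists_sum_norm_blockCorr_le {p : ℝ} (h0 : p ≠ 0) (h1 : p ≠ 1) (h2 : p ≠ 2) {θ : ℝ}
    (hθ : 0 < θ) : ∃ C : ℝ, 0 < C ∧ ∀ ν T : ℝ, 1 ≤ ν → 2 ≤ T → ν ≤ T → C * ν ^ 3 ≤ T →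
      ∑ h ∈ blockDiff T, ∑ h' ∈ blockDiff T, ‖blockCorr p (ν ^ 3 * θ) T h h'‖
        ≤ C * T ^ 3 / ν := by
  obtain ⟨C, hC, key⟩ := exists_norm_blockCorr_le h0 h1 h2
  refine ⟨C * θ + 9 * C / θ + 36, by positivity, fun ν T hν hT hνT hCT => ?_⟩
  have hTp : 0 < T := by linarith
  have hνp : 0 < ν := by linarith
  have hcard := card_blockDiff_le (T := T) (by linarith)
  set small : ℤ → ℝ := fun h => if |(h : ℝ)| ≤ ν⁻¹ * T then 1 else 0 with hsmall
  have hs0 : ∀ h, 0 ≤ small h := fun h => by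
    simp only [hsmall]; split_ifs <;> norm_num
  have hsum : ∑ h ∈ blockDiff T, small h ≤ 3 * (ν⁻¹ * T) := by
    have hle : 1 ≤ ν⁻¹ * T := by
      rw [inv_mul_eq_div, le_div_iff₀ hνp]; linarith
    refine le_trans ?_ (card_blockDiff_le hle)
    rw [Finset.sum_ite, Finset.sum_const_zero, add_zero, Finset.sum_const, nsmul_one]
    exact_mod_cast Finset.card_le_card fun h hh => mem_blockDiff.2 (Finset.mem_filter.1 hh).2
  have hB : 0 ≤ C * T / (ν ^ 3 * θ * (ν⁻¹) ^ 2) := by positivity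
  have hpt : ∀ h h' : ℤ, ‖blockCorr p (ν ^ 3 * θ) T h h'‖
      ≤ C * T / (ν ^ 3 * θ * (ν⁻¹) ^ 2) + 2 * T * small h + 2 * T * small h' := by
    intro h h'
    have htriv : ‖blockCorr p (ν ^ 3 * θ) T h h'‖ ≤ 2 * T :=
      (norm_blockCorr_le_card _ _ _ _ _).trans (card_dyadicBlock_le (by linarith))
    by_cases c1 : |(h : ℝ)| ≤ ν⁻¹ * T
    · have e : small h = 1 := if_pos c1
      have := mul_nonneg (mul_nonneg zero_le_two hTp.le) (hs0 h')
      rw [e]; linarith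
    by_cases c2 : |(h' : ℝ)| ≤ ν⁻¹ * T
    · have e : small h' = 1 := if_pos c2
      have := mul_nonneg (mul_nonneg zero_le_two hTp.le) (hs0 h)
      rw [e]; linarith
    have := key (ν ^ 3 * θ) T ν⁻¹ h h' (by positivity) hT (by
      refine le_trans ?_ hCT
      have : 0 ≤ (9 * C / θ + 36) * ν ^ 3 := by positivity
      nlinarith) (by positivity) (not_le.1 c1).le (not_le.1 c2).le
    have n1 := mul_nonneg (mul_nonneg zero_le_two hTp.le) (hs0 h)
    have n2 := mul_nonneg (mul_nonneg zero_le_two hTp.le) (hs0 h')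
    linarith
  set c : ℝ := ((blockDiff T).card : ℝ) with hc
  have hc0 : 0 ≤ c := Nat.cast_nonneg _
  calc _ ≤ ∑ h ∈ blockDiff T, ∑ h' ∈ blockDiff T,
        (C * T / (ν ^ 3 * θ * (ν⁻¹) ^ 2) + 2 * T * small h + 2 * T * small h') :=
        Finset.sum_le_sum fun h _ => Finset.sum_le_sum fun h' _ => hpt h h'
    _ = c * c * (C * T / (ν ^ 3 * θ * (ν⁻¹) ^ 2))
        + 4 * T * c * ∑ h ∈ blockDiff T, small h := by
        simp only [Finset.sum_add_distrib, Finset.sum_const, nsmul_eq_mul, ← Finset.mul_sum]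
        ring
    _ ≤ (3 * T) * (3 * T) * (C * T / (ν ^ 3 * θ * (ν⁻¹) ^ 2))
        + 4 * T * (3 * T) * (3 * (ν⁻¹ * T)) := by
        have : 0 ≤ ∑ h ∈ blockDiff T, small h := Finset.sum_nonneg fun h _ => hs0 h
        gcongr
    _ = (9 * C / θ + 36) * T ^ 3 / ν := by field_simp; ring
    _ ≤ _ := by
        refine div_le_div_of_nonneg_right (mul_le_mul_of_nonneg_right ?_ (by positivity)) hνp.le
        nlinarith [mul_pos hC hθ]

theorem prod_blockPhase {d : ℕ} (p κ T : ℝ) {s : Fin d → ℤ}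
    (hs : s ∈ Fintype.piFinset fun _ : Fin d => dyadicBlock T) :
    ∏ i, blockPhase p κ T (s i)
      = Complex.exp ((κ * ∑ i, ((s i : ℝ) / T) ^ p : ℝ) * Complex.I) := by
  rw [Finset.mul_sum, Complex.ofReal_sum, Finset.sum_mul, Complex.exp_sum]
  refine Finset.prod_congr rfl fun i _ => ?_
  rw [blockPhase, if_pos (Fintype.mem_piFinset.1 hs i)]

/-- Oscillatory averages of three-term progression counts decay. -/
theorem exists_norm_sum_exp_mul_apCount_le {p : ℝ} (h0 : p ≠ 0) (h1 : p ≠ 1) (h2 : p ≠ 2) {θ : ℝ}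
    (hθ : 0 < θ) {d : ℕ} (hd : 36 ≤ d) : ∃ C : ℝ, 0 < C ∧ ∀ k : ℕ, 1 ≤ k → ∃ T₁ : ℝ, ∀ T, T₁ ≤ T →
      ∀ (G : Type) [AddCommGroup G] [Fintype G] (ρ : (Fin d → ℤ) →+ G) (f : G → ℝ),
      (∀ x, |f x| ≤ 1) →
      ‖∑ s ∈ Fintype.piFinset fun _ : Fin d => dyadicBlock T,
        Complex.exp ((k * θ * ∑ i, ((s i : ℝ) / T) ^ p : ℝ) * Complex.I) * (apCount f (ρ s) : ℂ)‖
        ≤ C * Fintype.card G * T ^ d / k ^ 3 := by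
  obtain ⟨C, hC, key⟩ := exists_sum_norm_blockCorr_le h0 h1 h2 hθ
  set D : ℝ := max 1 (3 * C) with hD
  refine ⟨D ^ d, by positivity, fun k hk => ?_⟩
  have hk1 : (1 : ℝ) ≤ k := by exact_mod_cast hk
  obtain ⟨ν, hν, hνk⟩ : ∃ ν : ℝ, 1 ≤ ν ∧ ν ^ 3 = k :=
    ⟨(k : ℝ) ^ (1 / 3 : ℝ), Real.one_le_rpow hk1 (by norm_num), by
      rw [← Real.rpow_natCast, ← Real.rpow_mul (by positivity)]; norm_num⟩
  refine ⟨max 2 (max ν (C * ν ^ 3)), fun T hT G _ _ ρ f hf => ?_⟩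
  obtain ⟨hT2, hT3⟩ := max_le_iff.1 hT
  obtain ⟨hT3, hT4⟩ := max_le_iff.1 hT3
  have hTp : 0 < T := by linarith
  have hνp : 0 < ν := by linarith
  have hcs := norm_sum_prod_mul_apCount_pow_four_le (I := dyadicBlock T) (H := blockDiff T)
    (ω := blockPhase p (ν ^ 3 * θ) T) (f := f)
    (fun s hs s' hs' => by
      rw [mem_dyadicBlock] at hs hs'
      rw [mem_blockDiff, abs_le]
      push_cast
      constructor <;> linarith)
    (fun s hs => if_neg hs) ρ hf
  rw [Finset.sum_congr rfl fun s hs => by rw [prod_blockPhase p (ν ^ 3 * θ) T hs], hνk] at hcs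
  have hsum := key ν T hν hT2 hT3 hT4
  have hcard := card_blockDiff_le (T := T) (by linarith)
  refine le_of_pow_le_pow_left₀ (n := 4) (by norm_num) (by positivity) (hcs.trans ?_)
  have e1 : ((blockDiff T).card : ℝ) * ∑ h ∈ blockDiff T, ∑ h' ∈ blockDiff T,
      ‖blockCorr p (ν ^ 3 * θ) T h h'‖ ≤ D * (T ^ 4 / ν) := by
    calc _ ≤ 3 * T * (C * T ^ 3 / ν) := by
          gcongr
      _ = 3 * C * (T ^ 4 / ν) := by ring
      _ ≤ _ := by gcongr; exact le_max_right _ _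
  rw [hνk] at e1
  have e2 : (((blockDiff T).card : ℝ) * ∑ h ∈ blockDiff T, ∑ h' ∈ blockDiff T,
      ‖blockCorr p (k * θ) T h h'‖) ^ d ≤ (D * (T ^ 4 / ν)) ^ d :=
    pow_le_pow_left₀ (by positivity) e1 d
  have e3 : (D * (T ^ 4 / ν)) ^ d ≤ (D ^ d * T ^ d / k ^ 3) ^ 4 := by
    have hD1 : 1 ≤ D := le_max_left _ _
    rw [← hνk, mul_pow, div_pow, div_pow, mul_pow, mul_div_assoc]
    have i1 : D ^ d ≤ (D ^ d) ^ 4 := le_self_pow₀ (one_le_pow₀ hD1) (by norm_num)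
    have i2 : (T ^ 4) ^ d / ν ^ d ≤ (T ^ d) ^ 4 / ((ν ^ 3) ^ 3) ^ 4 := by
      rw [← pow_mul, ← pow_mul, ← pow_mul, ← pow_mul, mul_comm 4 d]
      exact div_le_div_of_nonneg_left (by positivity) (by positivity)
        (pow_le_pow_right₀ hν (by omega))
    exact mul_le_mul i1 i2 (by positivity) (by positivity)
  calc _ ≤ (Fintype.card G : ℝ) ^ 4 * (D ^ d * T ^ d / k ^ 3) ^ 4 := by
        refine mul_le_mul_of_nonneg_left (le_trans ?_ e3) (by positivity)
        exact e2
    _ = _ := by ring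

end BlockPhaseSums

section Fejer

open Complex in
/-- The Fejér kernel. -/
noncomputable def fejer (n : ℕ) (α : ℝ) : ℝ :=
  ‖∑ k ∈ Finset.range n, exp ((k * α : ℝ) * I)‖ ^ 2 / n

theorem norm_sum_range_exp_le (n : ℕ) (α : ℝ) :
    ‖∑ k ∈ Finset.range n, Complex.exp ((k * α : ℝ) * Complex.I)‖ ≤ n := by
  refine (norm_sum_le _ _).trans ?_
  simp [Complex.norm_exp_ofReal_mul_I, -Complex.ofReal_mul]

theorem fejer_nonneg (n : ℕ) (α : ℝ) : 0 ≤ fejer n α := by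
  unfold fejer; positivity

theorem fejer_le (n : ℕ) (α : ℝ) : fejer n α ≤ n := by
  unfold fejer
  refine div_le_of_le_mul₀ (Nat.cast_nonneg n) (Nat.cast_nonneg n) ?_
  rw [← sq]
  exact pow_le_pow_left₀ (norm_nonneg _) (norm_sum_range_exp_le n α) 2

theorem le_fejer {n : ℕ} (hn : 1 ≤ n) {α : ℝ} (hα : |α| ≤ 1 / n) : n / 4 ≤ fejer n α := by
  have hn0 : (0 : ℝ) < n := by exact_mod_cast hn
  have h1 : (n : ℝ) / 2 ≤ ‖∑ k ∈ Finset.range n, Complex.exp ((k * α : ℝ) * Complex.I)‖ := by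
    refine le_trans ?_ (Complex.re_le_norm _)
    rw [Complex.re_sum]
    simp only [Complex.exp_ofReal_mul_I_re]
    calc (n : ℝ) / 2 = ∑ k ∈ Finset.range n, (1 / 2 : ℝ) := by simp; ring
      _ ≤ _ := Finset.sum_le_sum fun k hk => by
        have hk' : (k : ℝ) ≤ n := by exact_mod_cast (Finset.mem_range.1 hk).le
        have hb : |k * α| ≤ 1 := by
          rw [abs_mul, Nat.abs_cast]
          calc (k : ℝ) * |α| ≤ n * (1 / n) := by gcongr
            _ = 1 := by field_simp
        have := Real.one_sub_sq_div_two_le_cos (x := k * α)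
        have hb2 : (k * α) ^ 2 ≤ 1 := by
          rw [← sq_abs]; exact pow_le_one₀ (abs_nonneg _) hb
        linarith
  rw [fejer, le_div_iff₀ hn0]
  calc (n : ℝ) / 4 * n = (n / 2) ^ 2 := by ring
    _ ≤ _ := pow_le_pow_left₀ (by positivity) h1 2

theorem fejer_mul_sq_le (n : ℕ) {α : ℝ} (hα : |α| ≤ Real.pi) :
    fejer n α * α ^ 2 ≤ 16 / n := by
  have h1 : (∑ k ∈ Finset.range n, Complex.exp ((k * α : ℝ) * Complex.I))
      * (Complex.exp (α * Complex.I) - 1) = Complex.exp ((n * α : ℝ) * Complex.I) - 1 := by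
    have e : ∀ k : ℕ, Complex.exp ((k * α : ℝ) * Complex.I) = Complex.exp (α * Complex.I) ^ k :=
      fun k => by
        rw [← Complex.exp_nat_mul]
        push_cast
        rw [mul_assoc]
    simp only [e]
    exact geom_sum_mul _ _
  have h2 : ‖∑ k ∈ Finset.range n, Complex.exp ((k * α : ℝ) * Complex.I)‖ * (|α| / 2) ≤ 2 := by
    calc _ ≤ ‖∑ k ∈ Finset.range n, Complex.exp ((k * α : ℝ) * Complex.I)‖
          * ‖Complex.exp (α * Complex.I) - 1‖ := by
          gcongr; exact le_norm_exp_mul_I_sub_one hα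
      _ = ‖Complex.exp ((n * α : ℝ) * Complex.I) - 1‖ := by rw [← norm_mul, h1]
      _ ≤ ‖Complex.exp ((n * α : ℝ) * Complex.I)‖ + ‖(1 : ℂ)‖ := norm_sub_le _ _
      _ = 2 := by rw [Complex.norm_exp_ofReal_mul_I, norm_one]; norm_num
  rw [fejer, div_mul_eq_mul_div]
  refine div_le_div_of_nonneg_right ?_ (Nat.cast_nonneg n)
  have h3 := pow_le_pow_left₀ (by positivity) h2 2
  rw [mul_pow, div_pow, sq_abs] at h3
  linarith

theorem abs_fejer_sub_le (n : ℕ) (α β : ℝ) :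
    |fejer n α - fejer n β| ≤ 2 * n ^ 2 * |α - β| := by
  rcases Nat.eq_zero_or_pos n with rfl | hn
  · simp [fejer]
  have hn0 : (0 : ℝ) < n := by exact_mod_cast hn
  set S : ℝ → ℂ := fun α => ∑ k ∈ Finset.range n, Complex.exp ((k * α : ℝ) * Complex.I) with hS
  have h1 : ‖S α - S β‖ ≤ n * (n * |α - β|) := by
    simp only [hS]
    rw [← Finset.sum_sub_distrib]
    refine (norm_sum_le _ _).trans ?_
    calc _ ≤ ∑ k ∈ Finset.range n, n * |α - β| := Finset.sum_le_sum fun k hk => by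
          have hk' : (k : ℝ) ≤ n := by exact_mod_cast (Finset.mem_range.1 hk).le
          have e : Complex.exp ((k * α : ℝ) * Complex.I) - Complex.exp ((k * β : ℝ) * Complex.I)
              = Complex.exp ((k * β : ℝ) * Complex.I)
                * (Complex.exp (Complex.I * ((k * (α - β) : ℝ) : ℂ)) - 1) := by
            rw [mul_sub, ← Complex.exp_add, mul_one]
            congr 2
            push_cast
            ring
          rw [e, norm_mul, Complex.norm_exp_ofReal_mul_I, one_mul]
          refine Real.norm_exp_I_mul_ofReal_sub_one_le.trans ?_
          rw [Real.norm_eq_abs, abs_mul, Nat.abs_cast]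
          gcongr
      _ = _ := by simp
  have h2 := abs_norm_sub_norm_le (S α) (S β)
  have h3 := norm_sum_range_exp_le n α
  have h4 := norm_sum_range_exp_le n β
  have e : fejer n α - fejer n β = (‖S α‖ + ‖S β‖) * (‖S α‖ - ‖S β‖) / n := by
    simp only [fejer, hS]; ring
  rw [e, abs_div, abs_mul, Nat.abs_cast, abs_of_nonneg (by positivity : 0 ≤ ‖S α‖ + ‖S β‖),
    div_le_iff₀ hn0]
  calc _ ≤ (n + n : ℝ) * (n * (n * |α - β|)) := by
        refine mul_le_mul (add_le_add h3 h4) (h2.trans h1) (abs_nonneg _) (by positivity)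
    _ = _ := by ring

theorem norm_sum_range_exp_sq (n : ℕ) (α : ℝ) :
    ‖∑ k ∈ Finset.range n, Complex.exp ((k * α : ℝ) * Complex.I)‖ ^ 2
      = n + 2 * ∑ k ∈ Finset.range n, ((n : ℝ) - (k + 1)) * Real.cos ((k + 1) * α) := by
  induction n with
  | zero => simp
  | succ n ih =>
    rw [Finset.sum_range_succ, ← Complex.normSq_eq_norm_sq, Complex.normSq_add,
      Complex.normSq_eq_norm_sq, Complex.normSq_eq_norm_sq, ih, Complex.norm_exp_ofReal_mul_I]
    have e : ((∑ k ∈ Finset.range n, Complex.exp ((k * α : ℝ) * Complex.I))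
        * (starRingEnd ℂ) (Complex.exp ((n * α : ℝ) * Complex.I))).re
        = ∑ k ∈ Finset.range n, Real.cos ((k + 1) * α) := by
      rw [← Finset.sum_range_reflect (fun k => Real.cos (((k : ℕ) + 1 : ℝ) * α)),
        Finset.sum_mul, Complex.re_sum]
      refine Finset.sum_congr rfl fun k hk => ?_
      have hk' := Finset.mem_range.1 hk
      rw [← Complex.exp_conj, map_mul, Complex.conj_ofReal, Complex.conj_I, ← Complex.exp_add,
        show ((k * α : ℝ) : ℂ) * Complex.I + (n * α : ℝ) * -Complex.I
          = ((-((n - k) * α) : ℝ) : ℂ) * Complex.I by push_cast; ring,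
        Complex.exp_ofReal_mul_I_re, Real.cos_neg]
      congr 2
      rw [Nat.sub_sub, Nat.cast_sub (by omega)]
      push_cast
      ring
    rw [e, Finset.sum_range_succ]
    push_cast
    have e2 : ∑ k ∈ Finset.range n, ((n : ℝ) + 1 - (k + 1)) * Real.cos ((k + 1) * α)
        = ∑ k ∈ Finset.range n, ((n : ℝ) - (k + 1)) * Real.cos ((k + 1) * α)
          + ∑ k ∈ Finset.range n, Real.cos ((k + 1) * α) := by
      rw [← Finset.sum_add_distrib]
      exact Finset.sum_congr rfl fun k _ => by ring
    rw [e2]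
    ring

theorem fejer_eq {n m : ℕ} (hn : 1 ≤ n) (hnm : n ≤ m) (α : ℝ) :
    fejer n α = 1 + ∑ k ∈ Finset.range m,
      2 * max 0 (1 - (k + 1 : ℝ) / n) * Real.cos ((k + 1) * α) := by
  have hn0 : (0 : ℝ) < n := by exact_mod_cast hn
  rw [fejer, norm_sum_range_exp_sq, add_div, div_self hn0.ne', ← Finset.sum_subset
    (Finset.range_subset_range.2 hnm), Finset.mul_sum, Finset.sum_div]
  · congr 1
    refine Finset.sum_congr rfl fun k hk => ?_
    have : (k + 1 : ℝ) / n ≤ 1 := by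
      rw [div_le_one hn0]; exact_mod_cast Finset.mem_range.1 hk
    rw [max_eq_right (by linarith)]
    field_simp
  · intro k _ hk
    have : 1 ≤ (k + 1 : ℝ) / n := by
      rw [le_div_iff₀ hn0, one_mul]
      have : n ≤ k := by simpa using hk
      have : (n : ℝ) ≤ k := by exact_mod_cast this
      linarith
    rw [max_eq_left (by linarith)]
    simp

theorem exists_fejer_sub_eq {n m : ℕ} (hn : 1 ≤ n) (hnm : n ≤ m) : ∃ a : ℕ → ℝ,
    (∀ k, |a k| ≤ 2 * (k + 1) / n) ∧ ∀ α, fejer m α - fejer n α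
      = ∑ k ∈ Finset.range m, a k * Real.cos ((k + 1) * α) := by
  have hn0 : (0 : ℝ) < n := by exact_mod_cast hn
  have hnm' : (n : ℝ) ≤ m := by exact_mod_cast hnm
  refine ⟨fun k => 2 * max 0 (1 - (k + 1 : ℝ) / m) - 2 * max 0 (1 - (k + 1 : ℝ) / n),
    fun k => ?_, fun α => ?_⟩
  · have h1 : (k + 1 : ℝ) / m ≤ (k + 1) / n := by gcongr
    have h2 : 0 ≤ (k + 1 : ℝ) / m := by positivity
    have e : 2 * (k + 1 : ℝ) / n = 2 * ((k + 1) / n) := by ring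
    rw [e, abs_le]
    constructor
    · have : max 0 (1 - (k + 1 : ℝ) / n) ≤ max 0 (1 - (k + 1 : ℝ) / m) :=
        max_le_max le_rfl (by linarith)
      linarith [h1, h2]
    · have i1 : max 0 (1 - (k + 1 : ℝ) / m) ≤ 1 := max_le zero_le_one (by linarith)
      have i2 := le_max_right 0 (1 - (k + 1 : ℝ) / n)
      linarith
  · rw [fejer_eq hn hnm α, fejer_eq (hn.trans hnm) le_rfl α, add_sub_add_left_eq_sub,
      ← Finset.sum_sub_distrib]
    exact Finset.sum_congr rfl fun k _ => by ring

end Fejer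

section BlockAngle

theorem abs_rpow_sub_rpow_le {p x y : ℝ} (hp : 1 ≤ p) (hx : x ∈ Set.Icc (1 : ℝ) 2)
    (hy : y ∈ Set.Icc (1 : ℝ) 2) : |x ^ p - y ^ p| ≤ p * 2 ^ p * |x - y| := by
  have := (convex_Icc (1 : ℝ) 2).norm_image_sub_le_of_norm_hasDerivWithin_le
    (f := fun z : ℝ => z ^ p) (f' := fun z => p * z ^ (p - 1)) (C := p * 2 ^ p)
    (fun z hz => (Real.hasDerivAt_rpow_const (Or.inr hp)).hasDerivWithinAt)
    (fun z hz => by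
      have hz0 : 0 < z := lt_of_lt_of_le one_pos hz.1
      rw [Real.norm_eq_abs, abs_of_nonneg (by positivity)]
      refine mul_le_mul_of_nonneg_left ?_ (by linarith)
      exact (Real.rpow_le_rpow hz0.le hz.2 (by linarith)).trans
        (Real.rpow_le_rpow_of_exponent_le one_le_two (by linarith))) hy hx
  simpa using this

variable {d : ℕ}

/-- The box of lattice points whose coordinates lie in `[T, 2 * T)`. -/
noncomputable def blockBox (d : ℕ) (T : ℝ) : Finset (Fin d → ℤ) := intBox d ⌈T⌉ ⌈2 * T⌉

theorem mem_blockBox {T : ℝ} {s : Fin d → ℤ} :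
    s ∈ blockBox d T ↔ ∀ i, T ≤ s i ∧ (s i : ℝ) < 2 * T := by
  rw [blockBox, mem_intBox]
  exact forall_congr' fun i => by rw [Int.ceil_le, Int.lt_ceil]

theorem blockBox_eq_piFinset (T : ℝ) :
    blockBox d T = Fintype.piFinset fun _ : Fin d => dyadicBlock T := by
  ext s
  simp only [mem_blockBox, Fintype.mem_piFinset, mem_dyadicBlock]

theorem div_mem_Icc_of_mem_blockBox {T : ℝ} (hT : 0 < T) {s : Fin d → ℤ} (hs : s ∈ blockBox d T)
    (i : Fin d) : (s i : ℝ) / T ∈ Set.Icc (1 : ℝ) 2 := by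
  obtain ⟨h1, h2⟩ := mem_blockBox.1 hs i
  exact ⟨by rwa [le_div_iff₀ hT, one_mul], by rw [div_le_iff₀ hT]; exact h2.le⟩

/-- The normalized deviation of `∑ (s i / T) ^ p` from its value at `s i = 3 * T / 2`. -/
noncomputable def blockAngle (p T : ℝ) (s : Fin d → ℤ) : ℝ :=
  (d * 2 ^ p : ℝ)⁻¹ * (∑ i, ((s i : ℝ) / T) ^ p - d * (3 / 2) ^ p)

theorem abs_blockAngle_le_one {p T : ℝ} (hp : 1 ≤ p) (hT : 0 < T) (hd : 0 < d) {s : Fin d → ℤ}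
    (hs : s ∈ blockBox d T) : |blockAngle p T s| ≤ 1 := by
  have hd' : (0 : ℝ) < d := by exact_mod_cast hd
  have h1 : ∀ x ∈ Set.Icc (1 : ℝ) 2, 0 ≤ x ^ p ∧ x ^ p ≤ 2 ^ p := fun x hx =>
    ⟨Real.rpow_nonneg (by linarith [hx.1]) _, Real.rpow_le_rpow (by linarith [hx.1]) hx.2
      (by linarith)⟩
  have h2 : ∑ i, ((s i : ℝ) / T) ^ p ≤ d * 2 ^ p := by
    calc _ ≤ ∑ i : Fin d, (2 : ℝ) ^ p :=
          Finset.sum_le_sum fun i _ => (h1 _ (div_mem_Icc_of_mem_blockBox hT hs i)).2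
      _ = _ := by simp
  have h3 : 0 ≤ ∑ i, ((s i : ℝ) / T) ^ p :=
    Finset.sum_nonneg fun i _ => (h1 _ (div_mem_Icc_of_mem_blockBox hT hs i)).1
  obtain ⟨h4, h5⟩ := h1 (3 / 2) (by constructor <;> norm_num)
  have hpos : (0 : ℝ) < d * 2 ^ p := by positivity
  rw [blockAngle, abs_mul, abs_of_pos (inv_pos.2 hpos), inv_mul_le_iff₀ hpos, mul_one, abs_le]
  have h6 : (d : ℝ) * (3 / 2) ^ p ≤ d * 2 ^ p := by gcongr
  have h7 : 0 ≤ (d : ℝ) * (3 / 2) ^ p := by positivity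
  constructor <;> linarith

theorem abs_blockAngle_sub_le {p T : ℝ} (hp : 1 ≤ p) (hT : 0 < T) (hd : 0 < d) {s τ : Fin d → ℤ}
    (hs : s ∈ blockBox d T) (hsτ : s + τ ∈ blockBox d T) :
    |blockAngle p T s - blockAngle p T (s + τ)| ≤ p * (∑ i, |(τ i : ℝ)|) / T := by
  have hd' : (1 : ℝ) ≤ d := by exact_mod_cast hd
  have hpos : (0 : ℝ) < d * 2 ^ p := by positivity
  have e : blockAngle p T s - blockAngle p T (s + τ)
      = (d * 2 ^ p : ℝ)⁻¹ * ∑ i, (((s i : ℝ) / T) ^ p - (((s + τ) i : ℝ) / T) ^ p) := by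
    rw [blockAngle, blockAngle, Finset.sum_sub_distrib]; ring
  rw [e, abs_mul, abs_of_pos (inv_pos.2 hpos), inv_mul_le_iff₀ hpos]
  calc _ ≤ ∑ i, |((s i : ℝ) / T) ^ p - (((s + τ) i : ℝ) / T) ^ p| :=
        Finset.abs_sum_le_sum_abs _ _
    _ ≤ ∑ i, p * 2 ^ p / T * |(τ i : ℝ)| := Finset.sum_le_sum fun i _ => by
        refine (abs_rpow_sub_rpow_le hp (div_mem_Icc_of_mem_blockBox hT hs i)
          (div_mem_Icc_of_mem_blockBox hT hsτ i)).trans_eq ?_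
        rw [← sub_div, abs_div, abs_of_pos hT, Pi.add_apply]
        push_cast
        rw [sub_add_cancel_left, abs_neg]
        ring
    _ = 1 * 2 ^ p * (p * (∑ i, |(τ i : ℝ)|) / T) := by rw [← Finset.mul_sum]; ring
    _ ≤ _ := by gcongr

theorem card_blockBox_le {T : ℝ} (hT : 1 ≤ T) : ((blockBox d T).card : ℝ) ≤ (2 * T) ^ d := by
  rw [blockBox_eq_piFinset, Fintype.card_piFinset_const]
  push_cast
  exact pow_le_pow_left₀ (Nat.cast_nonneg _) (card_dyadicBlock_le hT) d

/-- The number of progressions with gaps in the block, weighted by the Fejér kernel. -/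
noncomputable def fejerCount {G : Type} [AddCommGroup G] [Fintype G] (n : ℕ) (p T : ℝ)
    (ρ : (Fin d → ℤ) →+ G) (f : G → ℝ) : ℝ :=
  ∑ s ∈ blockBox d T, fejer n (blockAngle p T s) * apCount f (ρ s)

theorem sum_inv_sq_le (m : ℕ) : ∑ k ∈ Finset.range m, 1 / ((k : ℝ) + 1) ^ 2 ≤ 2 := by
  suffices h : ∑ k ∈ Finset.range m, 1 / ((k : ℝ) + 1) ^ 2 ≤ 2 - 1 / (m : ℝ) by
    have : (0 : ℝ) ≤ 1 / (m : ℝ) := by positivity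
    linarith
  induction m with
  | zero => norm_num
  | succ m ih =>
    rw [Finset.sum_range_succ]
    rcases Nat.eq_zero_or_pos m with rfl | hm
    · norm_num
    have hm' : (0 : ℝ) < m := by exact_mod_cast hm
    have h : 1 / ((m : ℝ) + 1) ^ 2 ≤ 1 / (m : ℝ) - 1 / ((m : ℝ) + 1) := by
      rw [div_sub_div _ _ hm'.ne' (by positivity), div_le_div_iff₀ (by positivity) (by positivity)]
      nlinarith
    push_cast
    linarith

theorem exists_abs_fejerCount_sub_le {p : ℝ} (h0 : p ≠ 0) (h1 : p ≠ 1) (h2 : p ≠ 2)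
    (hd : 36 ≤ d) : ∃ C : ℝ, 0 < C ∧ ∀ n m : ℕ, 1 ≤ n → n ≤ m → ∃ T₁ : ℝ, ∀ T, T₁ ≤ T →
      ∀ (G : Type) [AddCommGroup G] [Fintype G] (ρ : (Fin d → ℤ) →+ G) (f : G → ℝ),
      (∀ x, |f x| ≤ 1) →
      |fejerCount m p T ρ f - fejerCount n p T ρ f| ≤ C / n * (Fintype.card G * T ^ d) := by
  have hd0 : 0 < d := by omega
  have hd' : (0 : ℝ) < d := by exact_mod_cast hd0
  obtain ⟨C, hC, key⟩ := exists_norm_sum_exp_mul_apCount_le h0 h1 h2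
    (θ := (d * 2 ^ p : ℝ)⁻¹) (by positivity) hd
  refine ⟨4 * C, by positivity, fun n m hn hnm => ?_⟩
  have hn0 : (0 : ℝ) < n := by exact_mod_cast hn
  choose T₁ hT₁ using fun k : ℕ => key (k + 1) (by omega)
  obtain ⟨a, ha, hexp⟩ := exists_fejer_sub_eq hn hnm
  refine ⟨max 0 (∑ k ∈ Finset.range m, |T₁ k|), fun T hT G _ _ ρ f hf => ?_⟩
  have hT0 : 0 ≤ T := (le_max_left _ _).trans hT
  have hcos : ∀ k ∈ Finset.range m, |∑ s ∈ blockBox d T,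
      Real.cos ((k + 1) * blockAngle p T s) * apCount f (ρ s)|
      ≤ C * Fintype.card G * T ^ d / (k + 1 : ℝ) ^ 3 := by
    intro k hk
    have hTk : T₁ k ≤ T := (le_abs_self _).trans ((Finset.single_le_sum
      (f := fun k => |T₁ k|) (fun _ _ => abs_nonneg _) hk).trans ((le_max_right _ _).trans hT))
    have := hT₁ k T hTk G ρ f hf
    rw [← blockBox_eq_piFinset] at this
    push_cast only [Nat.cast_add, Nat.cast_one] at this
    set c₀ : ℝ := (k + 1) * ((d * 2 ^ p : ℝ)⁻¹ * (d * (3 / 2) ^ p)) with hc₀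
    have e : (∑ s ∈ blockBox d T, Real.cos ((k + 1) * blockAngle p T s) * apCount f (ρ s))
        = (Complex.exp ((-c₀ : ℝ) * Complex.I) * ∑ s ∈ blockBox d T,
          Complex.exp (((k + 1) * (d * 2 ^ p : ℝ)⁻¹ * ∑ i, ((s i : ℝ) / T) ^ p : ℝ) * Complex.I)
            * (apCount f (ρ s) : ℂ)).re := by
      rw [Finset.mul_sum, Complex.re_sum]
      refine Finset.sum_congr rfl fun s _ => ?_
      rw [← mul_assoc, ← Complex.exp_add, ← add_mul, ← Complex.ofReal_add, Complex.re_mul_ofReal,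
        Complex.exp_ofReal_mul_I_re]
      congr 2
      rw [hc₀, blockAngle]
      ring
    rw [e]
    refine (Complex.abs_re_le_norm _).trans ?_
    rw [norm_mul, Complex.norm_exp_ofReal_mul_I, one_mul]
    exact this
  have e : fejerCount m p T ρ f - fejerCount n p T ρ f = ∑ k ∈ Finset.range m,
      a k * ∑ s ∈ blockBox d T, Real.cos ((k + 1) * blockAngle p T s) * apCount f (ρ s) := by
    rw [fejerCount, fejerCount, ← Finset.sum_sub_distrib]
    simp only [← sub_mul, hexp, Finset.sum_mul, Finset.mul_sum]
    rw [Finset.sum_comm]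
    exact Finset.sum_congr rfl fun _ _ => Finset.sum_congr rfl fun _ _ => by ring
  rw [e]
  calc _ ≤ ∑ k ∈ Finset.range m, 2 * (k + 1 : ℝ) / n
        * (C * Fintype.card G * T ^ d / (k + 1 : ℝ) ^ 3) := by
        refine (Finset.abs_sum_le_sum_abs _ _).trans (Finset.sum_le_sum fun k hk => ?_)
        rw [abs_mul]
        exact mul_le_mul (ha k) (hcos k hk) (abs_nonneg _) (by positivity)
    _ = 2 * C / n * (Fintype.card G * T ^ d) * ∑ k ∈ Finset.range m, 1 / ((k : ℝ) + 1) ^ 2 := by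
        rw [Finset.mul_sum]
        refine Finset.sum_congr rfl fun k _ => ?_
        field_simp
    _ ≤ 2 * C / n * (Fintype.card G * T ^ d) * 2 := by
        gcongr; exact sum_inv_sq_le m
    _ = _ := by ring

theorem fejerCount_le_of_forall {G : Type} [AddCommGroup G] [Fintype G] {p T κ : ℝ} (hp : 1 ≤ p)
    (hT : 1 ≤ T) (hd : 0 < d) (hκ : 0 < κ) (n : ℕ) (ρ : (Fin d → ℤ) →+ G) {f : G → ℝ}
    (hf : ∀ x, |f x| ≤ 1)
    (h : ∀ s ∈ blockBox d T, |∑ i, ((s i : ℝ) / T) ^ p - d * (3 / 2) ^ p| < κ →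
      apCount f (ρ s) = 0) :
    fejerCount n p T ρ f
      ≤ 16 * (d * 2 ^ p) ^ 2 / (n * κ ^ 2) * (Fintype.card G * (2 * T) ^ d) := by
  have hd' : (0 : ℝ) < d := by exact_mod_cast hd
  have hpos : (0 : ℝ) < d * 2 ^ p := by positivity
  have hT0 : 0 < T := by linarith
  calc fejerCount n p T ρ f ≤ ∑ s ∈ blockBox d T,
        16 * (d * 2 ^ p) ^ 2 / (n * κ ^ 2) * Fintype.card G := Finset.sum_le_sum fun s hs => by
        by_cases hc : |∑ i, ((s i : ℝ) / T) ^ p - d * (3 / 2) ^ p| < κ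
        · rw [h s hs hc, mul_zero]; positivity
        · have hα : κ / (d * 2 ^ p) ≤ |blockAngle p T s| := by
            rw [blockAngle, abs_mul, abs_of_pos (inv_pos.2 hpos), inv_mul_eq_div]
            gcongr
            exact not_lt.1 hc
          have h1 := fejer_mul_sq_le n ((abs_blockAngle_le_one hp hT0 hd hs).trans
            (by linarith [Real.pi_gt_three]))
          have h2 : fejer n (blockAngle p T s) * (κ / (d * 2 ^ p)) ^ 2 ≤ 16 / n := by
            refine le_trans ?_ h1
            rw [← sq_abs (blockAngle p T s)]
            exact mul_le_mul_of_nonneg_left (pow_le_pow_left₀ (by positivity) hα 2)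
              (fejer_nonneg _ _)
          have h3 : fejer n (blockAngle p T s) ≤ 16 * (d * 2 ^ p) ^ 2 / (n * κ ^ 2) := by
            calc _ = fejer n (blockAngle p T s) * (κ / (d * 2 ^ p)) ^ 2
                  * ((d * 2 ^ p) ^ 2 / κ ^ 2) := by field_simp
              _ ≤ 16 / n * ((d * 2 ^ p) ^ 2 / κ ^ 2) := by gcongr
              _ = _ := by ring
          have h4 : apCount f (ρ s) ≤ Fintype.card G := by
            refine (le_abs_self _).trans ((abs_sum_le_card_mul (C := 1) fun x => ?_).trans_eq
              (one_mul _))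
            rw [abs_mul, abs_mul]
            exact mul_le_one₀ (mul_le_one₀ (hf _) (abs_nonneg _) (hf _)) (abs_nonneg _) (hf _)
          exact (mul_le_mul_of_nonneg_left h4 (fejer_nonneg _ _)).trans
            (mul_le_mul_of_nonneg_right h3 (Nat.cast_nonneg _))
    _ = (blockBox d T).card * (16 * (d * 2 ^ p) ^ 2 / (n * κ ^ 2) * Fintype.card G) := by simp
    _ ≤ (2 * T) ^ d * (16 * (d * 2 ^ p) ^ 2 / (n * κ ^ 2) * Fintype.card G) := by
        gcongr; exact card_blockBox_le hT
    _ = _ := by ring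

end BlockAngle

section BlockMass

/-- The integers `z` with `|2 * z / T - y| ≤ u`. -/
noncomputable def halfWindow (T y u : ℝ) : Finset ℤ :=
  Finset.Icc ⌈T * (y - u) / 2⌉ ⌊T * (y + u) / 2⌋

theorem mem_halfWindow {T y u : ℝ} (hT : 0 < T) {z : ℤ} :
    z ∈ halfWindow T y u ↔ |((z + z : ℤ) : ℝ) / T - y| ≤ u := by
  rw [halfWindow, Finset.mem_Icc, Int.ceil_le, Int.le_floor, abs_le, le_sub_iff_add_le,
    sub_le_iff_le_add, le_div_iff₀ hT, div_le_iff₀ hT]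
  push_cast
  constructor <;> rintro ⟨h1, h2⟩ <;> constructor <;> linarith

theorem le_card_halfWindow {T y u : ℝ} (hTu : 2 ≤ T * u) :
    T * u / 2 ≤ ((halfWindow T y u).card : ℝ) := by
  rw [halfWindow, Int.card_Icc]
  have h1 : T * u - 1 ≤ ((⌊T * (y + u) / 2⌋ + 1 - ⌈T * (y - u) / 2⌉ : ℤ) : ℝ) := by
    push_cast
    linarith [Int.lt_floor_add_one (T * (y + u) / 2), Int.ceil_lt_add_one (T * (y - u) / 2)]
  have h2 : ((⌊T * (y + u) / 2⌋ + 1 - ⌈T * (y - u) / 2⌉ : ℤ) : ℝ)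
      ≤ ((⌊T * (y + u) / 2⌋ + 1 - ⌈T * (y - u) / 2⌉).toNat : ℝ) := by
    rw [← Int.cast_natCast (R := ℝ), Int.cast_le]
    exact Int.self_le_toNat _
  linarith

theorem exists_le_sum_fejer {p : ℝ} (hp : 1 ≤ p) {d : ℕ} (hd : 0 < d) :
    ∃ c : ℝ, 0 < c ∧ ∀ n : ℕ, 1 ≤ n → ∃ T₁ : ℝ, ∀ T, T₁ ≤ T →
      c * T ^ d ≤ ∑ t ∈ blockBox d (T / 2), fejer n (blockAngle p T (t + t)) := by
  obtain ⟨e, rfl⟩ : ∃ e, d = e + 1 := ⟨d - 1, by omega⟩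
  have hp0 : 0 < p := by linarith
  set γ : ℝ := min ((3 / 2) ^ p - (6 / 5) ^ p) ((9 / 5) ^ p - (3 / 2) ^ p) with hγ
  have hγ0 : 0 < γ := lt_min
    (sub_pos.2 (Real.rpow_lt_rpow (by norm_num) (by norm_num) hp0))
    (sub_pos.2 (Real.rpow_lt_rpow (by norm_num) (by norm_num) hp0))
  set r : ℝ := min (1 / 4) (γ / (e * (p * 2 ^ p) + 1)) with hr
  have hr0 : 0 < r := by positivity
  have hrγ : e * (p * 2 ^ p * r) ≤ γ := by
    have h1 : r ≤ γ / (e * (p * 2 ^ p) + 1) := min_le_right _ _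
    rw [le_div_iff₀ (by positivity)] at h1
    nlinarith
  refine ⟨(r / 2) ^ e / (80 * p), by positivity, fun n hn => ?_⟩
  have hn0 : (1 : ℝ) ≤ n := by exact_mod_cast hn
  set u : ℝ := 1 / (10 * p * n) with hu
  have hu0 : 0 < u := by positivity
  have hu1 : u ≤ 1 / 10 := by
    rw [hu]; gcongr
    nlinarith
  refine ⟨2 / r + 2 / u, fun T hT => ?_⟩
  have hTr : 2 ≤ T * r := by
    have : 2 / r ≤ T := le_trans (by linarith [show 0 < 2 / u by positivity]) hT
    rwa [div_le_iff₀ hr0] at this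
  have hTu : 2 ≤ T * u := by
    have : 2 / u ≤ T := le_trans (by linarith [show 0 < 2 / r by positivity]) hT
    rwa [div_le_iff₀ hu0] at this
  have hT0 : 0 < T := by
    by_contra h
    nlinarith [not_lt.1 h]
  set J : Finset ℤ := halfWindow T (3 / 2) r with hJ
  set v : (Fin e → ℤ) → ℝ := fun t => ((e + 1 : ℕ) : ℝ) * (3 / 2) ^ p
    - ∑ i, (((t i + t i : ℤ) : ℝ) / T) ^ p with hv
  set P : Finset (Σ _ : Fin e → ℤ, ℤ) := (Fintype.piFinset fun _ : Fin e => J).sigma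
    fun t => halfWindow T (v t ^ p⁻¹) u with hP
  have hJ2 : ∀ t ∈ Fintype.piFinset (fun _ : Fin e => J), ∀ i,
      |((t i + t i : ℤ) : ℝ) / T - 3 / 2| ≤ r := fun t ht i =>
    (mem_halfWindow hT0).1 (Fintype.mem_piFinset.1 ht i)
  have hr4 : r ≤ 1 / 4 := min_le_left _ _
  have hvmem : ∀ t ∈ Fintype.piFinset (fun _ : Fin e => J),
      v t ^ p⁻¹ ∈ Set.Icc (6 / 5 : ℝ) (9 / 5) ∧ (v t ^ p⁻¹) ^ p = v t := by
    intro t ht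
    have h1 : |∑ i, ((((t i + t i : ℤ) : ℝ) / T) ^ p - (3 / 2) ^ p)| ≤ γ := by
      refine (Finset.abs_sum_le_sum_abs _ _).trans (le_trans ?_ hrγ)
      calc _ ≤ ∑ i : Fin e, p * 2 ^ p * r := Finset.sum_le_sum fun i _ => by
            have hi := hJ2 t ht i
            obtain ⟨a1, a2⟩ := abs_le.1 hi
            refine (abs_rpow_sub_rpow_le hp ⟨by linarith, by linarith⟩
              (by constructor <;> norm_num)).trans ?_
            gcongr
        _ = _ := by simp
    have h2 : v t = (3 / 2) ^ p - ∑ i, ((((t i + t i : ℤ) : ℝ) / T) ^ p - (3 / 2) ^ p) := by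
      simp only [hv, Finset.sum_sub_distrib, Finset.sum_const, Finset.card_univ,
        Fintype.card_fin, nsmul_eq_mul]
      push_cast
      ring
    obtain ⟨h3, h4⟩ := abs_le.1 h1
    have h5 : (6 / 5 : ℝ) ^ p ≤ v t := by
      have := min_le_left ((3 / 2 : ℝ) ^ p - (6 / 5) ^ p) ((9 / 5) ^ p - (3 / 2) ^ p)
      linarith
    have h6 : v t ≤ (9 / 5 : ℝ) ^ p := by
      have := min_le_right ((3 / 2 : ℝ) ^ p - (6 / 5) ^ p) ((9 / 5) ^ p - (3 / 2) ^ p)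
      linarith
    have h7 : 0 ≤ v t := le_trans (by positivity) h5
    refine ⟨⟨?_, ?_⟩, Real.rpow_inv_rpow h7 hp0.ne'⟩
    · rw [Real.le_rpow_inv_iff_of_pos (by norm_num) h7 hp0]; exact h5
    · rw [Real.rpow_inv_le_iff_of_pos h7 (by norm_num) hp0]; exact h6
  have hPmem : ∀ q ∈ P, (Fin.cons q.2 q.1 : Fin (e + 1) → ℤ) ∈ blockBox (e + 1) (T / 2) ∧
      n / 4 ≤ fejer n (blockAngle p T
        ((Fin.cons q.2 q.1 : Fin (e + 1) → ℤ) + (Fin.cons q.2 q.1 : Fin (e + 1) → ℤ))) := by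
    rintro ⟨t, z⟩ hq
    obtain ⟨ht, hz⟩ := Finset.mem_sigma.1 hq
    simp only at ht hz ⊢
    rw [mem_halfWindow hT0] at hz
    obtain ⟨⟨y1, y2⟩, y3⟩ := hvmem t ht
    obtain ⟨z1, z2⟩ := abs_le.1 hz
    have conv : ∀ w : ℤ, 1 ≤ ((w + w : ℤ) : ℝ) / T → ((w + w : ℤ) : ℝ) / T < 2 →
        T / 2 ≤ w ∧ (w : ℝ) < 2 * (T / 2) := fun w h1 h2 => by
      rw [le_div_iff₀ hT0] at h1
      rw [div_lt_iff₀ hT0] at h2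
      push_cast at h1 h2
      constructor <;> linarith
    refine ⟨mem_blockBox.2 fun i => ?_, le_fejer hn ?_⟩
    · refine Fin.cases ?_ (fun i => ?_) i
      · rw [Fin.cons_zero]; exact conv z (by linarith) (by linarith)
      · obtain ⟨a1, a2⟩ := abs_le.1 (hJ2 t ht i)
        rw [Fin.cons_succ]; exact conv _ (by linarith) (by linarith)
    · have ez : (((z + z : ℤ) : ℝ) / T) ^ p - (v t ^ p⁻¹) ^ p = ∑ i, ((((Fin.cons z t
          : Fin (e + 1) → ℤ) + (Fin.cons z t : Fin (e + 1) → ℤ)) i : ℝ) / T) ^ p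
            - ((e + 1 : ℕ) : ℝ) * (3 / 2) ^ p := by
        rw [y3, Fin.sum_univ_succ]
        simp only [hv, Pi.add_apply, Fin.cons_zero, Fin.cons_succ]
        ring
      have hb := abs_rpow_sub_rpow_le hp (x := ((z + z : ℤ) : ℝ) / T) (y := v t ^ p⁻¹)
        ⟨by linarith, by linarith⟩ ⟨by linarith, by linarith⟩
      rw [ez] at hb
      have hpos : (0 : ℝ) < ((e + 1 : ℕ) : ℝ) * 2 ^ p := by positivity
      rw [blockAngle, abs_mul, abs_of_pos (inv_pos.2 hpos), inv_mul_le_iff₀ hpos]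
      refine hb.trans ?_
      calc p * 2 ^ p * |((z + z : ℤ) : ℝ) / T - v t ^ p⁻¹| ≤ p * 2 ^ p * u := by gcongr
        _ = 1 / 10 * 2 ^ p * (1 / n) := by rw [hu]; field_simp
        _ ≤ _ := by
          gcongr
          push_cast
          linarith [show (0 : ℝ) ≤ e from Nat.cast_nonneg e]
  have hinj : Set.InjOn (fun q : Σ _ : Fin e → ℤ, ℤ => (Fin.cons q.2 q.1 : Fin (e + 1) → ℤ)) P := by
    rintro ⟨t, z⟩ _ ⟨t', z'⟩ _ h
    obtain ⟨h1, h2⟩ := Fin.cons_injective2 h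
    simp only at h1 h2
    subst h1; subst h2; rfl
  have hcard : (T * r / 2) ^ e * (T * u / 2) ≤ (P.card : ℝ) := by
    rw [hP, Finset.card_sigma]
    push_cast
    calc (T * r / 2) ^ e * (T * u / 2) ≤ (J.card : ℝ) ^ e * (T * u / 2) := by
          gcongr; exact le_card_halfWindow hTr
      _ = ∑ t ∈ Fintype.piFinset (fun _ : Fin e => J), T * u / 2 := by
          rw [Finset.sum_const, Fintype.card_piFinset_const, nsmul_eq_mul, Nat.cast_pow]
      _ ≤ _ := Finset.sum_le_sum fun t _ => le_card_halfWindow hTu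
  calc (r / 2) ^ e / (80 * p) * T ^ (e + 1) = (T * r / 2) ^ e * (T * u / 2) * (n / 4) := by
        rw [hu, mul_div_assoc, mul_pow, pow_succ]; field_simp; norm_num
    _ ≤ P.card * (n / 4) := by gcongr
    _ = ∑ q ∈ P, (n / 4 : ℝ) := by rw [Finset.sum_const, nsmul_eq_mul]
    _ ≤ ∑ q ∈ P, fejer n (blockAngle p T
        ((Fin.cons q.2 q.1 : Fin (e + 1) → ℤ) + (Fin.cons q.2 q.1 : Fin (e + 1) → ℤ))) :=
        Finset.sum_le_sum fun q hq => (hPmem q hq).2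
    _ = ∑ t ∈ P.image (fun q : Σ _ : Fin e → ℤ, ℤ => (Fin.cons q.2 q.1 : Fin (e + 1) → ℤ)),
        fejer n (blockAngle p T (t + t)) := by rw [Finset.sum_image hinj]
    _ ≤ _ := Finset.sum_le_sum_of_subset_of_nonneg
        (fun t ht => by
          obtain ⟨q, hq, rfl⟩ := Finset.mem_image.1 ht
          exact (hPmem q hq).1) fun _ _ _ => fejer_nonneg _ _

end BlockMass

section BlockKernels

variable {G : Type} [AddCommGroup G] [Fintype G] {d : ℕ}

theorem NearInv.kerCorr {u : G → ℝ} {t : G} {η : ℝ} (hu : IsProbKer u) (h : NearInv u t η) :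
    NearInv (kerCorr u) t η := by
  intro φ hφ
  rw [sum_kerCorr_mul u (fun g => φ (g + t)), sum_kerCorr_mul u φ, ← Finset.sum_sub_distrib]
  simp only [← mul_sub]
  refine hu.abs_sum_le fun r _ => ?_
  have := h (fun s => φ (s - r)) fun _ => hφ _
  simpa only [add_sub_right_comm] using this

theorem boxEnergy_nonneg {u : G → ℝ} (hu : IsProbKer u) (f : G → ℝ) : 0 ≤ boxEnergy f u u :=
  Finset.sum_nonneg fun t _ => Finset.sum_nonneg fun t' _ =>
    mul_nonneg (mul_nonneg (hu.nonneg t) (hu.nonneg t')) (Finset.sum_nonneg fun _ _ => sq_nonneg _)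

theorem boxEnergy_le {u f : G → ℝ} (hu : IsProbKer u) (hf : ∀ x, |f x| ≤ 1) :
    boxEnergy f u u ≤ Fintype.card G := by
  have h : ∀ r, energy u (pairProd f r) ≤ Fintype.card G := fun r => by
    refine (hu.energy_le _).trans ?_
    calc ∑ x, pairProd f r x ^ 2 ≤ ∑ _x : G, (1 : ℝ) := Finset.sum_le_sum fun x _ => by
          rw [← sq_abs]; exact pow_le_one₀ (abs_nonneg _) (abs_pairProd_le hf _ _)
      _ = _ := by simp
  calc boxEnergy f u u ≤ ∑ t, ∑ t', u t * u t' * (Fintype.card G : ℝ) :=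
        Finset.sum_le_sum fun t _ => Finset.sum_le_sum fun t' _ =>
          mul_le_mul_of_nonneg_left (h _) (mul_nonneg (hu.nonneg t) (hu.nonneg t'))
    _ = (∑ t, u t) * (∑ t', u t') * Fintype.card G := by
        rw [Finset.sum_mul_sum, Finset.sum_mul]
        exact Finset.sum_congr rfl fun _ _ => by rw [Finset.sum_mul]
    _ = _ := by rw [hu.sum_one]; ring

/-- The push-forward of the Fejér weights on the block. -/
noncomputable def blockKer (n : ℕ) (p T : ℝ) (ρ : (Fin d → ℤ) →+ G) : G → ℝ :=
  pushKer (blockBox d T) (fun s => fejer n (blockAngle p T s)) ρ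

theorem blockKer_nonneg (n : ℕ) (p T : ℝ) (ρ : (Fin d → ℤ) →+ G) (g : G) :
    0 ≤ blockKer n p T ρ g :=
  pushKer_nonneg _ (fun _ _ => fejer_nonneg _ _) g

theorem sum_blockKer_mul (n : ℕ) (p T : ℝ) (ρ : (Fin d → ℤ) →+ G) (φ : G → ℝ) :
    ∑ g, blockKer n p T ρ g * φ g
      = ∑ s ∈ blockBox d T, fejer n (blockAngle p T s) * φ (ρ s) :=
  sum_pushKer_mul _ _ _ _

theorem sum_blockBox_half_le {T : ℝ} {F : (Fin d → ℤ) → ℝ} (hF : ∀ s, 0 ≤ F s) :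
    ∑ t ∈ blockBox d (T / 2), F (t + t) ≤ ∑ s ∈ blockBox d T, F s := by
  classical
  have hinj : Set.InjOn (fun t : Fin d → ℤ => t + t) (blockBox d (T / 2)) := by
    intro t _ t' _ h
    funext i
    have := congrFun h i
    simp only [Pi.add_apply] at this
    omega
  rw [← Finset.sum_image (f := F) hinj]
  refine Finset.sum_le_sum_of_subset_of_nonneg (fun s hs => ?_) fun _ _ _ => hF _
  obtain ⟨t, ht, rfl⟩ := Finset.mem_image.1 hs
  refine mem_blockBox.2 fun i => ?_
  have := mem_blockBox.1 ht i
  simp only [Pi.add_apply]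
  push_cast
  constructor <;> linarith [this.1, this.2]

theorem sum_blockKer_le {n : ℕ} {p T : ℝ} (hT : 1 ≤ T) (ρ : (Fin d → ℤ) →+ G) :
    ∑ g, blockKer n p T ρ g ≤ n * (2 * T) ^ d := by
  have h := sum_blockKer_mul n p T ρ (fun _ => 1)
  simp only [mul_one] at h
  rw [h]
  calc _ ≤ ∑ s ∈ blockBox d T, (n : ℝ) := Finset.sum_le_sum fun _ _ => fejer_le _ _
    _ = n * (blockBox d T).card := by simp [mul_comm]
    _ ≤ _ := by gcongr; exact card_blockBox_le hT

theorem abs_sum_fejer_shift_sub_le {p T : ℝ} (hp : 1 ≤ p) (hT : 1 ≤ T) (hd : 0 < d) (n : ℕ)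
    {ψ : (Fin d → ℤ) → ℝ} (hψ : ∀ s, |ψ s| ≤ 1) (τ : Fin d → ℤ) :
    |∑ s ∈ blockBox d T, fejer n (blockAngle p T s) * ψ (s + τ)
      - ∑ s ∈ blockBox d T, fejer n (blockAngle p T s) * ψ s|
      ≤ (2 * n ^ 2 * p + 2 * n) * ((∑ i, |(τ i : ℝ)|) / T) * (2 * T) ^ d := by
  have hT0 : 0 < T := by linarith
  have hL : 0 ≤ ∑ i, |(τ i : ℝ)| := Finset.sum_nonneg fun _ _ => abs_nonneg _
  have hab : ⌈T⌉ ≤ ⌈2 * T⌉ := Int.ceil_mono (by linarith)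
  have hlen0 : (0 : ℝ) ≤ ((⌈2 * T⌉ - ⌈T⌉ : ℤ) : ℝ) := by
    exact_mod_cast sub_nonneg.2 hab
  have hlen : ((⌈2 * T⌉ - ⌈T⌉ : ℤ) : ℝ) ≤ 2 * T := by
    push_cast
    linarith [Int.ceil_lt_add_one (2 * T), Int.le_ceil T]
  have h := abs_sum_intBox_shift_sub_le (d := d) hab
    (w := fun s => fejer n (blockAngle p T s)) (ψ := ψ) (K := n)
    (ε := 2 * n ^ 2 * (p * (∑ i, |(τ i : ℝ)|) / T)) τ hψ
    (fun s _ => by rw [abs_of_nonneg (fejer_nonneg _ _)]; exact fejer_le _ _)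
    (fun s hs hs' => (abs_fejer_sub_le _ _ _).trans (by
      gcongr; exact abs_blockAngle_sub_le hp hT0 hd hs hs')) (by positivity) (Nat.cast_nonneg n)
  refine h.trans ?_
  calc _ ≤ 2 * n ^ 2 * (p * (∑ i, |(τ i : ℝ)|) / T) * (2 * T) ^ d
        + 2 * n * ((∑ i, |(τ i : ℝ)|) * (2 * T) ^ (d - 1)) := by gcongr
    _ = (2 * n ^ 2 * p + n) * ((∑ i, |(τ i : ℝ)|) / T) * (2 * T) ^ d := by
        obtain ⟨e, rfl⟩ : ∃ e, d = e + 1 := ⟨d - 1, by omega⟩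
        rw [Nat.add_sub_cancel, pow_succ]
        field_simp
        ring
    _ ≤ _ := by
        gcongr
        linarith [show (0 : ℝ) ≤ n from Nat.cast_nonneg n]

theorem sum_abs_le_of_mem_intBox {L : ℕ} {τ : Fin d → ℤ} (h : τ ∈ intBox d 0 L) :
    ∑ i, |(τ i : ℝ)| ≤ d * L := by
  rw [mem_intBox] at h
  calc _ ≤ ∑ i : Fin d, (L : ℝ) := Finset.sum_le_sum fun i _ => by
        rw [abs_of_nonneg (by exact_mod_cast (h i).1)]
        exact_mod_cast (h i).2.le
    _ = _ := by simp

theorem nearInv_boxKer_of_ne_zero (ρ : (Fin d → ℤ) →+ G) {L L' : ℕ} (hL : 0 < L') {t : G}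
    (ht : boxKer ρ L t ≠ 0) : NearInv (boxKer ρ L') t (2 * (d * L) / L') := by
  obtain ⟨τ, hτ, rfl⟩ := exists_of_pushKer_ne_zero ht
  refine (nearInv_boxKer ρ hL τ).mono ?_
  gcongr
  exact sum_abs_le_of_mem_intBox hτ

theorem nearInv_boxKer_of_blockKer_ne_zero (ρ : (Fin d → ℤ) →+ G) {n : ℕ} {p T : ℝ} (hT : 0 ≤ T)
    {L : ℕ} (hL : 0 < L) {s : G} (hs : blockKer n p T ρ s ≠ 0) :
    NearInv (boxKer ρ L) (s + s) (2 * (d * (2 * T)) / L) := by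
  obtain ⟨σ, hσ, rfl⟩ := exists_of_pushKer_ne_zero hs
  rw [← map_add]
  refine (nearInv_boxKer ρ hL σ).mono ?_
  gcongr
  calc _ ≤ ∑ i : Fin d, 2 * T := Finset.sum_le_sum fun i _ => by
        obtain ⟨h1, h2⟩ := mem_blockBox.1 hσ i
        rw [abs_of_nonneg (hT.trans h1)]
        exact h2.le
    _ = _ := by simp

theorem le_sum_blockKer_mul_kerCorr {n : ℕ} {p T c : ℝ} (ρ : (Fin d → ℤ) →+ G)
    {L : ℕ} (hL : 0 < L) {f : G → ℝ} (hf : ∀ x, 0 ≤ f x) (hf1 : ∀ x, |f x| ≤ 1)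
    (hc : c * Fintype.card G ≤ ∑ g, kerCorr (boxKer ρ L) g * apCount f g) (hT : 0 < T)
    (hTL : 4 * (d * T) / L ≤ c) :
    (∑ t ∈ blockBox d (T / 2), fejer n (blockAngle p T (t + t))) * (c / 2 * Fintype.card G)
      ≤ ∑ s, blockKer n p T ρ s * ∑ t, kerCorr (boxKer ρ L) t * apCount f (s + t) := by
  have hu := isProbKer_boxKer ρ hL
  set V : ℝ := (Fintype.card G : ℝ) with hV
  have hV0 : 0 < V := by
    rw [hV]
    exact Nat.cast_pos.2 Fintype.card_pos
  have hap : ∀ s, |apCount f s| ≤ V := fun s => by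
    refine (abs_sum_le_card_mul (C := 1) fun x => ?_).trans_eq (one_mul _)
    rw [abs_mul, abs_mul]
    exact mul_le_one₀ (mul_le_one₀ (hf1 _) (abs_nonneg _) (hf1 _)) (abs_nonneg _) (hf1 _)
  rw [sum_blockKer_mul n p T ρ fun s => ∑ t, kerCorr (boxKer ρ L) t * apCount f (s + t)]
  refine le_trans ?_ (sum_blockBox_half_le (F := fun s => fejer n (blockAngle p T s)
    * ∑ t, kerCorr (boxKer ρ L) t * apCount f (ρ s + t)) fun s =>
      mul_nonneg (fejer_nonneg _ _) (Finset.sum_nonneg fun t _ =>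
        mul_nonneg (hu.kerCorr.nonneg t) (apCount_nonneg hf _)))
  rw [Finset.sum_mul]
  refine Finset.sum_le_sum fun t ht => mul_le_mul_of_nonneg_left ?_ (fejer_nonneg _ _)
  have hni := ((nearInv_boxKer ρ hL t).kerCorr hu) (fun g => apCount f g / V) fun g => by
    rw [abs_div, abs_of_pos hV0, div_le_one hV0]; exact hap g
  simp only [← mul_div_assoc, ← Finset.sum_div, ← sub_div] at hni
  rw [abs_div, abs_of_pos hV0, div_le_iff₀ hV0] at hni
  have hsum : ∑ i, |(t i : ℝ)| ≤ d * T := by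
    calc _ ≤ ∑ i : Fin d, T := Finset.sum_le_sum fun i _ => by
          obtain ⟨h1, h2⟩ := mem_blockBox.1 ht i
          rw [abs_of_nonneg (by linarith)]
          linarith
      _ = _ := by simp
  have hL0 : (0 : ℝ) < L := by exact_mod_cast hL
  have hsmall : 2 * (∑ i, |(t i : ℝ)|) / L ≤ c / 2 := by
    calc _ ≤ 2 * (d * T) / L := by gcongr
      _ = 4 * (d * T) / L / 2 := by ring
      _ ≤ _ := by linarith
  have h1 := (abs_le.1 hni).1
  have h2 : 2 * (∑ i, |(t i : ℝ)|) / L * V ≤ c / 2 * V := mul_le_mul_of_nonneg_right hsmall hV0.le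
  have e : ∑ g, kerCorr (boxKer ρ L) g * apCount f (ρ (t + t) + g)
      = ∑ g, kerCorr (boxKer ρ L) g * apCount f (g + ρ (t + t)) :=
    Finset.sum_congr rfl fun g _ => by rw [add_comm]
  rw [e]
  linarith

end BlockKernels

section SingleScale

variable {G : Type} [AddCommGroup G] [Fintype G] {d : ℕ}

theorem le_sum_blockKer {n : ℕ} {p T c : ℝ} (ρ : (Fin d → ℤ) →+ G)
    (h : c ≤ ∑ t ∈ blockBox d (T / 2), fejer n (blockAngle p T (t + t))) :
    c ≤ ∑ g, blockKer n p T ρ g := by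
  have e := sum_blockKer_mul n p T ρ fun _ => 1
  simp only [mul_one] at e
  rw [e]
  exact h.trans (sum_blockBox_half_le (F := fun s => fejer n (blockAngle p T s))
    fun _ => fejer_nonneg _ _)

theorem le_fejerCount_of_boxEnergy_sub_le {n : ℕ} {p T η ε c₁ c₂ : ℝ} {a b c : ℕ} (hp : 1 ≤ p)
    (hT : 1 ≤ T) (hd : 0 < d) (ρ : (Fin d → ℤ) →+ G) {f : G → ℝ} (hf : ∀ x, f x = 0 ∨ f x = 1)
    (ha : 0 < a) (hb : 0 < b) (hc : 0 < c) (hη : 0 ≤ η) (hε : 0 < ε) (hε1 : ε ≤ 1)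
    (hηε : η ≤ ε ^ 4 / 1000) (hc₂ : 0 ≤ c₂)
    (hW : c₁ * T ^ d ≤ ∑ t ∈ blockBox d (T / 2), fejer n (blockAngle p T (t + t)))
    (hR : c₂ * Fintype.card G ≤ ∑ g, kerCorr (boxKer ρ b) g * apCount f g)
    (haT : (2 * n ^ 2 * p + 2 * n) * (2 * (d * a) / T) * 2 ^ d ≤ η * c₁)
    (hab : 2 * (d * a) / b ≤ η) (hac : 2 * (d * a) / c ≤ η) (hbc : 2 * (d * b) / c ≤ η)
    (hTc : 2 * (d * (2 * T)) / c ≤ η) (hTb : 4 * (d * T) / b ≤ c₂)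
    (hεn : 2 * ε * (n * 2 ^ d) ≤ c₁ * c₂ / 4)
    (hE : boxEnergy f (boxKer ρ a) (boxKer ρ a) - boxEnergy f (boxKer ρ c) (boxKer ρ c)
      ≤ ε ^ 4 / 1000 * Fintype.card G) :
    c₁ * c₂ / 4 * (Fintype.card G * T ^ d) ≤ fejerCount n p T ρ f := by
  have hT0 : 0 < T := by linarith
  have hf0 : ∀ x, 0 ≤ f x := fun x => by rcases hf x with h | h <;> simp [h]
  have hf1 : ∀ x, |f x| ≤ 1 := fun x => by rcases hf x with h | h <;> simp [h]
  have hWle := le_sum_blockKer ρ hW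
  have hp0 : 0 ≤ p := by linarith
  have hshift : ∀ ψ : (Fin d → ℤ) → ℝ, (∀ s, |ψ s| ≤ 1) → ∀ τ : Fin d → ℤ,
      ∑ i, |(τ i : ℝ)| ≤ 2 * (d * a) →
      |∑ s ∈ blockBox d T, fejer n (blockAngle p T s) * ψ (s + τ)
        - ∑ s ∈ blockBox d T, fejer n (blockAngle p T s) * ψ s|
        ≤ η * ∑ g, blockKer n p T ρ g := by
    intro ψ hψ τ hτ
    refine (abs_sum_fejer_shift_sub_le hp hT hd n hψ τ).trans ?_
    calc _ ≤ (2 * n ^ 2 * p + 2 * n) * (2 * (d * a) / T) * (2 * T) ^ d := by gcongr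
      _ = (2 * n ^ 2 * p + 2 * n) * (2 * (d * a) / T) * 2 ^ d * T ^ d := by
          rw [mul_pow]; ring
      _ ≤ η * c₁ * T ^ d := by gcongr
      _ = η * (c₁ * T ^ d) := by ring
      _ ≤ _ := by gcongr
  have main := abs_sum_apCount_sub_le (a := boxKer ρ a) (b := boxKer ρ b) (c := boxKer ρ c)
    (w := blockKer n p T ρ) (isProbKer_boxKer ρ ha) (isProbKer_boxKer ρ hb)
    (isProbKer_boxKer ρ hc) (blockKer_nonneg n p T ρ) hf1 hη hε hε1
    (fun t ht φ hφ => by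
      obtain ⟨τ, hτ, rfl⟩ := exists_of_pushKer_ne_zero ht
      rw [sum_blockKer_mul n p T ρ fun s => φ (s + ρ (τ + τ)), sum_blockKer_mul n p T ρ φ]
      have := hshift (fun s => φ (ρ s)) (fun s => hφ _) (τ + τ) (by
        have h := sum_abs_le_of_mem_intBox hτ
        calc _ ≤ ∑ i, 2 * |(τ i : ℝ)| := Finset.sum_le_sum fun i _ => by
              simp only [Pi.add_apply]
              push_cast
              exact (abs_add_le _ _).trans_eq (by ring)
          _ = 2 * ∑ i, |(τ i : ℝ)| := by rw [Finset.mul_sum]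
          _ ≤ _ := by linarith)
      simpa only [map_add] using this)
    (fun t ht φ hφ => by
      obtain ⟨τ, hτ, rfl⟩ := exists_of_pushKer_ne_zero ht
      rw [sum_blockKer_mul n p T ρ fun s => φ (s + s + ρ (τ + τ)),
        sum_blockKer_mul n p T ρ fun s => φ (s + s)]
      have := hshift (fun s => φ (ρ s + ρ s)) (fun s => hφ _) τ (by
        have h := sum_abs_le_of_mem_intBox hτ
        have : (0 : ℝ) ≤ d * a := by positivity
        linarith)
      have e : ∀ s, ρ (s + τ) + ρ (s + τ) = ρ s + ρ s + ρ (τ + τ) := fun s => by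
        simp only [map_add]; abel
      simpa only [e] using this)
    (fun t ht => (nearInv_boxKer_of_ne_zero ρ hb ht).mono hab)
    (fun t ht => (nearInv_boxKer_of_ne_zero ρ hc ht).mono hac)
    (fun t ht => (nearInv_boxKer_of_ne_zero ρ hc ht).mono hbc)
    (fun t ht => (nearInv_boxKer_of_blockKer_ne_zero ρ hT0.le hc ht).mono hTc) hηε hE
  have hlow := le_sum_blockKer_mul_kerCorr (n := n) (p := p) ρ hb hf0 hf1 hR hT0 hTb
  rw [sum_blockKer_mul n p T ρ (apCount f)] at main
  change |fejerCount n p T ρ f - _| ≤ _ at main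
  have h1 := (abs_le.1 main).1
  have hV0 : (0 : ℝ) ≤ Fintype.card G := Nat.cast_nonneg _
  have h2 : c₁ * T ^ d * (c₂ / 2 * Fintype.card G)
      ≤ (∑ t ∈ blockBox d (T / 2), fejer n (blockAngle p T (t + t)))
        * (c₂ / 2 * Fintype.card G) := by gcongr
  have h3 : 2 * ε * (∑ s, blockKer n p T ρ s) * Fintype.card G
      ≤ c₁ * c₂ / 4 * (Fintype.card G * T ^ d) := by
    calc _ ≤ 2 * ε * (n * (2 * T) ^ d) * Fintype.card G := by
          gcongr; exact sum_blockKer_le hT ρ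
      _ = 2 * ε * (n * 2 ^ d) * (Fintype.card G * T ^ d) := by rw [mul_pow]; ring
      _ ≤ _ := by gcongr
  have h4 : c₁ * T ^ d * (c₂ / 2 * Fintype.card G)
      = 2 * (c₁ * c₂ / 4 * (Fintype.card G * T ^ d)) := by ring
  linarith

end SingleScale

theorem exists_sub_succ_le {E : ℕ → ℝ} {V ε : ℝ} {J : ℕ} (hJ : 0 < J) (h0 : ∀ j, 0 ≤ E j)
    (hV : ∀ j, E j ≤ V) (hε : V ≤ J * ε) : ∃ j < J, E j - E (j + 1) ≤ ε := by
  by_contra! h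
  have h1 : ∑ _j ∈ Finset.range J, ε < ∑ j ∈ Finset.range J, (E j - E (j + 1)) :=
    Finset.sum_lt_sum_of_nonempty ⟨0, Finset.mem_range.2 hJ⟩ fun j hj => h j (Finset.mem_range.1 hj)
  rw [Finset.sum_range_sub'] at h1
  simp only [Finset.sum_const, Finset.card_range, nsmul_eq_mul] at h1
  linarith [h0 J, hV 0]

theorem le_of_forall_mul_le_succ {M c : ℝ} (hM : 1 ≤ M) (hc : 0 ≤ c) {T : ℕ → ℝ} (h0 : c ≤ T 0)
    (h : ∀ j, M * T j ≤ T (j + 1)) (j : ℕ) : c ≤ T j := by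
  induction j with
  | zero => exact h0
  | succ j ih => exact ih.trans ((le_mul_of_one_le_left (hc.trans ih) hM).trans (h j))

set_option maxHeartbeats 1000000 in
/-- Among boundedly many well separated scales, at least one carries many weighted progressions. -/
theorem exists_le_fejerCount {p : ℝ} (hp : 1 ≤ p) {d : ℕ} (hd : 0 < d) {δ : ℝ} (hδ : 0 < δ) :
    ∃ c : ℝ, 0 < c ∧ ∀ n : ℕ, 1 ≤ n → ∃ (J : ℕ) (M T₁ : ℝ), 1 ≤ M ∧ ∀ T : ℕ → ℝ, T₁ ≤ T 0 →
      (∀ j, M * T j ≤ T (j + 1)) → ∀ (G : Type) [AddCommGroup G] [Fintype G]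
      (ρ : (Fin d → ℤ) →+ G) (f : G → ℝ), (∀ x, f x = 0 ∨ f x = 1) →
      δ * Fintype.card G ≤ ∑ x, f x →
      ∃ j < J, c * (Fintype.card G * T j ^ d) ≤ fejerCount n p (T j) ρ f := by
  obtain ⟨q, c₂, hq, hc₂, hR⟩ := exists_le_sum_kerCorr_boxKer d hδ
  obtain ⟨c₁, hc₁, hW⟩ := exists_le_sum_fejer hp hd
  refine ⟨c₁ * c₂ / 4, by positivity, fun n hn => ?_⟩
  obtain ⟨T₂, hT₂⟩ := hW n hn
  have hn0 : (1 : ℝ) ≤ n := by exact_mod_cast hn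
  have hd0 : (1 : ℝ) ≤ d := by exact_mod_cast hd
  have hq0 : (1 : ℝ) ≤ q := by exact_mod_cast hq
  have hp0 : 0 < p := by linarith
  obtain ⟨ε, hε, hε1, hεn⟩ : ∃ ε : ℝ, 0 < ε ∧ ε ≤ 1 ∧ 2 * ε * (n * 2 ^ d) ≤ c₁ * c₂ / 4 := by
    have h : (0 : ℝ) < n * 2 ^ d := by positivity
    refine ⟨min 1 (c₁ * c₂ / 4 / (2 * (n * 2 ^ d))), by positivity, min_le_left _ _, ?_⟩
    calc _ ≤ 2 * (c₁ * c₂ / 4 / (2 * (n * 2 ^ d))) * (n * 2 ^ d) := by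
          gcongr; exact min_le_right _ _
      _ = _ := by field_simp
  obtain ⟨η, hη⟩ : ∃ η : ℝ, η = ε ^ 4 / 1000 := ⟨_, rfl⟩
  have hη0 : 0 < η := by rw [hη]; positivity
  have hη1 : η ≤ 1 := by
    have : ε ^ 4 ≤ 1 := pow_le_one₀ hε.le hε1
    rw [hη]; linarith
  obtain ⟨J, hJ⟩ := exists_nat_gt (1 / η)
  have hJ0 : 0 < J := by
    have : (0 : ℝ) < J := lt_trans (by positivity) hJ
    exact_mod_cast this
  have hJη : 1 ≤ J * η := by rw [div_lt_iff₀ hη0] at hJ; exact hJ.le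
  obtain ⟨K, hK1, hKa, hKb, hKc⟩ : ∃ K : ℝ, 1 ≤ K ∧
      (2 * n ^ 2 * p + 2 * n) * (2 * d) * 2 ^ d ≤ K * (η * c₁) ∧ 2 * d ≤ K * η ∧
      4 * d ≤ K * c₂ := by
    set x := (2 * n ^ 2 * p + 2 * n) * (2 * d) * 2 ^ d with hx
    have hx0 : 0 < x := by positivity
    have e1 : 0 ≤ x / (η * c₁) := by positivity
    have e2 : 0 ≤ 2 * d / η := by positivity
    have e3 : 0 ≤ 4 * d / c₂ := by positivity
    refine ⟨1 + x / (η * c₁) + 2 * d / η + 4 * d / c₂, by linarith, ?_, ?_, ?_⟩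
    · rw [← div_le_iff₀ (by positivity)]; linarith
    · rw [← div_le_iff₀ (by positivity)]; linarith
    · rw [← div_le_iff₀ (by positivity)]; linarith
  have hK0 : 0 < K := by linarith
  have hM1 : 1 ≤ 16 * (d * q * K ^ 2) / η := by
    rw [le_div_iff₀ hη0]
    have : 1 ≤ d * q * K ^ 2 :=
      one_le_mul_of_one_le_of_one_le (one_le_mul_of_one_le_of_one_le hd0 hq0) (one_le_pow₀ hK1)
    linarith
  refine ⟨J, 16 * (d * q * K ^ 2) / η, max (2 * K) T₂, hM1, ?_⟩
  intro T hT0 hTM G _ _ ρ f hf hsum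
  have hM : ∀ j, 16 * (d * q * K ^ 2) * T j ≤ η * T (j + 1) := fun j => by
    have := hTM j
    rwa [div_mul_eq_mul_div, div_le_iff₀' hη0] at this
  have hTj : ∀ j, max (2 * K) T₂ ≤ T j :=
    le_of_forall_mul_le_succ hM1 (le_max_of_le_left (by positivity)) hT0 hTM
  have hTK : ∀ j, 2 * K ≤ T j := fun j => (le_max_left _ _).trans (hTj j)
  have hTpos : ∀ j, 0 < T j := fun j => by linarith [hTK j]
  set a : ℕ → ℕ := fun j => ⌊T j / K⌋₊ with ha
  have hale : ∀ j, (a j : ℝ) * K ≤ T j := fun j => by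
    rw [← le_div_iff₀ hK0]
    exact Nat.floor_le (div_pos (hTpos j) hK0).le
  have hage : ∀ j, T j ≤ 2 * K * a j := fun j => by
    have h1 : T j / K < a j + 1 := Nat.lt_floor_add_one _
    rw [div_lt_iff₀ hK0] at h1
    linarith [hTK j]
  have ha0 : ∀ j, 0 < a j := fun j => Nat.floor_pos.2 (by
    rw [le_div_iff₀ hK0]; linarith [hTK j])
  have hV0 : (0 : ℝ) < Fintype.card G := Nat.cast_pos.2 Fintype.card_pos
  have hf1 : ∀ x, |f x| ≤ 1 := fun x => by rcases hf x with h | h <;> simp [h]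
  obtain ⟨j, hj, hE⟩ := exists_sub_succ_le (V := Fintype.card G) (ε := η * Fintype.card G)
    (E := fun j => boxEnergy f (boxKer ρ (a j)) (boxKer ρ (a j))) hJ0
    (fun j => boxEnergy_nonneg (isProbKer_boxKer ρ (ha0 j)) f)
    (fun j => boxEnergy_le (isProbKer_boxKer ρ (ha0 j)) hf1)
    (by rw [← mul_assoc]; exact le_mul_of_one_le_left hV0.le hJη)
  refine ⟨j, hj, ?_⟩
  set l : ℕ := ⌈K * T j⌉₊ with hl
  have hKT : 1 ≤ K * T j :=
    one_le_mul_of_one_le_of_one_le hK1 (by linarith [hTK j])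
  have hl1 : K * T j ≤ l := Nat.le_ceil _
  have hl2 : (l : ℝ) ≤ 2 * (K * T j) := by
    have := Nat.ceil_lt_add_one (a := K * T j) (by linarith)
    linarith
  have hl0 : 0 < l := Nat.ceil_pos.2 (by linarith)
  have hb1 : K * T j ≤ (2 * q * l : ℕ) := by
    push_cast
    nlinarith
  have hb2 : ((2 * q * l : ℕ) : ℝ) ≤ 4 * (q * K * T j) := by
    push_cast
    nlinarith
  have hb0 : 0 < 2 * q * l := by positivity
  have hbR : (0 : ℝ) < (2 * q * l : ℕ) := by exact_mod_cast hb0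
  have hc0 : (0 : ℝ) < a (j + 1) := by exact_mod_cast ha0 (j + 1)
  have hcge : 8 * (d * (q * K * T j)) ≤ η * a (j + 1) := by
    have h1 := hM j
    have h2 := mul_le_mul_of_nonneg_left (hage (j + 1)) hη0.le
    refine le_of_mul_le_mul_left ?_ (by positivity : 0 < 2 * K)
    linarith
  have hqK : T j ≤ q * K * T j :=
    le_mul_of_one_le_left (hTpos j).le (one_le_mul_of_one_le_of_one_le hq0 hK1)
  have haT : (a j : ℝ) ≤ T j := 
    (le_mul_of_one_le_right (Nat.cast_nonneg _) hK1).trans (hale j)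
  have hdT : d * T j ≤ d * (q * K * T j) := by gcongr
  have hdT0 : 0 < d * T j := mul_pos (by linarith) (hTpos j)
  have hdaT : d * (a j : ℝ) ≤ d * T j := by gcongr
  refine le_fejerCount_of_boxEnergy_sub_le hp (by linarith [hTK j]) hd ρ hf (ha0 j) hb0
    (ha0 (j + 1)) hη0.le hε hε1 hη.le hc₂.le (hT₂ _ ((le_max_right _ _).trans (hTj j)))
    (hR G f hf hsum ρ l hl0) ?_ ?_ ?_ ?_ ?_ ?_ hεn (by rw [← hη]; exact hE)
  · have h : 2 * (d * (a j : ℝ)) / T j ≤ 2 * d / K := by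
      rw [div_le_div_iff₀ (hTpos j) hK0]
      calc 2 * (d * (a j : ℝ)) * K = 2 * d * (a j * K) := by ring
        _ ≤ _ := by gcongr; exact hale j
    calc _ ≤ (2 * n ^ 2 * p + 2 * n) * (2 * d / K) * 2 ^ d := by gcongr
      _ = (2 * n ^ 2 * p + 2 * n) * (2 * d) * 2 ^ d / K := by ring
      _ ≤ _ := by rw [div_le_iff₀' hK0]; exact hKa
  · rw [div_le_iff₀ hbR]
    calc 2 * (d * (a j : ℝ)) ≤ 2 * d * T j := by linarith
      _ ≤ K * η * T j := by have := hTpos j; gcongr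
      _ = η * (K * T j) := by ring
      _ ≤ _ := by gcongr
  · rw [div_le_iff₀ hc0]
    linarith
  · rw [div_le_iff₀ hc0]
    calc 2 * (d * ((2 * q * l : ℕ) : ℝ)) ≤ 2 * (d * (4 * (q * K * T j))) := by gcongr
      _ = 8 * (d * (q * K * T j)) := by ring
      _ ≤ _ := hcge
  · rw [div_le_iff₀ hc0]
    linarith
  · rw [div_le_iff₀ hbR]
    calc 4 * (d * T j) = 4 * d * T j := by ring
      _ ≤ K * c₂ * T j := by have := hTpos j; gcongr
      _ = c₂ * (K * T j) := by ring
      _ ≤ _ := by gcongr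

/-- A dense subset of a finite abelian group contains a three-term progression whose gap comes from
an integer vector of prescribed approximate `ℓ^p` norm, at one of boundedly many given scales. -/
theorem exists_three_term_AP_of_dense {p : ℝ} (hp : 1 < p) (hp2 : p ≠ 2) {d : ℕ} (hd : 36 ≤ d)
    {δ : ℝ} (hδ : 0 < δ) : ∃ (J : ℕ) (M : ℝ), 1 ≤ M ∧ ∀ κ : ℝ, 0 < κ → ∃ T₀ : ℝ, 1 ≤ T₀ ∧
      ∀ T : ℕ → ℝ, T₀ ≤ T 0 → (∀ j, M * T j ≤ T (j + 1)) →
      ∀ (G : Type) [AddCommGroup G] [Fintype G] (ρ : (Fin d → ℤ) →+ G) (A : Finset G),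
      δ * Fintype.card G ≤ A.card →
      ∃ j < J, ∃ x ∈ A, ∃ s : Fin d → ℤ, (∀ i, T j ≤ s i ∧ (s i : ℝ) < 2 * T j) ∧
        |∑ i, ((s i : ℝ) / T j) ^ p - d * (3 / 2) ^ p| < κ ∧ x + ρ s ∈ A ∧ x + ρ s + ρ s ∈ A := by
  classical
  have hd0 : 0 < d := by omega
  have hdR : (0 : ℝ) < d := by exact_mod_cast hd0
  obtain ⟨c, hc, hlow⟩ := exists_le_fejerCount hp.le hd0 hδ
  obtain ⟨C, hC, hdiff⟩ := exists_abs_fejerCount_sub_le (p := p) (by linarith) hp.ne' hp2 hd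
  obtain ⟨n, hn⟩ := exists_nat_gt (4 * C / c)
  have hn0 : (0 : ℝ) < n := lt_trans (by positivity) hn
  have hCn : C / n ≤ c / 4 := by
    rw [div_lt_iff₀ hc] at hn
    rw [div_le_div_iff₀ hn0 (by norm_num)]
    linarith
  have hn1 : 1 ≤ n := by exact_mod_cast hn0
  obtain ⟨J, M, T₁, hM, hJ⟩ := hlow n hn1
  refine ⟨J, M, hM, fun κ hκ => ?_⟩
  set Q : ℝ := 16 * (d * 2 ^ p) ^ 2 * 2 ^ d with hQ
  have hQ0 : 0 < Q := by positivity
  obtain ⟨m', hm'⟩ := exists_nat_gt (4 * Q / (c * κ ^ 2))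
  set m := max n m' with hm
  have hmn : n ≤ m := le_max_left _ _
  have hm0 : (0 : ℝ) < m := lt_of_lt_of_le hn0 (by exact_mod_cast hmn)
  have hQm : Q / (m * κ ^ 2) ≤ c / 4 := by
    have h : 4 * Q / (c * κ ^ 2) ≤ m := hm'.le.trans (by exact_mod_cast le_max_right _ _)
    rw [div_le_iff₀ (by positivity)] at h
    rw [div_le_div_iff₀ (by positivity) (by norm_num)]
    linarith
  obtain ⟨T₂, hT₂⟩ := hdiff n m hn1 hmn
  refine ⟨max 1 (max T₁ T₂), le_max_left _ _, fun T hT hTM G _ _ ρ A hA => ?_⟩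
  have hTj := le_of_forall_mul_le_succ hM (zero_le_one.trans (le_max_left _ _)) hT hTM
  set f : G → ℝ := fun x => if x ∈ A then 1 else 0 with hf
  have hf01 : ∀ x, f x = 0 ∨ f x = 1 := fun x => by by_cases h : x ∈ A <;> simp [hf, h]
  have hf1 : ∀ x, |f x| ≤ 1 := fun x => by rcases hf01 x with h | h <;> simp [h]
  obtain ⟨j, hj, hcount⟩ := hJ T (((le_max_left _ _).trans (le_max_right _ _)).trans hT) hTM G ρ f
    hf01 (by simpa [hf] using hA)
  refine ⟨j, hj, ?_⟩
  have hT1 : 1 ≤ T j := (le_max_left _ _).trans (hTj j)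
  by_contra! hcon
  have hup := fejerCount_le_of_forall hp.le hT1 hd0 hκ m ρ hf1 fun s hs hsκ => by
    refine Finset.sum_eq_zero fun x _ => ?_
    by_cases hx : x ∈ A
    · by_cases hx' : x + ρ s ∈ A
      · have := hcon x hx s (mem_blockBox.1 hs) hsκ hx'
        simp [hf, this]
      · simp [hf, hx']
    · simp [hf, hx]
  have hd' := (abs_le.1 (hT₂ (T j) (((le_max_right _ _).trans (le_max_right _ _)).trans (hTj j))
    G ρ f hf1)).1
  have hV : (0 : ℝ) < Fintype.card G * T j ^ d :=
    mul_pos (Nat.cast_pos.2 Fintype.card_pos) (pow_pos (by linarith) _)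
  have e1 : 16 * (d * 2 ^ p) ^ 2 / (m * κ ^ 2) * (Fintype.card G * (2 * T j) ^ d)
      = Q / (m * κ ^ 2) * (Fintype.card G * T j ^ d) := by
    rw [hQ, mul_pow 2 (T j)]; ring
  rw [e1] at hup
  have h1 := mul_le_mul_of_nonneg_right hQm hV.le
  have h2 := mul_le_mul_of_nonneg_right hCn hV.le
  have h3 := mul_pos hc hV
  linarith

section Transfer

variable {d : ℕ}

/-- A bounded set of large volume meets some translate of a lattice in many points. -/
theorem exists_le_card_lattice {η N v : ℝ} (hη : 0 < η) {K : Set (Fin d → ℝ)}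
    (hK : MeasurableSet K) {x₀ : Fin d → ℝ} (hKN : K ⊆ Set.Icc x₀ (x₀ + fun _ => N))
    (hv : ENNReal.ofReal v < volume K) {Q : ℕ} (hQ : N / η < Q) :
    ∃ y : Fin d → ℝ, ∃ S ⊆ intBox d 0 Q, v ≤ S.card * η ^ d ∧
      ∀ n ∈ S, (y + fun i => η * (n i : ℝ)) ∈ K := by
  classical
  by_contra! hcon
  set S : (Fin d → ℝ) → Finset (Fin d → ℤ) := fun y =>
    (intBox d 0 Q).filter fun n => (y + fun i => η * (n i : ℝ)) ∈ K with hS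
  have hcard : ∀ y, (S y).card * η ^ d < v := fun y => by
    by_contra! h
    obtain ⟨n, hn, hn'⟩ := hcon y (S y) (Finset.filter_subset _ _) h
    exact hn' (Finset.mem_filter.1 hn).2
  have hv0 : 0 < v := lt_of_le_of_lt (by positivity) (hcard x₀)
  set τ : (Fin d → ℤ) → Fin d → ℝ := fun n i => η * (n i : ℝ) with hτ
  set D : Set (Fin d → ℝ) := Set.Icc x₀ (x₀ + fun _ => η) with hD
  have hKm : ∀ n, MeasurableSet ((fun y => y + τ n) ⁻¹' K) := fun n =>
    measurable_add_const (τ n) hK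
  have hcover : K ⊆ ⋃ n ∈ intBox d 0 Q, (fun x => x + -τ n) ⁻¹' (((fun y => y + τ n) ⁻¹' K) ∩ D) := by
    intro x hx
    have hx' := hKN hx
    have h0 : ∀ i, 0 ≤ (x i - x₀ i) / η := fun i => div_nonneg (sub_nonneg.2 (hx'.1 i)) hη.le
    refine Set.mem_biUnion (x := fun i => ⌊(x i - x₀ i) / η⌋) (mem_intBox.2 fun i =>
      ⟨Int.floor_nonneg.2 (h0 i), Int.floor_lt.2 ?_⟩) ⟨?_, ?_, ?_⟩
    · have h2 : x i ≤ x₀ i + N := hx'.2 i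
      refine lt_of_le_of_lt ?_ (by exact_mod_cast hQ)
      gcongr
      linarith
    · simpa using hx
    · intro i
      have := (le_div_iff₀' hη).1 (Int.floor_le ((x i - x₀ i) / η))
      simp only [hτ, Pi.add_apply, Pi.neg_apply]
      linarith
    · intro i
      have := (div_lt_iff₀' hη).1 (Int.lt_floor_add_one ((x i - x₀ i) / η))
      simp only [hτ, Pi.add_apply, Pi.neg_apply]
      linarith
  have hle : volume K ≤ ENNReal.ofReal v := by
    calc volume K ≤ ∑ n ∈ intBox d 0 Q,
          volume ((fun x => x + -τ n) ⁻¹' (((fun y => y + τ n) ⁻¹' K) ∩ D)) :=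
        (measure_mono hcover).trans (measure_biUnion_finset_le _ _)
      _ = ∑ n ∈ intBox d 0 Q, ∫⁻ y in D, ((fun y => y + τ n) ⁻¹' K).indicator 1 y := by
        refine Finset.sum_congr rfl fun n _ => ?_
        rw [measure_preimage_add_right, lintegral_indicator_one (hKm n),
          Measure.restrict_apply (hKm n)]
      _ = ∫⁻ y in D, ∑ n ∈ intBox d 0 Q, ((fun y => y + τ n) ⁻¹' K).indicator 1 y := by
        rw [lintegral_finsetSum]
        exact fun n _ => measurable_one.indicator (hKm n)
      _ ≤ ∫⁻ _y in D, ENNReal.ofReal (v / η ^ d) := by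
        refine lintegral_mono fun y => ?_
        have e : ∑ n ∈ intBox d 0 Q, ((fun y => y + τ n) ⁻¹' K).indicator (1 : (Fin d → ℝ) → ℝ≥0∞) y
            = ((S y).card : ℝ≥0∞) := by
          simp [Set.indicator_apply, hS, hτ]
        rw [e, ← ENNReal.ofReal_natCast]
        refine ENNReal.ofReal_le_ofReal ?_
        rw [le_div_iff₀ (by positivity)]
        exact (hcard y).le
      _ = ENNReal.ofReal v := by
        rw [setLIntegral_const, hD, Real.volume_Icc_pi]
        simp only [Pi.add_apply, add_sub_cancel_left, Finset.prod_const, Finset.card_univ,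
          Fintype.card_fin]
        rw [← ENNReal.ofReal_pow hη.le, ← ENNReal.ofReal_mul (by positivity),
          div_mul_cancel₀ _ (by positivity)]
  exact absurd hv hle.not_gt

/-- Progressions modulo `2 * Q` inside a box of side `Q` with short gaps are genuine. -/
theorem exists_mem_of_mem_image_compLeft {Q : ℕ} {S : Finset (Fin d → ℤ)} (hS : S ⊆ intBox d 0 Q)
    {s : Fin d → ℤ} (hs : ∀ i, 0 ≤ s i ∧ s i ≤ Q) {x : Fin d → ZMod (2 * Q)}
    {ρ : (Fin d → ℤ) →+ (Fin d → ZMod (2 * Q))} (hρ : ρ = (Int.castAddHom _).compLeft (Fin d))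
    (h0 : ∃ a ∈ S, ρ a = x) (h1 : ∃ a ∈ S, ρ a = x + ρ s) (h2 : ∃ a ∈ S, ρ a = x + ρ s + ρ s) :
    ∃ a ∈ S, a + s ∈ S ∧ a + s + s ∈ S := by
  have key : ∀ a ∈ S, ∀ b ∈ S, ρ b = ρ a + ρ s → b = a + s := by
    intro a ha b hb h
    funext i
    have hi := congrFun h i
    rw [hρ] at hi
    simp only [Pi.add_apply, AddMonoidHom.compLeft_apply, Function.comp_apply,
      Int.coe_castAddHom] at hi ⊢
    rw [← Int.cast_add, ZMod.intCast_eq_intCast_iff_dvd_sub] at hi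
    obtain ⟨k, hk⟩ := hi
    have ha' := mem_intBox.1 (hS ha) i
    have hb' := mem_intBox.1 (hS hb) i
    have hs' := hs i
    push_cast at hk
    have hk0 : k = 0 := by
      have l1 : k < 1 := by
        by_contra! hk1
        nlinarith
      have l2 : -1 < k := by
        by_contra! hk1
        nlinarith
      omega
    rw [hk0] at hk
    omega
  obtain ⟨a, ha, rfl⟩ := h0
  obtain ⟨b, hb, h1⟩ := h1
  obtain ⟨c, hc, h2⟩ := h2
  have eb := key a ha b hb h1
  have ec := key b hb c hc (by rw [h1, h2])
  exact ⟨a, ha, eb ▸ hb, by rw [← eb, ← ec]; exact hc⟩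

theorem card_image_compLeft_intCast {Q : ℕ} {S : Finset (Fin d → ℤ)} (hS : S ⊆ intBox d 0 Q) :
    (S.image ((Int.castAddHom (ZMod (2 * Q))).compLeft (Fin d))).card = S.card := by
  refine Finset.card_image_of_injOn fun a ha b hb h => ?_
  funext i
  have hi := congrFun h i
  simp only [AddMonoidHom.compLeft_apply, Function.comp_apply, Int.coe_castAddHom] at hi
  have ha' := mem_intBox.1 (hS ha) i
  have hb' := mem_intBox.1 (hS hb) i
  rw [ZMod.intCast_eq_intCast_iff] at hi
  push_cast at hi
  have := Int.ModEq.of_mul_left 2 hi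
  rw [Int.ModEq, Int.emod_eq_of_lt ha'.1 ha'.2, Int.emod_eq_of_lt hb'.1 hb'.2] at this
  exact this

theorem lpNorm_eq_of_sum_eq {p lam : ℝ} (hp : 0 < p) (hlam : 0 ≤ lam) {s : Fin d → ℝ}
    (h : ∑ i, |s i| ^ p = lam ^ p) : lpNorm p s = lam := by
  rw [_root_.lpNorm, h, ← Real.rpow_mul hlam, mul_one_div_cancel hp.ne', Real.rpow_one]

/-- If a compact set has no progression with gap of norm `lam`, then its gaps stay away from
norm `lam`. -/
theorem exists_le_abs_sub_of_isCompact {p lam c : ℝ} (hp : 0 < p) (hlam : 0 < lam) (hc : 0 < c)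
    {K : Set (Fin d → ℝ)} (hK : IsCompact K)
    (h : ∀ x s, x ∈ K → x + s ∈ K → x + s + s ∈ K → lpNorm p s ≠ lam) :
    ∃ κ : ℝ, 0 < κ ∧ ∀ x s, x ∈ K → x + s ∈ K → x + s + s ∈ K →
      κ ≤ |c / lam ^ p * ∑ i, |s i| ^ p - c| := by
  set g : (Fin d → ℝ) × (Fin d → ℝ) → ℝ := fun z =>
    |c / lam ^ p * ∑ i, |z.2 i - z.1 i| ^ p - c| with hg
  have hgc : Continuous g := by
    refine ((continuous_const.mul (continuous_finsetSum _ fun i _ => ?_)).sub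
      continuous_const).abs
    refine Continuous.rpow_const ?_ fun _ => Or.inr hp.le
    fun_prop
  set Ω : Set ((Fin d → ℝ) × (Fin d → ℝ)) := (K ×ˢ K) ∩ {z | z.2 + (z.2 - z.1) ∈ K} with hΩ
  have hΩc : IsCompact Ω := (hK.prod hK).inter_right (hK.isClosed.preimage (by fun_prop))
  have hmem : ∀ x s, x ∈ K → x + s ∈ K → x + s + s ∈ K → (x, x + s) ∈ Ω := fun x s h1 h2 h3 =>
    ⟨⟨h1, h2⟩, by simpa using h3⟩
  have hval : ∀ x s, g (x, x + s) = |c / lam ^ p * ∑ i, |s i| ^ p - c| := fun x s => by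
    simp [hg]
  rcases Ω.eq_empty_or_nonempty with hΩe | hΩn
  · refine ⟨1, one_pos, fun x s h1 h2 h3 => ?_⟩
    have := hmem x s h1 h2 h3
    rw [hΩe] at this
    exact this.elim
  obtain ⟨⟨x, y⟩, hz, hmin⟩ := hΩc.exists_isMinOn hΩn hgc.continuousOn
  refine ⟨g (x, y), abs_pos.2 fun h0 => ?_, fun x' s h1 h2 h3 => ?_⟩
  · refine h x (y - x) hz.1.1 (by simpa using hz.1.2) (by simpa using hz.2) ?_
    have hl : 0 < lam ^ p := Real.rpow_pos_of_pos hlam p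
    refine lpNorm_eq_of_sum_eq hp hlam.le ?_
    simp only [Pi.sub_apply]
    have h1 : c / lam ^ p * ∑ i, |y i - x i| ^ p = c := sub_eq_zero.1 h0
    field_simp at h1
    exact h1
  · rw [← hval x']
    exact hmin (hmem x' s h1 h2 h3)

theorem exists_forall_lt_le {P : ℕ → ℝ → Prop} (hP : ∀ j κ κ', κ' ≤ κ → P j κ → P j κ')
    (h : ∀ j, ∃ κ : ℝ, 0 < κ ∧ P j κ) (J : ℕ) : ∃ κ : ℝ, 0 < κ ∧ ∀ j < J, P j κ := by
  induction J with
  | zero => exact ⟨1, one_pos, fun j hj => absurd hj (Nat.not_lt_zero j)⟩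
  | succ J ih =>
    obtain ⟨κ, hκ, H⟩ := ih
    obtain ⟨κ', hκ', H'⟩ := h J
    refine ⟨min κ κ', lt_min hκ hκ', fun j hj => ?_⟩
    rcases Nat.lt_succ_iff_lt_or_eq.1 hj with hj | rfl
    · exact hP _ _ _ (min_le_left _ _) (H j hj)
    · exact hP _ _ _ (min_le_right _ _) H'

/-- A compact set filling a positive proportion of a large cube contains a progression at one of
boundedly many well separated scales. -/
theorem exists_three_term_AP_of_isCompact {p : ℝ} (hp : 1 < p) (hp2 : p ≠ 2) (hd : 36 ≤ d)
    {δ : ℝ} (hδ : 0 < δ) : ∃ (J : ℕ) (M : ℝ), 1 ≤ M ∧ ∀ lam : ℕ → ℝ, 0 < lam 0 →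
      (∀ j, M * lam j ≤ lam (j + 1)) → ∀ N : ℝ, (∀ j ≤ J, 2 * lam j ≤ N) →
      ∀ K : Set (Fin d → ℝ), IsCompact K → ∀ x₀, K ⊆ Set.Icc x₀ (x₀ + fun _ => N) →
      ENNReal.ofReal (δ * N ^ d) < volume K →
      ∃ j < J, ∃ x s, x ∈ K ∧ x + s ∈ K ∧ x + s + s ∈ K ∧ lpNorm p s = lam j := by
  classical
  have hp0 : 0 < p := by linarith
  obtain ⟨J, M, hM, H⟩ := exists_three_term_AP_of_dense hp hp2 hd (δ := δ / 4 ^ d) (by positivity)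
  refine ⟨J, M, hM, fun lam hlam0 hlamM N hN K hK x₀ hKN hvol => ?_⟩
  by_contra! hcon
  have hlamle := le_of_forall_mul_le_succ hM hlam0.le le_rfl hlamM
  have hlam : ∀ j, 0 < lam j := fun j => hlam0.trans_le (hlamle j)
  have hdR : (36 : ℝ) ≤ d := by exact_mod_cast hd
  set c : ℝ := d * (3 / 2) ^ p with hc
  have hc1 : 1 ≤ c := by
    have h : (1 : ℝ) ≤ (3 / 2) ^ p := Real.one_le_rpow (by norm_num) hp0.le
    exact one_le_mul_of_one_le_of_one_le (by linarith) h
  have hc0 : 0 < c := by linarith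
  obtain ⟨κ, hκ, hsep⟩ := exists_forall_lt_le (J := J)
    (P := fun j κ => j < J → ∀ x s, x ∈ K → x + s ∈ K → x + s + s ∈ K →
      κ ≤ |c / lam j ^ p * ∑ i, |s i| ^ p - c|)
    (fun j κ κ' hκ h hj x s h1 h2 h3 => hκ.trans (h hj x s h1 h2 h3))
    (fun j => by
      by_cases hj : j < J
      · obtain ⟨κ, hκ, h⟩ := exists_le_abs_sub_of_isCompact hp0 (hlam j) hc0 hK (hcon j hj)
        exact ⟨κ, hκ, fun _ => h⟩
      · exact ⟨1, one_pos, fun h => absurd h hj⟩)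
  obtain ⟨T₀, hT₀, HT⟩ := H κ hκ
  obtain ⟨r, hr⟩ : ∃ r, r = c ^ (1 / p) := ⟨_, rfl⟩
  have hr1 : 1 ≤ r := hr ▸ Real.one_le_rpow hc1 (by positivity)
  have hrp : r ^ p = c := by
    rw [hr, ← Real.rpow_mul hc0.le, one_div_mul_cancel hp0.ne', Real.rpow_one]
  have hr0 : 0 < r := by linarith
  have hT₀0 : 0 < T₀ := by linarith
  obtain ⟨η, hη⟩ : ∃ η, η = lam 0 / (r * T₀) := ⟨_, rfl⟩
  have hη0 : 0 < η := hη ▸ by positivity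
  set T : ℕ → ℝ := fun j => T₀ * lam j / lam 0 with hT
  have hTpos : ∀ j, 0 < T j := fun j => by have := hlam j; positivity
  have hTη : ∀ j, r * η * T j = lam j := fun j => by
    rw [hη, hT]
    field_simp
  have hηT : ∀ j, η * T j ≤ lam j := fun j => by
    rw [← hTη j, mul_assoc]
    exact le_mul_of_one_le_left (mul_pos hη0 (hTpos j)).le hr1
  have hT0 : T 0 = T₀ := by simp only [hT]; field_simp
  have hN0 : 0 < N := by linarith [hN 0 (Nat.zero_le _)]
  have hηN : 1 ≤ N / η := by
    rw [le_div_iff₀ hη0, one_mul]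
    have h := hηT 0
    rw [hT0] at h
    nlinarith [hN 0 (Nat.zero_le _)]
  set Q : ℕ := ⌊N / η⌋₊ + 1 with hQ
  have hQ1 : N / η < Q := by rw [hQ]; push_cast; exact Nat.lt_floor_add_one _
  have hQ2 : Q * η ≤ 2 * N := by
    have h : (Q : ℝ) ≤ N / η + N / η := by
      rw [hQ]
      push_cast
      exact add_le_add (Nat.floor_le (by linarith)) hηN
    calc Q * η ≤ (N / η + N / η) * η := by gcongr
      _ = 2 * N := by field_simp; ring
  obtain ⟨y, S, hS, hcard, hSK⟩ := exists_le_card_lattice hη0 hK.measurableSet hKN hvol hQ1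
  have : NeZero (2 * Q) := ⟨by omega⟩
  obtain ⟨ρ, hρ⟩ : ∃ ρ, ρ = (Int.castAddHom (ZMod (2 * Q))).compLeft (Fin d) := ⟨_, rfl⟩
  obtain ⟨j, hj, x, hx, s, hs, hsκ, h1, h2⟩ := HT T hT0.ge
    (fun j => by
      simp only [hT]
      rw [← mul_div_assoc, mul_left_comm]
      gcongr
      exact hlamM j) (Fin d → ZMod (2 * Q)) ρ (S.image ρ) (by
      rw [hρ, card_image_compLeft_intCast hS]
      simp only [Fintype.card_fun, ZMod.card, Fintype.card_fin]
      refine le_of_mul_le_mul_right (le_trans ?_ hcard) (pow_pos hη0 d)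
      push_cast
      calc δ / 4 ^ d * (2 * Q) ^ d * η ^ d = δ / 4 ^ d * (2 * (Q * η)) ^ d := by
            rw [mul_assoc, ← mul_pow, mul_assoc]
        _ ≤ δ / 4 ^ d * (2 * (2 * N)) ^ d := by gcongr
        _ = δ / 4 ^ d * (4 ^ d * N ^ d) := by rw [← mul_pow]; ring_nf
        _ = δ * N ^ d := by field_simp)
  have hsQ : ∀ i, 0 ≤ s i ∧ s i ≤ Q := fun i => by
    obtain ⟨l, u⟩ := hs i
    constructor
    · exact_mod_cast (hTpos j).le.trans l
    · have h : 2 * T j ≤ N / η := by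
        rw [le_div_iff₀ hη0]
        linarith [hηT j, hN j hj.le]
      exact_mod_cast (u.le.trans h).trans hQ1.le
  obtain ⟨a, ha, ha1, ha2⟩ := exists_mem_of_mem_image_compLeft hS hsQ hρ
    (Finset.mem_image.1 hx) (Finset.mem_image.1 h1) (Finset.mem_image.1 h2)
  have hsep' := hsep j hj hj (y + fun i => η * (a i : ℝ)) (fun i => η * (s i : ℝ)) (hSK a ha)
    (by
      convert hSK _ ha1 using 1
      funext i
      simp only [Pi.add_apply]
      push_cast
      ring)
    (by
      convert hSK _ ha2 using 1
      funext i
      simp only [Pi.add_apply]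
      push_cast
      ring)
  refine absurd hsκ (not_lt.2 (hsep'.trans_eq ?_))
  congr 2
  rw [Finset.mul_sum]
  refine Finset.sum_congr rfl fun i _ => ?_
  have hs0 : (0 : ℝ) ≤ s i := by exact_mod_cast (hsQ i).1
  have hl : 0 < lam j ^ p := Real.rpow_pos_of_pos (hlam j) p
  rw [abs_of_nonneg (by positivity), ← hrp, div_mul_eq_mul_div, ← Real.mul_rpow hr0.le (by positivity),
    ← Real.div_rpow (by positivity) (hlam j).le]
  congr 1
  rw [← hTη j]
  have := hTpos j
  field_simp

theorem exists_mul_pow_lt_volume {A : Set (Fin d → ℝ)} {δ : ℝ}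
    (hδ : ENNReal.ofReal δ < upperBanachDensity d A) (hδ0 : 0 ≤ δ) (N₀ : ℝ) : ∃ N x, N₀ ≤ N ∧
      ENNReal.ofReal (δ * N ^ d) < volume (A ∩ Set.Icc x (x + fun _ => N)) := by
  have h := (frequently_lt_of_lt_limsup (by isBoundedDefault) hδ).and_eventually
    (eventually_ge_atTop (max 1 N₀))
  obtain ⟨N, hN, hN0⟩ := h.exists
  obtain ⟨x, hx⟩ := lt_iSup_iff.1 hN
  refine ⟨N, x, (le_max_right _ _).trans hN0, ?_⟩
  have hNpos : 0 < N ^ d := pow_pos (lt_of_lt_of_le one_pos ((le_max_left _ _).trans hN0)) d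
  rw [ENNReal.lt_div_iff_mul_lt (Or.inl (ENNReal.ofReal_pos.2 hNpos).ne')
    (Or.inl ENNReal.ofReal_ne_top)] at hx
  rwa [ENNReal.ofReal_mul hδ0]

end Transfer

theorem three_term_APs_all_large_gaps (p : ℝ)
    (hp : p ∈ Set.Ioo (1 : ℝ) 2 ∪ Set.Ioi (2 : ℝ)) :
    ∃ dp : ℕ, 2 ≤ dp ∧ ∀ d : ℕ, dp ≤ d →
      ∀ A : Set (Fin d → ℝ), MeasurableSet A →
        0 < upperBanachDensity d A →
        ∃ lam0 : ℝ, 0 < lam0 ∧ ∀ lam : ℝ, lam0 ≤ lam →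
          ∃ x s : Fin d → ℝ,
            x ∈ A ∧ x + s ∈ A ∧ x + (2 : ℝ) • s ∈ A ∧ lpNorm p s = lam := by
  have hp1 : 1 < p := by
    rcases hp with h | h
    · exact h.1
    · exact one_lt_two.trans h
  have hp2 : p ≠ 2 := by
    rcases hp with h | h
    · exact h.2.ne
    · exact ne_of_gt h
  refine ⟨36, by norm_num, fun d hd A hA hdens => ?_⟩
  obtain ⟨δ, hδ0, hδ⟩ : ∃ δ : ℝ, 0 < δ ∧ ENNReal.ofReal δ < upperBanachDensity d A := by
    obtain ⟨r, hr0, hr⟩ := ENNReal.lt_iff_exists_nnreal_btwn.1 hdens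
    exact ⟨r, by exact_mod_cast hr0, by rwa [ENNReal.ofReal_coe_nnreal]⟩
  obtain ⟨J, M, hM, H⟩ := exists_three_term_AP_of_isCompact hp1 hp2 hd hδ0
  by_contra! hcon
  choose g hg hbad using hcon
  have hM0 : 0 < M := by linarith
  let L : ℕ → {r : ℝ // 0 < r} := fun j => Nat.rec ⟨1, one_pos⟩
    (fun _ r => ⟨M * g r.1 r.2, mul_pos hM0 (r.2.trans_le (hg _ _))⟩) j
  set lam : ℕ → ℝ := fun j => g (L j).1 (L j).2 with hlam
  have hlam0 : ∀ j, 0 < lam j := fun j => (L j).2.trans_le (hg _ _)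
  obtain ⟨N, x₀, hN, hvol⟩ := exists_mul_pow_lt_volume hδ hδ0.le
    (∑ j ∈ Finset.range (J + 1), 2 * lam j)
  obtain ⟨K, hKA, hK, hKvol⟩ := (hA.inter measurableSet_Icc).exists_lt_isCompact hvol
  obtain ⟨j, -, x, s, h1, h2, h3, h4⟩ := H lam (hlam0 0) (fun j => hg (L (j + 1)).1 (L (j + 1)).2) N
    (fun j hj => le_trans (Finset.single_le_sum (f := fun j => 2 * lam j)
      (fun i _ => by linarith [hlam0 i]) (Finset.mem_range.2 (Nat.lt_succ_of_le hj))) hN)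
    K hK x₀ (fun z hz => (hKA hz).2) hKvol
  refine hbad _ (L j).2 x s (hKA h1).1 (hKA h2).1 ?_ h4
  rw [two_smul, ← add_assoc]
  exact (hKA h3).1
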